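/- The equation 10y^2 = 10x^5 + 75x^4 + 300x^3 + 450x^2 + 450x + 135, i.e., y^2·1 with Y^2 = 10X^5 + 75X^4 + 300X^3 + 450X^2 + 450X + 135, has no rational solutions. -/

import Mathlib

open Polynomial

/-- The quintic `w⁵ - 5w³ + 5w - 4`. -/
noncomputable def quintic : ℚ[X] := X ^ 5 - 5 * X ^ 3 + 5 * X - 4

lemma quintic_monic : quintic.Monic := by
  unfold quintic; monicity!

lemma quintic_natDegree : quintic.natDegree = 5 := by
  unfold quintic; compute_degree!

lemma irreducible_of_eisenstein_five {a b c d e : ℤ} (h0 : (5 : ℤ) ∣ a) (h1 : (5 : ℤ) ∣ b)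
    (h2 : (5 : ℤ) ∣ c) (h3 : (5 : ℤ) ∣ d) (h4 : (5 : ℤ) ∣ e) (h : ¬ (25 : ℤ) ∣ e) :
    Irreducible (X ^ 5 + C (a : ℚ) * X ^ 4 + C (b : ℚ) * X ^ 3 + C (c : ℚ) * X ^ 2
      + C (d : ℚ) * X + C (e : ℚ) : ℚ[X]) := by
  set p : ℤ[X] := X ^ 5 + C a * X ^ 4 + C b * X ^ 3 + C c * X ^ 2 + C d * X + C e with hp
  have hm : p.Monic := by rw [hp]; monicity!
  have hdeg : p.natDegree = 5 := by rw [hp]; compute_degree!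
  have hco : ∀ n < 5, (5 : ℤ) ∣ p.coeff n := by
    intro n hn
    interval_cases n <;>
      simp only [hp, coeff_add, coeff_C_mul, coeff_X_pow, coeff_X, coeff_C] <;> norm_num <;> assumption
  have hirr : Irreducible p := by
    refine IsEisensteinAt.irreducible (𝓟 := Ideal.span {(5 : ℤ)}) ⟨?_, ?_, ?_⟩ ?_ hm.isPrimitive
      (by omega)
    · rw [hm.leadingCoeff, Ideal.mem_span_singleton]; norm_num
    · intro n hn
      rw [hdeg] at hn
      exact Ideal.mem_span_singleton.2 (hco n hn)
    · rw [Ideal.span_singleton_pow, Ideal.mem_span_singleton]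
      simpa [hp] using h
    · exact (Ideal.span_singleton_prime (by norm_num)).2 (Int.prime_ofNat_iff.2 (by norm_num))
  have := (hm.irreducible_iff_irreducible_map_fraction_map (K := ℚ)).1 hirr
  simpa [hp] using this

lemma quintic_irreducible : Irreducible quintic := by
  have h := irreducible_of_eisenstein_five (a := -5) (b := 5) (c := 5) (d := -5) (e := -5)
    (by norm_num) (by norm_num) (by norm_num) (by norm_num) (by norm_num) (by norm_num)
  rw [← MulEquiv.irreducible_iff (algEquivAevalXAddC (-1 : ℚ))]
  convert h using 1
  simp only [quintic, map_sub, map_add, map_mul, map_pow, map_ofNat, algEquivAevalXAddC_apply,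
    aeval_X, map_neg, map_one, Int.cast_neg, Int.cast_ofNat]
  ring

instance : Fact (Irreducible quintic) := ⟨quintic_irreducible⟩

/-- The quintic field `ℚ(w)`. -/
def K : Type := AdjoinRoot quintic

noncomputable instance : Field K := inferInstanceAs (Field (AdjoinRoot quintic))
instance : CharZero K := inferInstanceAs (CharZero (AdjoinRoot quintic))

/-- The generator of `K`. -/
noncomputable def w : K := AdjoinRoot.root quintic

lemma w_pow_five : w ^ 5 = 5 * w ^ 3 - 5 * w + 4 := by
  have h : eval₂ (algebraMap ℚ K) w quintic = 0 := AdjoinRoot.eval₂_root quintic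
  have hw : w ^ 5 - 5 * w ^ 3 + 5 * w - 4 = 0 := by
    simpa only [quintic, eval₂_sub, eval₂_add, eval₂_mul, eval₂_pow, eval₂_X, eval₂_ofNat] using h
  linear_combination hw

/-- The power basis of `K` given by `w`. -/
noncomputable def wBasis : Module.Basis (Fin 5) ℚ K :=
  ((AdjoinRoot.powerBasis' quintic_monic).basis.reindex
    (finCongr (by rw [AdjoinRoot.powerBasis'_dim, quintic_natDegree])) :
    Module.Basis (Fin 5) ℚ (AdjoinRoot quintic))

lemma wBasis_apply (i : Fin 5) : wBasis i = w ^ (i : ℕ) := by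
  have := (AdjoinRoot.powerBasis' quintic_monic).basis_eq_pow
  unfold wBasis w
  erw [Module.Basis.reindex_apply, this]
  rfl

instance : FiniteDimensional ℚ K := wBasis.finiteDimensional_of_finite
instance : NumberField K where

lemma finrank_K : Module.finrank ℚ K = 5 := by
  simp [Module.finrank_eq_card_basis wBasis]

/-- Multiplication by `w` in the basis of powers of `w`. -/
def wMatrix : Matrix (Fin 5) (Fin 5) ℤ :=
  !![0, 0, 0, 0, 4; 1, 0, 0, 0, -5; 0, 1, 0, 0, 0; 0, 0, 1, 0, 5; 0, 0, 0, 1, 0]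

lemma leftMulMatrix_w : Algebra.leftMulMatrix wBasis w = wMatrix.map (Int.castRingHom ℚ) := by
  have key (j : Fin 5) : w * wBasis j = ∑ i, (wMatrix i j : ℚ) • wBasis i := by
    fin_cases j <;> simp [wBasis_apply, Fin.sum_univ_five, wMatrix, Algebra.smul_def] <;>
      first | ring1 | linear_combination w_pow_five
  ext i j
  rw [Algebra.leftMulMatrix_eq_repr_mul, key, map_sum]
  simp [Finsupp.single_apply]

/-- The element with given coordinates. -/
noncomputable def ev (c : Fin 5 → ℤ) : K := c 0 + c 1 * w + c 2 * w ^ 2 + c 3 * w ^ 3 + c 4 * w ^ 4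

lemma norm_ev (c : Fin 5 → ℤ) : Algebra.norm ℚ (ev c) =
    ((c 0 • (1 : Matrix (Fin 5) (Fin 5) ℤ) + c 1 • wMatrix + c 2 • wMatrix ^ 2 + c 3 • wMatrix ^ 3
      + c 4 • wMatrix ^ 4).det : ℤ) := by
  rw [Algebra.norm_eq_matrix_det wBasis, ← eq_intCast (Int.castRingHom ℚ), RingHom.map_det]
  congr 1
  simp only [ev, map_add, map_mul, map_pow, map_intCast, leftMulMatrix_w, RingHom.mapMatrix_apply,
    zsmul_eq_mul, mul_one]

section RingOfIntegers

open NumberField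

/-- The integral generator. -/
noncomputable def W : 𝓞 K := ⟨w, by
  refine ⟨X ^ 5 - 5 * X ^ 3 + 5 * X - 4, by monicity!, ?_⟩
  simp only [eval₂_sub, eval₂_add, eval₂_mul, eval₂_pow, eval₂_X, eval₂_ofNat]
  linear_combination w_pow_five⟩

lemma coe_W : (W : K) = w := rfl

lemma W_pow_five : W ^ 5 = 5 * W ^ 3 - 5 * W + 4 := by
  ext
  simp only [map_add, map_sub, map_mul, map_pow, map_ofNat, coe_W, w_pow_five]

/-- The integer with given coordinates. -/
noncomputable def evO (c : Fin 5 → ℤ) : 𝓞 K :=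
  c 0 + c 1 * W + c 2 * W ^ 2 + c 3 * W ^ 3 + c 4 * W ^ 4

lemma coe_evO (c : Fin 5 → ℤ) : (evO c : K) = ev c := by
  simp [evO, ev, coe_W]

/-- The matrix of multiplication by `evO c`. -/
def mulMatrix (c : Fin 5 → ℤ) : Matrix (Fin 5) (Fin 5) ℤ :=
  c 0 • (1 : Matrix (Fin 5) (Fin 5) ℤ) + c 1 • wMatrix + c 2 • wMatrix ^ 2 + c 3 • wMatrix ^ 3
      + c 4 • wMatrix ^ 4

lemma norm_evO (c : Fin 5 → ℤ) : Algebra.norm ℤ (evO c) = (mulMatrix c).det := by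
  have h := Algebra.coe_norm_int (evO c)
  rw [coe_evO, norm_ev] at h
  exact_mod_cast h

lemma trace_w_pow (n : ℕ) : Algebra.trace ℚ K (w ^ n) = ((wMatrix ^ n).trace : ℤ) := by
  rw [Algebra.trace_eq_matrix_trace wBasis, map_pow, leftMulMatrix_w, ← eq_intCast (Int.castRingHom ℚ),
    ← RingHom.mapMatrix_apply, ← map_pow]
  exact (AddMonoidHom.map_trace (Int.castRingHom ℚ).toAddMonoidHom _).symm

lemma discr_wBasis : Algebra.discr ℚ wBasis = 450000 := by
  have : (Matrix.of fun i j : Fin 5 => (wMatrix ^ (i + j : ℕ)).trace).det = 450000 := by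
    decide +kernel
  rw [Algebra.discr_def]
  have h2 : Algebra.traceMatrix ℚ wBasis = (Matrix.of fun i j : Fin 5 =>
      (wMatrix ^ (i + j : ℕ)).trace).map (Int.castRingHom ℚ) := by
    ext i j
    simp only [Algebra.traceMatrix_apply, Algebra.traceForm_apply, wBasis_apply, ← pow_add,
      trace_w_pow, Matrix.map_apply, Matrix.of_apply, eq_intCast]
  rw [h2, ← RingHom.mapMatrix_apply, ← RingHom.map_det, this]
  norm_num

lemma abs_discr_le : |discr K| ≤ 450000 := by
  classical
  let b := integralBasis K
  let e : Module.Free.ChooseBasisIndex ℤ (𝓞 K) ≃ Fin 5 :=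
    Fintype.equivOfCardEq (by
      rw [← Module.finrank_eq_card_basis b, finrank_K, Fintype.card_fin])
  let b' := b.reindex e
  let P : Matrix (Fin 5) (Fin 5) ℤ :=
    Matrix.of fun i j => (RingOfIntegers.basis K).repr (W ^ (j : ℕ)) (e.symm i)
  have hP : Matrix.vecMul b' ((P.map (Int.castRingHom ℚ)).map (algebraMap ℚ K)) = wBasis := by
    funext j
    have := congrArg (algebraMap (𝓞 K) K) ((RingOfIntegers.basis K).sum_repr (W ^ (j : ℕ)))
    rw [wBasis_apply, ← coe_W, ← map_pow, ← this, map_sum, ← e.symm.sum_comp]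
    simp only [Matrix.vecMul, dotProduct, P, b',  b, Matrix.map_apply, Module.Basis.reindex_apply,
      integralBasis_apply, zsmul_eq_mul, map_mul, map_intCast]
    refine Finset.sum_congr rfl fun i _ => ?_
    rw [mul_comm, eq_intCast, map_intCast]
    rfl
  have h1 := Algebra.discr_of_matrix_vecMul (A := ℚ) b' (P.map (Int.castRingHom ℚ))
  have h2 : Algebra.discr ℚ b' = discr K := by
    rw [coe_discr, Module.Basis.coe_reindex]
    exact Algebra.discr_reindex ℚ b e
  rw [hP, h2, discr_wBasis, ← RingHom.mapMatrix_apply, ← RingHom.map_det, eq_intCast] at h1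
  have h3 : (450000 : ℤ) = P.det ^ 2 * discr K := by exact_mod_cast h1
  have h4 : P.det ≠ 0 := by rintro h; simp [h] at h3
  have h5 : 1 ≤ P.det ^ 2 := by have := sq_nonneg P.det; have := pow_ne_zero 2 h4; omega
  have h6 : 0 ≤ |discr K| := abs_nonneg _
  have h7 : |(450000 : ℤ)| = P.det ^ 2 * |discr K| := by rw [h3, abs_mul, abs_sq]
  norm_num at h7
  nlinarith

/-- A `3 × 3` determinant. -/
def det3 (a b c d e f g h i : ℤ) : ℤ :=
  a * (e * i - f * h) - b * (d * i - f * g) + c * (d * h - e * g)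

/-- A `5 × 5` determinant, expanded along its first two rows. -/
def det5 (a b : Fin 5 → ℤ) (x y z : Fin 5 → ℤ) : ℤ :=
  (a 0 * b 1 - a 1 * b 0) *
      det3 (x 2) (x 3) (x 4) (y 2) (y 3) (y 4) (z 2) (z 3) (z 4)
    - (a 0 * b 2 - a 2 * b 0) *
      det3 (x 1) (x 3) (x 4) (y 1) (y 3) (y 4) (z 1) (z 3) (z 4)
    + (a 0 * b 3 - a 3 * b 0) *
      det3 (x 1) (x 2) (x 4) (y 1) (y 2) (y 4) (z 1) (z 2) (z 4)
    - (a 0 * b 4 - a 4 * b 0) *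
      det3 (x 1) (x 2) (x 3) (y 1) (y 2) (y 3) (z 1) (z 2) (z 3)
    + (a 1 * b 2 - a 2 * b 1) *
      det3 (x 0) (x 3) (x 4) (y 0) (y 3) (y 4) (z 0) (z 3) (z 4)
    - (a 1 * b 3 - a 3 * b 1) *
      det3 (x 0) (x 2) (x 4) (y 0) (y 2) (y 4) (z 0) (z 2) (z 4)
    + (a 1 * b 4 - a 4 * b 1) *
      det3 (x 0) (x 2) (x 3) (y 0) (y 2) (y 3) (z 0) (z 2) (z 3)
    + (a 2 * b 3 - a 3 * b 2) *
      det3 (x 0) (x 1) (x 4) (y 0) (y 1) (y 4) (z 0) (z 1) (z 4)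
    - (a 2 * b 4 - a 4 * b 2) *
      det3 (x 0) (x 1) (x 3) (y 0) (y 1) (y 3) (z 0) (z 1) (z 3)
    + (a 3 * b 4 - a 4 * b 3) *
      det3 (x 0) (x 1) (x 2) (y 0) (y 1) (y 2) (z 0) (z 1) (z 2)

/-- The norm form of the basis `1, w, …, w ^ 4`. -/
def normForm (c : Fin 5 → ℤ) : ℤ :=
  det5 ![c 0, 4 * c 4, 4 * c 3, 4 * c 2 + 20 * c 4, 4 * c 1 + 20 * c 3]
    ![c 1, c 0 - 5 * c 4, -5 * c 3 + 4 * c 4, -5 * c 2 + 4 * c 3 - 25 * c 4, -5 * c 1 + 4 * c 2 - 25 * c 3 + 20 * c 4]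
    ![c 2, c 1, c 0 - 5 * c 4, -5 * c 3 + 4 * c 4, -5 * c 2 + 4 * c 3 - 25 * c 4]
    ![c 3, c 2 + 5 * c 4, c 1 + 5 * c 3, c 0 + 5 * c 2 + 20 * c 4, 5 * c 1 + 20 * c 3 + 4 * c 4]
    ![c 4, c 3, c 2 + 5 * c 4, c 1 + 5 * c 3, c 0 + 5 * c 2 + 20 * c 4]

lemma mulMatrix_eq (c : Fin 5 → ℤ) : mulMatrix c = !![c 0, 4 * c 4, 4 * c 3, 4 * c 2 + 20 * c 4, 4 * c 1 + 20 * c 3;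
    c 1, c 0 - 5 * c 4, -5 * c 3 + 4 * c 4, -5 * c 2 + 4 * c 3 - 25 * c 4, -5 * c 1 + 4 * c 2 - 25 * c 3 + 20 * c 4;
    c 2, c 1, c 0 - 5 * c 4, -5 * c 3 + 4 * c 4, -5 * c 2 + 4 * c 3 - 25 * c 4;
    c 3, c 2 + 5 * c 4, c 1 + 5 * c 3, c 0 + 5 * c 2 + 20 * c 4, 5 * c 1 + 20 * c 3 + 4 * c 4;
    c 4, c 3, c 2 + 5 * c 4, c 1 + 5 * c 3, c 0 + 5 * c 2 + 20 * c 4] := by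
  have h2 : wMatrix ^ 2 = !![0, 0, 0, 4, 0; 0, 0, 0, -5, 4; 1, 0, 0, 0, -5; 0, 1, 0, 5, 0; 0, 0, 1, 0, 5] := by
    decide +kernel
  have h3 : wMatrix ^ 3 = !![0, 0, 4, 0, 20; 0, 0, -5, 4, -25; 0, 0, 0, -5, 4; 1, 0, 5, 0, 20; 0, 1, 0, 5, 0] := by
    decide +kernel
  have h4 : wMatrix ^ 4 = !![0, 4, 0, 20, 0; 0, -5, 4, -25, 20; 0, 0, -5, 4, -25; 0, 5, 0, 20, 4; 1, 0, 5, 0, 20] := by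
    decide +kernel
  rw [mulMatrix, h2, h3, h4, wMatrix]
  ext i j
  fin_cases i <;> fin_cases j <;>
    simp [-zsmul_eq_mul, -zsmul_one] <;> ring1

lemma det_mulMatrix (c : Fin 5 → ℤ) : (mulMatrix c).det = normForm c := by
  rw [mulMatrix_eq, normForm]
  simp [Matrix.det_succ_row_zero, Fin.sum_univ_succ, Fin.succAbove, det5, det3]
  ring

lemma Ideal.eq_of_le_of_absNorm_eq {S : Type*} [CommRing S] [IsDedekindDomain S]
    [Module.Free ℤ S] {I J : Ideal S} (h : I ≤ J) (h0 : Ideal.absNorm J ≠ 0)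
    (hn : Ideal.absNorm I = Ideal.absNorm J) : I = J := by
  obtain ⟨L, rfl⟩ := Ideal.dvd_iff_le.2 h
  rw [map_mul] at hn
  have : Ideal.absNorm L = 1 := by
    exact Nat.eq_of_mul_eq_mul_left (Nat.pos_of_ne_zero h0) (by rw [hn, mul_one])
  rw [Ideal.absNorm_eq_one_iff.1 this, Ideal.mul_top]

/-- The value at `r` of the polynomial with coefficients `c`. -/
def evZ {R : Type*} [CommRing R] (c : Fin 5 → ℤ) (r : R) : R :=
  c 0 + c 1 * r + c 2 * r ^ 2 + c 3 * r ^ 3 + c 4 * r ^ 4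

lemma map_evO {R : Type*} [CommRing R] (φ : 𝓞 K →+* R) (c : Fin 5 → ℤ) :
    φ (evO c) = evZ c (φ W) := by
  simp [evO, evZ]

lemma map_W_pow_five {R : Type*} [CommRing R] (φ : 𝓞 K →+* R) :
    φ W ^ 5 = 5 * φ W ^ 3 - 5 * φ W + 4 := by
  rw [← map_pow, W_pow_five]
  simp only [map_add, map_sub, map_mul, map_pow, map_ofNat]

lemma exists_ringHom_zmod_of_absNorm_eq {P : Ideal (𝓞 K)} {p : ℕ} (hp : p.Prime)
    (h : Ideal.absNorm P = p) : ∃ φ : 𝓞 K →+* ZMod p, RingHom.ker φ = P := by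
  have hcard : Nat.card (𝓞 K ⧸ P) = p := by
    rw [← Submodule.cardQuot_apply, ← Ideal.absNorm_apply, h]
  have : Finite (𝓞 K ⧸ P) := Nat.finite_of_card_ne_zero (by rw [hcard]; exact hp.ne_zero)
  have : Fintype (𝓞 K ⧸ P) := Fintype.ofFinite _
  let e := ZMod.ringEquivOfPrime (𝓞 K ⧸ P) hp (by rw [← Nat.card_eq_fintype_card, hcard])
  refine ⟨e.symm.toRingHom.comp (Ideal.Quotient.mk P), ?_⟩
  ext x
  simp [RingHom.mem_ker, Ideal.Quotient.eq_zero_iff_mem]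

lemma absNorm_span_evO (c : Fin 5 → ℤ) :
    Ideal.absNorm (Ideal.span {evO c}) = (normForm c).natAbs := by
  rw [Ideal.absNorm_span_singleton, norm_evO, det_mulMatrix]

lemma eq_span_of_mem_of_absNorm_eq {P : Ideal (𝓞 K)} {c : Fin 5 → ℤ} (hc : evO c ∈ P)
    (h0 : Ideal.absNorm P ≠ 0) (hn : (normForm c).natAbs = Ideal.absNorm P) :
    P = Ideal.span {evO c} :=
  (Ideal.eq_of_le_of_absNorm_eq ((Ideal.span_singleton_le_iff_mem _).2 hc) h0
    (by rw [absNorm_span_evO, hn])).symm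

/-- Divisibility of the value of the quintic at `r` by `p`. -/
def IsRootMod (p : ℕ) (r : ℤ) : Prop := (r ^ 5 - 5 * r ^ 3 + 5 * r - 4) % p = 0

instance (p : ℕ) (r : ℤ) : Decidable (IsRootMod p r) := inferInstanceAs (Decidable (_ = _))

lemma exists_isRootMod {p : ℕ} [NeZero p] (φ : 𝓞 K →+* ZMod p) :
    ∃ r ∈ Finset.range p, φ W = ((r : ℤ) : ZMod p) ∧ IsRootMod p r := by
  have h : φ W = (((φ W).val : ℤ) : ZMod p) := by simp
  refine ⟨(φ W).val, Finset.mem_range.2 (ZMod.val_lt _), h, ?_⟩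
  refine Int.emod_eq_zero_of_dvd ((ZMod.intCast_zmod_eq_zero_iff_dvd _ p).1 ?_)
  push_cast
  have h5 := map_W_pow_five φ
  rw [h] at h5
  push_cast at h5
  linear_combination h5

lemma evO_mem_ker_iff {p : ℕ} (φ : 𝓞 K →+* ZMod p) {r : ℤ} (hr : φ W = (r : ZMod p))
    (c : Fin 5 → ℤ) : evO c ∈ RingHom.ker φ ↔ evZ c r % p = 0 := by
  rw [RingHom.mem_ker, map_evO, hr, ← Int.dvd_iff_emod_eq_zero,
    ← ZMod.intCast_zmod_eq_zero_iff_dvd]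
  simp [evZ]

lemma eq_span_of_roots {P : Ideal (𝓞 K)} {p : ℕ} (hp : p.Prime) (h : Ideal.absNorm P = p)
    (c : Fin 5 → ℤ) (hc : ∀ r ∈ Finset.range p, IsRootMod p r → evZ c (r : ℤ) % p = 0)
    (hn : (normForm c).natAbs = p) : P = Ideal.span {evO c} := by
  obtain ⟨φ, rfl⟩ := exists_ringHom_zmod_of_absNorm_eq hp h
  refine eq_span_of_mem_of_absNorm_eq ?_ (by rw [h]; exact hp.ne_zero) (by rw [hn, h])
  have : NeZero p := ⟨hp.ne_zero⟩
  obtain ⟨r, hr, h1, h2⟩ := exists_isRootMod φ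
  exact (evO_mem_ker_iff φ h1 c).2 (hc r hr h2)

lemma false_of_no_roots {P : Ideal (𝓞 K)} {p : ℕ} (hp : p.Prime) (h : Ideal.absNorm P = p)
    (hc : ∀ r ∈ Finset.range p, ¬ IsRootMod p r) : False := by
  obtain ⟨φ, rfl⟩ := exists_ringHom_zmod_of_absNorm_eq hp h
  have : NeZero p := ⟨hp.ne_zero⟩
  obtain ⟨r, hr, h1, h2⟩ := exists_isRootMod φ
  exact hc r hr h2

lemma eq_span_of_mem_of_prime_norm {P : Ideal (𝓞 K)} (hP : P.IsPrime) {c : Fin 5 → ℤ}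
    (hc : evO c ∈ P) (hn : ((normForm c).natAbs).Prime) : P = Ideal.span {evO c} := by
  have hn' := absNorm_span_evO c
  have hp : (Ideal.span {evO c}).IsPrime :=
    Ideal.isPrime_of_irreducible_absNorm (by rw [hn']; exact hn.prime.irreducible)
  have hne : Ideal.span {evO c} ≠ ⊥ := by
    rintro h
    rw [h, Ideal.absNorm_bot] at hn'
    exact hn.ne_zero hn'.symm
  exact ((hp.isMaximal hne).eq_of_le hP.ne_top ((Ideal.span_singleton_le_iff_mem _).2 hc)).symm

lemma eq_span_of_mem_of_sq_norm {P : Ideal (𝓞 K)} (hP : P.IsPrime) {c : Fin 5 → ℤ} {p : ℕ}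
    (hp : p.Prime) (hc : evO c ∈ P) (hn : (normForm c).natAbs = p ^ 2)
    (hr : ∀ r ∈ Finset.range p, IsRootMod p r → evZ c (r : ℤ) % p ≠ 0) : P = Ideal.span {evO c} := by
  have hd := Ideal.absNorm_dvd_absNorm_of_le ((Ideal.span_singleton_le_iff_mem P).2 hc)
  rw [absNorm_span_evO, hn] at hd
  obtain ⟨k, hk, hkn⟩ := (Nat.dvd_prime_pow hp).1 hd
  interval_cases k
  · exact absurd (Ideal.absNorm_eq_one_iff.1 hkn) hP.ne_top
  · rw [pow_one] at hkn
    obtain ⟨φ, rfl⟩ := exists_ringHom_zmod_of_absNorm_eq hp hkn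
    have : NeZero p := ⟨hp.ne_zero⟩
    obtain ⟨r, hrp, h1, h2⟩ := exists_isRootMod φ
    exact absurd ((evO_mem_ker_iff φ h1 c).1 hc) (hr r hrp h2)
  · exact eq_span_of_mem_of_absNorm_eq hc (by rw [hkn]; exact pow_ne_zero 2 hp.ne_zero)
      (by rw [hn, hkn])

/-- The prime of norm two. -/
noncomputable def π₂ : 𝓞 K := evO ![-2, 1, 0, 0, 0]
/-- The prime of norm four. -/
noncomputable def ρ₂ : 𝓞 K := evO ![-1, 1, 1, 0, 0]
/-- The prime of norm three. -/
noncomputable def π₃ : 𝓞 K := evO ![-1, 1, 0, 0, 0]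
/-- The prime of norm nine. -/
noncomputable def ρ₃ : 𝓞 K := evO ![-3, -1, 2, 1, 0]
/-- The prime of norm five. -/
noncomputable def π₅ : 𝓞 K := evO ![1, 1, 0, 0, 0]
/-- A fundamental unit. -/
noncomputable def e₁ : 𝓞 K := evO ![1, -1, 0, 1, 0]
/-- A fundamental unit. -/
noncomputable def e₃ : 𝓞 K := evO ![-3, 5, -2, -4, 2]

lemma two_eq : (2 : 𝓞 K) = π₂ * ρ₂ ^ 2 := by
  simp [π₂, ρ₂, evO]
  linear_combination (-1) * W_pow_five

lemma three_eq : (3 : 𝓞 K) = e₃ * π₃ * ρ₃ ^ 2 := by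
  simp [π₃, ρ₃, e₃, evO]
  linear_combination (-(-6 + 6 * W + 12 * W ^ 2 - 7 * W ^ 3 - 8 * W ^ 4 + 2 * W ^ 5 + 2 * W ^ 6)) * W_pow_five

lemma five_eq : (5 : 𝓞 K) = e₃ * π₅ ^ 5 := by
  simp [e₃, π₅, evO]
  linear_combination (-(2 + 5 * W + 8 * W ^ 2 + 6 * W ^ 3 + 2 * W ^ 4)) * W_pow_five

lemma minkowski_bound :
    (4 / Real.pi) ^ InfinitePlace.nrComplexPlaces K *
      ((Module.finrank ℚ K).factorial / (Module.finrank ℚ K : ℝ) ^ Module.finrank ℚ K *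
        √|(discr K : ℝ)|) < 42 := by
  have hr : InfinitePlace.nrComplexPlaces K ≤ 2 := by
    have := InfinitePlace.card_add_two_mul_card_eq_rank K
    rw [finrank_K] at this
    omega
  have hpi := Real.pi_gt_d4
  have hpi4 := Real.pi_le_four
  have h1 : (1 : ℝ) ≤ 4 / Real.pi := by
    rw [le_div_iff₀ Real.pi_pos]; linarith
  have h2 : (4 / Real.pi) ^ InfinitePlace.nrComplexPlaces K ≤ (4 / Real.pi) ^ 2 :=
    pow_le_pow_right₀ h1 hr
  have h3 : (4 / Real.pi) ^ 2 ≤ (4 / 3.1415) ^ 2 := by gcongr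
  have h4 : √|(discr K : ℝ)| ≤ 671 := by
    rw [Real.sqrt_le_left (by norm_num)]
    have : |(discr K : ℝ)| ≤ 450000 := by exact_mod_cast abs_discr_le
    linarith
  rw [finrank_K]
  calc _ ≤ (4 / 3.1415 : ℝ) ^ 2 * (((5 : ℕ).factorial : ℝ) / ((5 : ℕ) : ℝ) ^ 5 * 671) := by
        gcongr
        exact h2.trans h3
    _ < 42 := by norm_num [Nat.factorial]

set_option maxHeartbeats 800000 in
lemma exists_evO_of_absNorm_eq_prime {P : Ideal (𝓞 K)} {p : ℕ} (hp : p.Prime)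
    (hpn : Ideal.absNorm P = p) (h7 : 7 ≤ p) (hle : p ≤ 41) : ∃ c, P = Ideal.span {evO c} := by
  have hmem : p ∈ ({7, 11, 13, 17, 19, 23, 29, 31, 37, 41} : Finset ℕ) := by
    have : ∀ q ∈ Finset.Icc 7 41, q.Prime →
        q ∈ ({7, 11, 13, 17, 19, 23, 29, 31, 37, 41} : Finset ℕ) := by decide
    exact this p (Finset.mem_Icc.2 ⟨h7, hle⟩) hp
  simp only [Finset.mem_insert, Finset.mem_singleton] at hmem
  have h11 := eq_span_of_roots hp hpn
  have hno := false_of_no_roots hp hpn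
  rcases hmem with rfl | rfl | rfl | rfl | rfl | rfl | rfl | rfl | rfl | rfl
  · exact ⟨![-3, 1, 1, -2, -1], h11 _ (by decide +kernel) (by decide +kernel)⟩
  · exact (hno (by decide +kernel)).elim
  · exact ⟨![-1, 2, -1, -1, 0], h11 _ (by decide +kernel) (by decide +kernel)⟩
  · exact ⟨![-1, 1, -1, -1, 0], h11 _ (by decide +kernel) (by decide +kernel)⟩
  · exact (hno (by decide +kernel)).elim
  · exact ⟨![-1, 3, 1, -1, 0], h11 _ (by decide +kernel) (by decide +kernel)⟩
  · exact (hno (by decide +kernel)).elim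
  · exact ⟨![-1, -1, 3, 1, -1], h11 _ (by decide +kernel) (by decide +kernel)⟩
  · exact ⟨![-1, 1, 1, -3, 1], h11 _ (by decide +kernel) (by decide +kernel)⟩
  · exact ⟨![-1, 2, 1, -1, 0], h11 _ (by decide +kernel) (by decide +kernel)⟩

lemma isUnit_of_det {c : Fin 5 → ℤ} (h : (normForm c).natAbs = 1) : IsUnit (evO c) := by
  rw [← Ideal.span_singleton_eq_top, ← Ideal.absNorm_eq_one_iff, absNorm_span_evO, h]

lemma isUnit_e₁ : IsUnit e₁ := isUnit_of_det (by decide +kernel)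

lemma isUnit_e₃ : IsUnit e₃ := isUnit_of_det (by decide +kernel)

lemma eq_span_of_two_mem {P : Ideal (𝓞 K)} (hP : P.IsPrime) (h : (2 : 𝓞 K) ∈ P) :
    P = Ideal.span {π₂} ∨ P = Ideal.span {ρ₂} := by
  rw [two_eq] at h
  refine (hP.mem_or_mem h).imp (fun h => ?_) fun h => ?_
  · refine eq_span_of_mem_of_prime_norm hP h ?_
    rw [show (normForm ![-2, 1, 0, 0, 0]).natAbs = 2 by decide +kernel]
    exact Nat.prime_two
  · exact eq_span_of_mem_of_sq_norm hP Nat.prime_two (hP.mem_of_pow_mem _ h) (by decide +kernel)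
      (by decide +kernel)

lemma eq_span_of_three_mem {P : Ideal (𝓞 K)} (hP : P.IsPrime) (h : (3 : 𝓞 K) ∈ P) :
    P = Ideal.span {π₃} ∨ P = Ideal.span {ρ₃} := by
  have he : e₃ ∉ P := fun h => hP.ne_top (P.eq_top_of_isUnit_mem h isUnit_e₃)
  rw [three_eq] at h
  refine (hP.mem_or_mem h).imp (fun h => ?_) fun h => ?_
  · refine eq_span_of_mem_of_prime_norm hP ((hP.mem_or_mem h).resolve_left he) ?_
    rw [show (normForm ![-1, 1, 0, 0, 0]).natAbs = 3 by decide +kernel]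
    exact Nat.prime_three
  · exact eq_span_of_mem_of_sq_norm hP Nat.prime_three (hP.mem_of_pow_mem _ h) (by decide +kernel)
      (by decide +kernel)

lemma eq_span_of_five_mem {P : Ideal (𝓞 K)} (hP : P.IsPrime) (h : (5 : 𝓞 K) ∈ P) :
    P = Ideal.span {π₅} := by
  have he : e₃ ∉ P := fun h => hP.ne_top (P.eq_top_of_isUnit_mem h isUnit_e₃)
  rw [five_eq] at h
  refine eq_span_of_mem_of_prime_norm hP (hP.mem_of_pow_mem _ ((hP.mem_or_mem h).resolve_left he)) ?_
  rw [show (normForm ![1, 1, 0, 0, 0]).natAbs = 5 by decide +kernel]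
  exact Nat.prime_five

lemma isPrincipal_of_absNorm_le {P : Ideal (𝓞 K)} (hP : P.IsPrime) (h0 : P ≠ ⊥)
    (hn : Ideal.absNorm P ≤ 41) : Submodule.IsPrincipal P := by
  have := hP.isMaximal h0
  obtain ⟨p, n, hn0, hpP, hp, hpn⟩ := Ideal.exists_prime_and_absNorm_eq_pow P
  have hple : p ≤ 41 := (Nat.le_self_pow hn0.ne' p).trans (hpn ▸ hn)
  by_cases hp7 : 7 ≤ p
  · have h1 : n = 1 := by
      by_contra hne
      have : p ^ 2 ≤ p ^ n := Nat.pow_le_pow_right hp.pos (by omega)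
      nlinarith
    rw [h1, pow_one] at hpn
    obtain ⟨c, hc⟩ := exists_evO_of_absNorm_eq_prime hp hpn hp7 hple
    exact ⟨evO c, hc⟩
  · have hmem : p = 2 ∨ p = 3 ∨ p = 5 := by
      have h2 := hp.two_le
      have h4 : p ≠ 4 := by rintro rfl; revert hp; decide
      have h6 : p ≠ 6 := by rintro rfl; revert hp; decide
      omega
    rcases hmem with rfl | rfl | rfl
    · rcases eq_span_of_two_mem hP (by exact_mod_cast hpP) with h | h
      exacts [⟨_, h⟩, ⟨_, h⟩]
    · rcases eq_span_of_three_mem hP (by exact_mod_cast hpP) with h | h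
      exacts [⟨_, h⟩, ⟨_, h⟩]
    · exact ⟨_, eq_span_of_five_mem hP (by exact_mod_cast hpP)⟩

instance : IsPrincipalIdealRing (𝓞 K) := by
  refine RingOfIntegers.isPrincipalIdealRing_of_isPrincipal_of_norm_le_of_isPrime
    fun I hI hn => isPrincipal_of_absNorm_le hI (nonZeroDivisors.coe_ne_zero I) ?_
  have := hn.trans_lt minkowski_bound
  have : Ideal.absNorm (I : Ideal (𝓞 K)) < 42 := by exact_mod_cast this
  omega

lemma two_lt_of_quintic {x : ℝ} (hx : x ^ 5 = 5 * x ^ 3 - 5 * x + 4) : 2 < x := by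
  have h : (x ^ 2 - 4) * (x ^ 4 - 3 * x ^ 2 + 1) ^ 2 = 12 := by
    linear_combination (x ^ 5 - 5 * x ^ 3 + 5 * x + 4) * hx
  have h4 : 4 < x ^ 2 := by
    by_contra h4
    nlinarith [mul_nonneg (sub_nonneg.2 (not_lt.1 h4)) (sq_nonneg (x ^ 4 - 3 * x ^ 2 + 1))]
  have h1 : 0 < x ^ 4 - 5 * x ^ 2 + 5 := by nlinarith
  have h0 : 0 < x := by
    by_contra h0
    nlinarith [mul_nonneg (sub_nonneg.2 (not_lt.1 h0)) h1.le]
  nlinarith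

lemma quintic_real_root_unique {x y : ℝ} (hx : x ^ 5 = 5 * x ^ 3 - 5 * x + 4)
    (hy : y ^ 5 = 5 * y ^ 3 - 5 * y + 4) : x = y := by
  obtain ⟨a, ha, rfl⟩ : ∃ a : ℝ, 0 < a ∧ x = 2 + a :=
    ⟨x - 2, by linarith [two_lt_of_quintic hx], by ring⟩
  obtain ⟨b, hb, rfl⟩ : ∃ b : ℝ, 0 < b ∧ y = 2 + b :=
    ⟨y - 2, by linarith [two_lt_of_quintic hy], by ring⟩
  have h : (a - b) * (a ^ 4 + a ^ 3 * b + a ^ 2 * b ^ 2 + a * b ^ 3 + b ^ 4 +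
      10 * (a ^ 3 + a ^ 2 * b + a * b ^ 2 + b ^ 3) + 35 * (a ^ 2 + a * b + b ^ 2) +
      50 * (a + b) + 25) = 0 := by
    linear_combination hx - hy
  rcases mul_eq_zero.1 h with h | h
  · linarith
  · have : 0 < a ^ 4 + a ^ 3 * b + a ^ 2 * b ^ 2 + a * b ^ 3 + b ^ 4 +
      10 * (a ^ 3 + a ^ 2 * b + a * b ^ 2 + b ^ 3) + 35 * (a ^ 2 + a * b + b ^ 2) +
      50 * (a + b) + 25 := by positivity
    linarith

lemma K.ringHom_ext {R : Type*} [DivisionRing R] {f g : K →+* R} (h : f w = g w) : f = g :=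
  AdjoinRoot.ringHom_ext (Subsingleton.elim _ _) h

lemma nrRealPlaces_le : InfinitePlace.nrRealPlaces K ≤ 1 := by
  classical
  refine Fintype.card_le_one_iff.2 fun ⟨u, hu⟩ ⟨v, hv⟩ => Subtype.ext ?_
  have hroot (f : K →+* ℝ) : f w ^ 5 = 5 * f w ^ 3 - 5 * f w + 4 := by
    rw [← map_pow, w_pow_five]
    simp only [map_add, map_sub, map_mul, map_pow, map_ofNat]
  have h := K.ringHom_ext (quintic_real_root_unique (hroot (InfinitePlace.embedding_of_isReal hu))
    (hroot (InfinitePlace.embedding_of_isReal hv)))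
  change u = v
  rw [← InfinitePlace.mk_embedding u, ← InfinitePlace.mk_embedding v]
  congr 1
  ext x
  rw [← InfinitePlace.embedding_of_isReal_apply hu, h, InfinitePlace.embedding_of_isReal_apply]

lemma units_rank_le : Units.rank K ≤ 2 := by
  have h1 := nrRealPlaces_le
  have h2 := InfinitePlace.card_add_two_mul_card_eq_rank K
  have h3 := InfinitePlace.card_eq_nrRealPlaces_add_nrComplexPlaces K
  rw [finrank_K] at h2
  rw [Units.rank]
  omega

/-- The sign and the parities of the exponents of a unit determine it up to squares. -/
lemma exists_unit_class : ∃ c : (𝓞 K)ˣ → Bool × (Fin (Units.rank K) → ZMod 2),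
    ∀ u v, c u = c v → IsSquare (u * v) := by
  have h (u : (𝓞 K)ˣ) : ∃ s : Bool × (Fin (Units.rank K) → ℤ),
      u = (if s.1 then 1 else -1) * ∏ i, Units.fundSystem K i ^ s.2 i := by
    obtain ⟨⟨ζ, n⟩, hu, -⟩ := Units.exist_unique_eq_mul_prod K u
    rcases Units.torsion_eq_one_or_neg_one_of_odd_finrank
      (by rw [finrank_K]; decide) ζ with h | h
    · exact ⟨(true, n), by simpa [h] using hu⟩
    · exact ⟨(false, n), by simpa [h] using hu⟩
  choose c hc using h
  refine ⟨fun u => ((c u).1, fun i => (c u).2 i), fun u v huv => ?_⟩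
  simp only [Prod.mk.injEq] at huv
  rw [hc u, hc v, huv.1, mul_mul_mul_comm, ← Finset.prod_mul_distrib]
  refine (IsSquare.mul_self _).mul ?_
  refine Finset.isSquare_prod _ fun i _ => ?_
  have h2 := congrFun huv.2 i
  rw [ZMod.intCast_eq_intCast_iff_dvd_sub] at h2
  obtain ⟨k, hk⟩ := h2
  refine ⟨Units.fundSystem K i ^ ((c u).2 i + k), ?_⟩
  rw [← zpow_add, ← zpow_add]
  congr 1
  push_cast at hk
  linarith

lemma exists_ringHom_zmod {p : ℕ} (hp : p.Prime) (c : Fin 5 → ℤ) (hc : (normForm c).natAbs = p)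
    (s : ℤ) (hs : ∀ r ∈ Finset.range p, IsRootMod p r → evZ c (r : ℤ) % p = 0 → (r : ℤ) = s) :
    ∃ φ : 𝓞 K →+* ZMod p, φ W = s := by
  obtain ⟨φ, hφ⟩ := exists_ringHom_zmod_of_absNorm_eq hp (P := Ideal.span {evO c})
    (by rw [absNorm_span_evO, hc])
  have : NeZero p := ⟨hp.ne_zero⟩
  obtain ⟨r, hr, h1, h2⟩ := exists_isRootMod φ
  refine ⟨φ, ?_⟩
  rw [h1, hs r hr h2]
  exact (evO_mem_ker_iff φ h1 c).1 (hφ ▸ Ideal.mem_span_singleton_self _)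

/-- The units `± e₁ ^ a * e₃ ^ b`. -/
noncomputable def unitRep (g : Bool × Bool × Bool) : (𝓞 K)ˣ :=
  (if g.1 then -1 else 1) * (if g.2.1 then isUnit_e₁.unit else 1) *
    (if g.2.2 then isUnit_e₃.unit else 1)

lemma coe_unitRep (g : Bool × Bool × Bool) : (unitRep g : 𝓞 K) =
    (if g.1 then -1 else 1) * (if g.2.1 then e₁ else 1) * (if g.2.2 then e₃ else 1) := by
  obtain ⟨_ | _, _ | _, _ | _⟩ := g <;> simp [unitRep]

lemma norm_evO_eq_normForm (c : Fin 5 → ℤ) : Algebra.norm ℤ (evO c) = normForm c := by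
  rw [norm_evO, det_mulMatrix]

lemma norm_e₁ : Algebra.norm ℤ e₁ = 1 := (norm_evO_eq_normForm _).trans (by decide +kernel)

lemma norm_e₃ : Algebra.norm ℤ e₃ = 1 := (norm_evO_eq_normForm _).trans (by decide +kernel)

lemma norm_neg_one : Algebra.norm ℤ (-1 : 𝓞 K) = -1 := by
  have : (-1 : 𝓞 K) = evO ![-1, 0, 0, 0, 0] := by simp [evO]
  rw [this]
  exact (norm_evO_eq_normForm _).trans (by decide +kernel)

lemma MonoidHom.eq_of_isSquare_mul {G : Type*} [CommGroup G] (χ : G →* ℤ) {u v : G}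
    (h : IsSquare (u * v)) : χ u = χ v := by
  obtain ⟨x, hx⟩ := h
  have hu (y : G) : χ y = 1 ∨ χ y = -1 := Int.isUnit_iff.1 ((Group.isUnit y).map χ)
  have hx := congrArg χ hx
  simp only [map_mul] at hx
  rcases hu x with h1 | h1 <;> rcases hu u with h2 | h2 <;> rcases hu v with h3 | h3 <;>
    simp [h1, h2, h3] at hx ⊢

instance : Fact (Nat.Prime 7) := ⟨by norm_num⟩
instance : Fact (Nat.Prime 13) := ⟨by norm_num⟩

/-- A unit is determined up to squares by its norm and two residue characters. -/
lemma unitRep_injective {g h : Bool × Bool × Bool} (hgh : IsSquare (unitRep g * unitRep h)) :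
    g = h := by
  obtain ⟨φ, hφ⟩ := exists_ringHom_zmod (p := 7) (by norm_num) ![-3, 1, 1, -2, -1]
    (by decide +kernel) 3 (by decide +kernel)
  obtain ⟨ψ, hψ⟩ := exists_ringHom_zmod (p := 13) (by norm_num) ![-1, 2, -1, -1, 0]
    (by decide +kernel) 9 (by decide +kernel)
  have h1 := ((Algebra.norm ℤ).comp (Units.coeHom (𝓞 K))).eq_of_isSquare_mul hgh
  have h2 := (((quadraticChar (ZMod 7)).toMonoidHom.comp (φ : 𝓞 K →* ZMod 7)).comp
    (Units.coeHom (𝓞 K))).eq_of_isSquare_mul hgh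
  have h3 := (((quadraticChar (ZMod 13)).toMonoidHom.comp (ψ : 𝓞 K →* ZMod 13)).comp
    (Units.coeHom (𝓞 K))).eq_of_isSquare_mul hgh
  have a1 : φ e₁ = 4 := by
    rw [e₁, map_evO, hφ]; decide +kernel
  have a3 : φ e₃ = 6 := by
    rw [e₃, map_evO, hφ]; decide +kernel
  have b1 : ψ e₁ = 6 := by
    rw [e₁, map_evO, hψ]; decide +kernel
  have b3 : ψ e₃ = 11 := by
    rw [e₃, map_evO, hψ]; decide +kernel
  have q4 : quadraticChar (ZMod 7) 4 = 1 := by decide +kernel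
  have q6 : quadraticChar (ZMod 7) 6 = -1 := by decide +kernel
  have q1 : quadraticChar (ZMod 7) (-1) = -1 := by decide +kernel
  have r6 : quadraticChar (ZMod 13) 6 = -1 := by decide +kernel
  have r11 : quadraticChar (ZMod 13) 11 = -1 := by decide +kernel
  have r1 : quadraticChar (ZMod 13) (-1) = 1 := by decide +kernel
  have k1 (g) : Algebra.norm ℤ (unitRep g : 𝓞 K) = if g.1 then -1 else 1 := by
    rw [coe_unitRep]
    obtain ⟨_ | _, _ | _, _ | _⟩ := g <;> simp [norm_e₁, norm_e₃, norm_neg_one, -neg_mul]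
  have k2 (g) : quadraticChar (ZMod 7) (φ (unitRep g : 𝓞 K)) =
      (if g.1 then -1 else 1) * if g.2.2 then -1 else 1 := by
    rw [coe_unitRep]
    obtain ⟨_ | _, _ | _, _ | _⟩ := g <;> simp [a1, a3, q4, q6, q1, -neg_mul, -quadraticChar_apply]
  have k3 (g) : quadraticChar (ZMod 13) (ψ (unitRep g : 𝓞 K)) =
      (if g.2.1 then -1 else 1) * if g.2.2 then -1 else 1 := by
    rw [coe_unitRep]
    obtain ⟨_ | _, _ | _, _ | _⟩ := g <;> simp [b1, b3, r6, r11, r1, -neg_mul, -quadraticChar_apply]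
  replace h1 : Algebra.norm ℤ (unitRep g : 𝓞 K) = Algebra.norm ℤ (unitRep h : 𝓞 K) := h1
  replace h2 : quadraticChar (ZMod 7) (φ (unitRep g : 𝓞 K)) =
    quadraticChar (ZMod 7) (φ (unitRep h : 𝓞 K)) := h2
  replace h3 : quadraticChar (ZMod 13) (ψ (unitRep g : 𝓞 K)) =
    quadraticChar (ZMod 13) (ψ (unitRep h : 𝓞 K)) := h3
  rw [k1, k1] at h1
  rw [k2, k2] at h2
  rw [k3, k3] at h3
  obtain ⟨_ | _, _ | _, _ | _⟩ := g <;> obtain ⟨_ | _, _ | _, _ | _⟩ := h <;>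
    simp at h1 h2 h3 ⊢

lemma exists_unit_eq (u : (𝓞 K)ˣ) : ∃ g v, u = unitRep g * v ^ 2 := by
  obtain ⟨c, hc⟩ := exists_unit_class
  have hinj : Function.Injective fun g => c (unitRep g) :=
    fun g h hgh => unitRep_injective (hc _ _ hgh)
  have hcard : Fintype.card (Bool × (Fin (Units.rank K) → ZMod 2)) ≤
      Fintype.card (Bool × Bool × Bool) := by
    simp only [Fintype.card_prod, Fintype.card_bool, Fintype.card_fun, ZMod.card, Fintype.card_fin]
    have := Nat.pow_le_pow_right (n := 2) (by norm_num) units_rank_le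
    omega
  obtain ⟨g, hg⟩ := ((Fintype.bijective_iff_injective_and_card _).2
    ⟨hinj, (Fintype.card_le_of_injective _ hinj).antisymm hcard⟩).2 (c u)
  obtain ⟨x, hx⟩ := hc _ _ hg.symm
  exact ⟨g, x * (unitRep g)⁻¹, by
    rw [mul_pow, sq x, ← hx, mul_comm u, inv_pow, mul_assoc, ← mul_assoc, ← mul_assoc, ← sq,
      mul_right_comm, mul_inv_cancel, one_mul]⟩

/-- The element of `𝓞 K` at which the Weierstrass quintic vanishes. -/
noncomputable def Θ : 𝓞 K := evO ![3, -8, -5, 2, 1]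

lemma Θ_pow_two : Θ ^ 2 = evO ![-55, 28, 55, -4, -11] := by
  rw [sq]
  simp [Θ, evO]
  linear_combination ((-16) * W ^ 0 + (-1) * W ^ 1 + (4) * W ^ 2 + (1) * W ^ 3) * W_pow_five

lemma Θ_pow_three : Θ ^ 3 = evO ![299, 132, -123, -36, 15] := by
  rw [pow_succ, Θ_pow_two]
  simp [Θ, evO]
  linear_combination ((116) * W ^ 0 + (47) * W ^ 1 + (-26) * W ^ 2 + (-11) * W ^ 3) * W_pow_five

lemma Θ_pow_four : Θ ^ 4 = evO ![561, -2356, -1969, 484, 461] := by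
  rw [pow_succ, Θ_pow_three]
  simp [Θ, evO]
  linear_combination ((-84) * W ^ 0 + (-195) * W ^ 1 + (-6) * W ^ 2 + (15) * W ^ 3) * W_pow_five

lemma Θ_pow_five : Θ ^ 5 = evO ![-19805, 11300, 20765, -1940, -4105] := by
  rw [pow_succ, Θ_pow_four]
  simp [Θ, evO]
  linear_combination ((-5372) * W ^ 0 + (-1001) * W ^ 1 + (1406) * W ^ 2 + (461) * W ^ 3) * W_pow_five

/-- The sextic model `5 * h` over any ring. -/
noncomputable def sextic (R : Type*) [CommRing R] : R[X] :=
  5 * (X ^ 5 + 5 * X ^ 4 + 40 * X ^ 3 - 80 * X ^ 2 + 320 * X - 320)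

lemma sextic_map {R S : Type*} [CommRing R] [CommRing S] (f : R →+* S) :
    (sextic R).map f = sextic S := by
  simp [sextic]

lemma Θ_root : Θ ^ 5 + 5 * Θ ^ 4 + 40 * Θ ^ 3 - 80 * Θ ^ 2 + 320 * Θ - 320 = 0 := by
  rw [Θ_pow_two, Θ_pow_three, Θ_pow_four, Θ_pow_five]
  simp [Θ, evO]
  ring

lemma eval₂_sextic {R : Type*} [CommRing R] (f : R →+* 𝓞 K) : eval₂ f Θ (sextic R) = 0 := by
  have h : eval₂ f Θ (sextic R) =
      5 * (Θ ^ 5 + 5 * Θ ^ 4 + 40 * Θ ^ 3 - 80 * Θ ^ 2 + 320 * Θ - 320) := by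
    simp [sextic, eval₂_mul, eval₂_add, eval₂_sub]
  rw [h, Θ_root, mul_zero]

/-- The derivative at `Θ` is only divisible by primes above `2`, `3` and `5`. -/
lemma dvd_of_dvd_derivative {π : 𝓞 K} (hπ : Prime π)
    (h : π ∣ aeval Θ (derivative (sextic ℤ))) : π ∣ 2 ∨ π ∣ 3 ∨ π ∣ 5 := by
  have h1 : aeval Θ (derivative (sextic ℤ)) = 5 ^ 2 * evO ![405, -900, -981, 180, 225] := by
    simp [sextic, Θ_pow_two, Θ_pow_three, Θ_pow_four, map_ofNat]
    simp [Θ, evO]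
    ring
  rw [h1] at h
  rcases hπ.dvd_or_dvd h with h | h
  · exact Or.inr (Or.inr (hπ.dvd_of_dvd_pow h))
  · have h2 := Ideal.absNorm_mem (Ideal.span {evO ![405, -900, -981, 180, 225]})
    rw [absNorm_span_evO, show (normForm ![405, -900, -981, 180, 225]).natAbs = 2 ^ 24 * 3 ^ 10 by
      decide +kernel, Ideal.mem_span_singleton] at h2
    have h3 := h.trans h2
    replace h3 : π ∣ (2 : 𝓞 K) ^ 24 * 3 ^ 10 := by
      rwa [Nat.cast_mul, Nat.cast_pow, Nat.cast_pow] at h3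
    rcases hπ.dvd_or_dvd h3 with h3 | h3
    · exact Or.inl (hπ.dvd_of_dvd_pow h3)
    · exact Or.inr (Or.inl (hπ.dvd_of_dvd_pow h3))

lemma dvd_of_odd_multiplicity {R : Type*} [CommRing R] [IsDomain R] [WfDvdMonoid R]
    {π a m b : R} (hπ : Prime π)
    (ha : a ≠ 0) (hodd : Odd (multiplicity π a)) (h : b ^ 2 = -(a * m)) :
    π ∣ a ∧ π ∣ b ∧ π ∣ m := by
  have hfin {x : R} (hx : x ≠ 0) : FiniteMultiplicity π x :=
    FiniteMultiplicity.of_prime_left hπ hx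
  have hpa : π ∣ a := by
    by_contra hn
    rw [multiplicity_eq_zero.2 hn] at hodd
    exact absurd hodd (by decide)
  have hpb : π ∣ b := hπ.dvd_of_dvd_pow (n := 2) (by rw [h]; exact (hpa.mul_right m).neg_right)
  refine ⟨hpa, hpb, ?_⟩
  by_cases hm : m = 0
  · rw [hm]; exact dvd_zero π
  by_contra hn
  have h1 : multiplicity π (b ^ 2) = multiplicity π a + multiplicity π m := by
    rw [h, multiplicity_neg, multiplicity_mul hπ (hfin (mul_ne_zero ha hm))]
  have hb : b ^ 2 ≠ 0 := by
    rw [h]; exact neg_ne_zero.2 (mul_ne_zero ha hm)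
  rw [multiplicity_eq_zero.2 hn, (hfin (pow_ne_zero_iff two_ne_zero |>.1 hb)).multiplicity_pow hπ]
    at h1
  rw [← add_zero (multiplicity π a), ← h1] at hodd
  exact absurd hodd (by simp)

lemma Polynomial.dvd_of_sq_add_mul_eq_zero {k : Type*} [Field k] {A B M r : k[X]} (hA : A ≠ 0)
    (hdeg : A.natDegree ≤ 2) (hr : Irreducible r) (hrA : r ∣ A) (hrB : r ∣ B) (hrM : r ∣ M)
    (h : B ^ 2 + A * M = 0) : A ∣ B := by
  obtain ⟨s, rfl⟩ := hrA
  obtain ⟨b, rfl⟩ := hrB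
  obtain ⟨m, rfl⟩ := hrM
  have hr0 := hr.ne_zero
  have hs0 : s ≠ 0 := right_ne_zero_of_mul hA
  refine mul_dvd_mul_left r ?_
  have hbs : s ∣ b ^ 2 := ⟨-m, mul_left_cancel₀ (pow_ne_zero 2 hr0) (by linear_combination h)⟩
  rw [natDegree_mul hr0 hs0] at hdeg
  have hr1 := hr.natDegree_pos
  by_cases hs : s.natDegree = 0
  · exact (isUnit_iff_degree_eq_zero.2 (by rw [degree_eq_natDegree hs0, hs]; rfl)).dvd
  · have hs1 : s.degree = 1 := by
      rw [degree_eq_natDegree hs0, show s.natDegree = 1 by omega, Nat.cast_one]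
    exact (irreducible_of_degree_eq_one hs1).prime.dvd_of_dvd_pow hbs

lemma Polynomial.C_natCast_dvd_iff {p : ℕ} {f : ℤ[X]} :
    C (p : ℤ) ∣ f ↔ f.map (Int.castRingHom (ZMod p)) = 0 := by
  rw [C_dvd_iff_dvd_coeff, Polynomial.ext_iff]
  simp [ZMod.intCast_zmod_eq_zero_iff_dvd]

lemma exists_prime_dvd {π : 𝓞 K} (hπ : Prime π) : ∃ p : ℕ, p.Prime ∧ π ∣ (p : 𝓞 K) := by
  have hP := (Ideal.span_singleton_prime hπ.ne_zero).2 hπ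
  have := hP.isMaximal (by simpa using hπ.ne_zero)
  obtain ⟨p, n, -, hpP, hp, -⟩ := Ideal.exists_prime_and_absNorm_eq_pow (Ideal.span {π})
  exact ⟨p, hp, Ideal.mem_span_singleton.1 hpP⟩

lemma map_dvd_map_of_dvd {A B M : ℤ[X]} {π : 𝓞 K} (hπ : Prime π) {p : ℕ} (hp : p.Prime)
    (hpπ : π ∣ (p : 𝓞 K)) (hA : A.map (Int.castRingHom (ZMod p)) ≠ 0) (hdeg : A.natDegree ≤ 2)
    (hπA : π ∣ aeval Θ A) (hπB : π ∣ aeval Θ B) (hπM : π ∣ aeval Θ M)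
    (h : C (p : ℤ) ∣ B ^ 2 + A * M) :
    A.map (Int.castRingHom (ZMod p)) ∣ B.map (Int.castRingHom (ZMod p)) := by
  have : Fact p.Prime := ⟨hp⟩
  have hP := (Ideal.span_singleton_prime hπ.ne_zero).2 hπ
  let k := 𝓞 K ⧸ Ideal.span {π}
  let q : 𝓞 K →+* k := Ideal.Quotient.mk _
  have hmax : (Ideal.span {π}).IsMaximal := hP.isMaximal (by simpa using hπ.ne_zero)
  let _ : Field k := Ideal.Quotient.field _
  have hpk : (p : k) = 0 := by
    rw [← map_natCast q]
    exact Ideal.Quotient.eq_zero_iff_mem.2 (Ideal.mem_span_singleton.2 hpπ)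
  have : CharP k p := ringChar.of_eq (CharP.ringChar_of_prime_eq_zero hp hpk)
  let _ : Algebra (ZMod p) k := ZMod.algebra k p
  have key (f : ℤ[X]) (hf : π ∣ aeval Θ f) :
      aeval (q Θ) (f.map (Int.castRingHom (ZMod p))) = 0 := by
    rw [aeval_def, eval₂_map, RingHom.ext_int ((algebraMap (ZMod p) k).comp (Int.castRingHom _))
      (q.comp (algebraMap ℤ (𝓞 K))), ← hom_eval₂, ← aeval_def]
    exact Ideal.Quotient.eq_zero_iff_mem.2 (Ideal.mem_span_singleton.2 hf)
  have h_int : IsIntegral (ZMod p) (q Θ) :=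
    IsAlgebraic.isIntegral ⟨_, hA, key A hπA⟩
  refine dvd_of_sq_add_mul_eq_zero (M := M.map (Int.castRingHom (ZMod p))) hA
    (natDegree_map_le.trans hdeg) (minpoly.irreducible h_int)
    (minpoly.dvd _ _ (key A hπA)) (minpoly.dvd _ _ (key B hπB)) (minpoly.dvd _ _ (key M hπM)) ?_
  rw [← Polynomial.map_mul, ← Polynomial.map_pow, ← Polynomial.map_add]
  exact C_natCast_dvd_iff.1 h

lemma dvd_two_three_five {A : ℤ[X]} (hA : A.IsPrimitive) (hdeg : A.natDegree ≤ 2) {π : 𝓞 K}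
    (hπ : Prime π) (ha : aeval Θ A ≠ 0) (hodd : Odd (multiplicity π (aeval Θ A))) (c : ℕ) :
    ∀ B M : ℤ[X], 0 < c → C (c : ℤ) ^ 2 * sextic ℤ = B ^ 2 + A * M → π ∣ 2 ∨ π ∣ 3 ∨ π ∣ 5 := by
  induction c using Nat.strong_induction_on with
  | _ c ih =>
    intro B M hc h
    have hev := congrArg (aeval Θ) h
    simp only [map_mul, map_add, map_pow] at hev
    rw [aeval_def (p := sextic ℤ), eval₂_sextic, mul_zero] at hev
    obtain ⟨hπA, hπB, hπM⟩ := dvd_of_odd_multiplicity hπ ha hodd (eq_neg_of_add_eq_zero_left hev.symm)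
    obtain ⟨p, hp, hpπ⟩ := exists_prime_dvd hπ
    by_cases hpc : p ∣ c
    · obtain ⟨c, rfl⟩ := hpc
      have hAp : ¬ C (p : ℤ) ∣ A := fun hd =>
        (Nat.prime_iff_prime_int.1 hp).not_isUnit (hA _ hd)
      have hdvd := map_dvd_map_of_dvd hπ hp hpπ (fun h0 => hAp (C_natCast_dvd_iff.2 h0)) hdeg
        hπA hπB hπM (by
          rw [← h]
          exact (Dvd.intro (C (c : ℤ)) (by push_cast; rw [C_mul])).trans
            ((dvd_pow_self _ two_ne_zero).trans (Dvd.intro _ rfl)))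
      obtain ⟨l, hl⟩ := hdvd
      obtain ⟨l, rfl⟩ := map_surjective _ (ZMod.ringHom_surjective (Int.castRingHom (ZMod p))) l
      obtain ⟨B₁, hB₁⟩ : C (p : ℤ) ∣ B - A * l := C_natCast_dvd_iff.2 (by simp [hl])
      obtain ⟨M₁, hM₁⟩ : C (p : ℤ) ^ 2 ∣ 2 * C (p : ℤ) * B₁ * l + A * l ^ 2 + M := by
        refine (prime_C_iff.2 (Nat.prime_iff_prime_int.1 hp)).pow_dvd_of_dvd_mul_left 2 hAp
          ⟨C (c : ℤ) ^ 2 * sextic ℤ - B₁ ^ 2, ?_⟩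
        push_cast [C_mul] at h
        linear_combination (-h) - (B + A * l + C (p : ℤ) * B₁) * hB₁
      have hc0 : 0 < c := Nat.pos_of_mul_pos_left hc
      refine ih c (lt_mul_of_one_lt_left hc0 hp.one_lt) B₁ M₁ hc0 ?_
      refine mul_left_cancel₀ (pow_ne_zero 2 (C_ne_zero.2 (Nat.cast_ne_zero.2 hp.ne_zero))) ?_
      push_cast [C_mul] at h
      linear_combination h + (B + A * l + C (p : ℤ) * B₁) * hB₁ + A * hM₁
    · refine dvd_of_dvd_derivative hπ ?_
      have hd : C (c : ℤ) ^ 2 * derivative (sextic ℤ) =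
          B * (2 * derivative B) + M * derivative A + A * derivative M := by
        have := congrArg derivative h
        simp only [← C_pow, derivative_C, zero_mul, zero_add, derivative_add, derivative_mul,
          pow_two B] at this
        rw [← C_pow, this]
        ring
      replace hd := congrArg (aeval Θ) hd
      simp only [map_mul, map_add, map_pow] at hd
      have : π ∣ aeval Θ (C (c : ℤ)) ^ 2 * aeval Θ (derivative (sextic ℤ)) := by
        rw [hd]
        exact dvd_add (dvd_add (hπB.mul_right _) (hπM.mul_right _)) (hπA.mul_right _)
      refine (hπ.dvd_or_dvd this).resolve_left fun hdc => ?_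
      have hdc := hπ.dvd_of_dvd_pow hdc
      rw [aeval_C] at hdc
      obtain ⟨u, v, huv⟩ := Nat.isCoprime_iff_coprime.2 ((Nat.Prime.coprime_iff_not_dvd hp).2 hpc)
      apply hπ.not_isUnit
      rw [isUnit_iff_dvd_one]
      have h1 := congrArg (Int.cast : ℤ → 𝓞 K) huv
      push_cast at h1
      rw [← h1]
      exact dvd_add (hpπ.mul_left _) (Dvd.dvd.mul_left (by simpa using hdc) _)

/-- Elements of `K` that are, up to squares, a rational number times a product of the chosen units
and primes. -/
def IsGood (x : K) : Prop :=
  ∃ (q : ℚ) (a b c d : ℕ) (z : K), q ≠ 0 ∧ z ≠ 0 ∧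
    x = q * (e₁ : K) ^ a * (e₃ : K) ^ b * (ρ₂ : K) ^ c * (ρ₃ : K) ^ d * z ^ 2

lemma IsGood.mul {x y : K} (hx : IsGood x) (hy : IsGood y) : IsGood (x * y) := by
  obtain ⟨q, a, b, c, d, z, hq, hz, rfl⟩ := hx
  obtain ⟨q', a', b', c', d', z', hq', hz', rfl⟩ := hy
  refine ⟨q * q', a + a', b + b', c + c', d + d', z * z', mul_ne_zero hq hq', mul_ne_zero hz hz', ?_⟩
  push_cast
  ring

lemma isGood_sq {z : K} (hz : z ≠ 0) : IsGood (z ^ 2) :=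
  ⟨1, 0, 0, 0, 0, z, one_ne_zero, hz, by simp⟩

lemma isGood_ratCast {q : ℚ} (hq : q ≠ 0) : IsGood q :=
  ⟨q, 0, 0, 0, 0, 1, hq, one_ne_zero, by simp⟩

lemma isGood_e₁ : IsGood e₁ := ⟨1, 1, 0, 0, 0, 1, one_ne_zero, one_ne_zero, by simp⟩
lemma isGood_e₃ : IsGood e₃ := ⟨1, 0, 1, 0, 0, 1, one_ne_zero, one_ne_zero, by simp⟩
lemma isGood_ρ₂ : IsGood ρ₂ := ⟨1, 0, 0, 1, 0, 1, one_ne_zero, one_ne_zero, by simp⟩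
lemma isGood_ρ₃ : IsGood ρ₃ := ⟨1, 0, 0, 0, 1, 1, one_ne_zero, one_ne_zero, by simp⟩

lemma IsGood.of_mul_sq {x z : K} (hz : z ≠ 0) (h : IsGood (x * z ^ 2)) : IsGood x := by
  have := h.mul (isGood_sq (inv_ne_zero hz))
  rwa [mul_assoc, ← mul_pow, mul_inv_cancel₀ hz, one_pow, mul_one] at this

lemma isGood_unit (u : (𝓞 K)ˣ) : IsGood (u : 𝓞 K) := by
  obtain ⟨g, v, rfl⟩ := exists_unit_eq u
  have hv : ((v : 𝓞 K) : K) ≠ 0 := by simp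
  have h1 : IsGood (1 : K) := by simpa using isGood_ratCast one_ne_zero
  have hm : IsGood (-1 : K) := by
    simpa using isGood_ratCast (q := -1) (by norm_num)
  rw [Units.val_mul, Units.val_pow_eq_pow_val, RingOfIntegers.coe_eq_algebraMap, map_mul, map_pow, coe_unitRep, map_mul, map_mul]
  refine (((?_ : IsGood _).mul ?_).mul ?_).mul (isGood_sq hv)
  · split_ifs <;> simpa
  · split_ifs
    · exact isGood_e₁
    · simpa
  · split_ifs
    · exact isGood_e₃
    · simpa

lemma e₁_ne_zero : (e₁ : K) ≠ 0 := by simpa using isUnit_e₁.ne_zero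
lemma e₃_ne_zero : (e₃ : K) ≠ 0 := by simpa using isUnit_e₃.ne_zero
lemma coe_two_eq : (2 : K) = π₂ * ρ₂ ^ 2 := by
  simpa [map_ofNat] using congrArg (algebraMap (𝓞 K) K) two_eq
lemma coe_three_eq : (3 : K) = e₃ * π₃ * ρ₃ ^ 2 := by
  simpa [map_ofNat] using congrArg (algebraMap (𝓞 K) K) three_eq
lemma coe_five_eq : (5 : K) = e₃ * π₅ ^ 5 := by
  simpa [map_ofNat] using congrArg (algebraMap (𝓞 K) K) five_eq
lemma ρ₂_ne_zero : (ρ₂ : K) ≠ 0 := by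
  intro h; have := coe_two_eq; rw [h] at this; norm_num at this
lemma ρ₃_ne_zero : (ρ₃ : K) ≠ 0 := by
  intro h; have := coe_three_eq; rw [h] at this; norm_num at this
lemma π₅_ne_zero : (π₅ : K) ≠ 0 := by
  intro h; have := coe_five_eq; rw [h] at this; norm_num at this

lemma isGood_π₂ : IsGood π₂ := by
  refine IsGood.of_mul_sq ρ₂_ne_zero ?_
  rw [← coe_two_eq]
  exact_mod_cast isGood_ratCast (q := 2) two_ne_zero

lemma isGood_π₃ : IsGood π₃ := by
  refine IsGood.of_mul_sq ρ₃_ne_zero (IsGood.of_mul_sq e₃_ne_zero ?_)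
  have h : IsGood (3 : K) := by exact_mod_cast isGood_ratCast (q := 3) three_ne_zero
  convert! h.mul isGood_e₃ using 1
  linear_combination -(e₃ : K) * coe_three_eq

lemma isGood_π₅ : IsGood π₅ := by
  refine IsGood.of_mul_sq (pow_ne_zero 2 π₅_ne_zero) (IsGood.of_mul_sq e₃_ne_zero ?_)
  have h : IsGood (5 : K) := by exact_mod_cast isGood_ratCast (q := 5) (by norm_num)
  convert! h.mul isGood_e₃ using 1
  linear_combination -(e₃ : K) * coe_five_eq

lemma isGood_of_span_eq {π ρ : 𝓞 K} (h : Ideal.span {π} = Ideal.span {ρ}) (hρ : IsGood ρ) :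
    IsGood π := by
  obtain ⟨u, rfl⟩ := (Ideal.span_singleton_eq_span_singleton.1 h).symm
  rw [RingOfIntegers.coe_eq_algebraMap, map_mul]
  exact hρ.mul (isGood_unit u)

lemma isGood_of_dvd {π : 𝓞 K} (hπ : Prime π) (h : π ∣ 2 ∨ π ∣ 3 ∨ π ∣ 5) : IsGood π := by
  have hP := (Ideal.span_singleton_prime hπ.ne_zero).2 hπ
  simp only [← Ideal.mem_span_singleton] at h
  rcases h with h | h | h
  · rcases eq_span_of_two_mem hP h with h | h
    exacts [isGood_of_span_eq h isGood_π₂, isGood_of_span_eq h isGood_ρ₂]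
  · rcases eq_span_of_three_mem hP h with h | h
    exacts [isGood_of_span_eq h isGood_π₃, isGood_of_span_eq h isGood_ρ₃]
  · exact isGood_of_span_eq (eq_span_of_five_mem hP h) isGood_π₅

lemma isGood_of_odd_multiplicity {a : 𝓞 K} (ha : a ≠ 0)
    (h : ∀ π, Prime π → Odd (multiplicity π a) → IsGood (π : K)) : IsGood (a : K) := by
  induction a using (wellFounded_dvdNotUnit (α := 𝓞 K)).induction with
  | _ a ih =>
    by_cases hu : IsUnit a
    · exact isGood_unit hu.unit
    obtain ⟨π, hirr, b, rfl⟩ := WfDvdMonoid.exists_irreducible_factor hu ha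
    have hπ : Prime π := hirr.prime
    have hb : b ≠ 0 := right_ne_zero_of_mul ha
    have hfin {ϖ x : 𝓞 K} (hϖ : Prime ϖ) (hx : x ≠ 0) : FiniteMultiplicity ϖ x :=
      FiniteMultiplicity.of_prime_left hϖ hx
    by_cases hdvd : π ∣ b
    · obtain ⟨b, rfl⟩ := hdvd
      have hb' : b ≠ 0 := right_ne_zero_of_mul hb
      have h1 : IsGood (b : K) := by
        refine ih b ⟨hb', π * π, ?_, by ring⟩ hb' fun ϖ hϖ hodd => h ϖ hϖ ?_
        · exact fun hh => hπ.not_isUnit (isUnit_of_mul_isUnit_left hh)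
        · rw [multiplicity_mul hϖ (hfin hϖ ha), multiplicity_mul hϖ (hfin hϖ hb), ← add_assoc]
          exact Even.add_odd ⟨_, rfl⟩ hodd
      have := h1.mul (isGood_sq (z := (π : K)) (by simpa using hπ.ne_zero))
      convert! this using 1
      simp only [map_mul]
      ring
    · have hbm : multiplicity π b = 0 := multiplicity_eq_zero.2 hdvd
      rw [RingOfIntegers.coe_eq_algebraMap, map_mul]
      refine (h π hπ ?_).mul (ih b ⟨hb, π, hπ.not_isUnit, mul_comm _ _⟩ hb fun ϖ hϖ hodd => h ϖ hϖ ?_)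
      · rw [multiplicity_mul hπ (hfin hπ ha), hbm, multiplicity_self]
        exact odd_one
      · have hn : ¬ ϖ ∣ π := fun hd => by
          have hass := (hϖ.dvd_prime_iff_associated hπ).1 hd
          refine hdvd (hass.symm.dvd.trans ?_)
          by_contra hh
          rw [multiplicity_eq_zero.2 hh] at hodd
          exact absurd hodd (by decide)
        rwa [multiplicity_mul hϖ (hfin hϖ ha), multiplicity_eq_zero.2 hn, zero_add]

/-- The root of the Weierstrass quintic, as an element of the field. -/
noncomputable def θ : K := (Θ : K)

lemma aeval_θ_map (f : ℤ[X]) : aeval θ (f.map (Int.castRingHom ℚ)) = (aeval Θ f : 𝓞 K) := by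
  rw [aeval_def, eval₂_map, θ, RingOfIntegers.coe_eq_algebraMap, RingOfIntegers.coe_eq_algebraMap, aeval_def,
    hom_eval₂]
  exact congrArg (fun φ => eval₂ φ _ f) (RingHom.ext_int _ _)

lemma aeval_θ_sextic : aeval θ (sextic ℚ) = 0 := by
  rw [← sextic_map (Int.castRingHom ℚ), aeval_θ_map, aeval_def, eval₂_sextic, RingOfIntegers.coe_eq_algebraMap, map_zero]

lemma exists_primitive_scaling {f : ℚ[X]} (hf : f ≠ 0) :
    ∃ (g : ℤ[X]) (q : ℚ), g.IsPrimitive ∧ q ≠ 0 ∧ g.natDegree = f.natDegree ∧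
      g.map (Int.castRingHom ℚ) = C q * f := by
  obtain ⟨c, hc, hs⟩ := IsLocalization.integerNormalization_spec (nonZeroDivisors ℤ) f
  set g := IsLocalization.integerNormalization (nonZeroDivisors ℤ) f
  have hc0 : (c : ℚ) ≠ 0 := Int.cast_ne_zero.2 (nonZeroDivisors.ne_zero hc)
  have hs' : g.map (Int.castRingHom ℚ) = C (c : ℚ) * f := by
    rw [← smul_eq_C_mul]
    exact hs.trans (by ext; simp)
  have hg : g ≠ 0 := by
    rintro h0
    rw [h0, Polynomial.map_zero, eq_comm] at hs'
    exact mul_ne_zero (C_ne_zero.2 hc0) hf hs'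
  have hcont : (g.content : ℚ) ≠ 0 := Int.cast_ne_zero.2 (content_eq_zero_iff.not.2 hg)
  refine ⟨g.primPart, (g.content : ℚ)⁻¹ * c, g.isPrimitive_primPart,
    mul_ne_zero (inv_ne_zero hcont) hc0, ?_, ?_⟩
  · rw [natDegree_primPart, ← natDegree_map_eq_of_injective (Int.cast_injective (α := ℚ))
      (f := Int.castRingHom ℚ), hs', natDegree_C_mul hc0]
  · have h1 := congrArg (Polynomial.map (Int.castRingHom ℚ)) g.eq_C_content_mul_primPart
    rw [Polynomial.map_mul, map_C, hs'] at h1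
    rw [C_mul, mul_assoc, h1, ← mul_assoc, eq_intCast, ← C_mul, inv_mul_cancel₀ hcont, C_1, one_mul]

lemma exists_integer_scaling (f : ℚ[X]) : ∃ (g : ℤ[X]) (c : ℕ), 0 < c ∧
      g.map (Int.castRingHom ℚ) = C (c : ℚ) * f := by
  obtain ⟨c, hc, hs⟩ := IsLocalization.integerNormalization_spec (nonZeroDivisors ℤ) f
  set g := IsLocalization.integerNormalization (nonZeroDivisors ℤ) f
  have hc0 : c ≠ 0 := nonZeroDivisors.ne_zero hc
  have hs' : g.map (Int.castRingHom ℚ) = C (c : ℚ) * f := by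
    rw [← smul_eq_C_mul]
    exact hs.trans (by ext; simp)
  refine ⟨C (c.sign) * g, c.natAbs, Int.natAbs_pos.2 hc0, ?_⟩
  rw [Polynomial.map_mul, hs', map_C, ← mul_assoc, ← C_mul, eq_intCast, ← Int.cast_mul,
    Int.sign_mul_self_eq_natAbs, Int.cast_natCast]

lemma isGood_aeval {A B : ℚ[X]} (hA : A ≠ 0) (hdeg : A.natDegree ≤ 2)
    (h : A ∣ sextic ℚ - B ^ 2) (h0 : aeval θ A ≠ 0) : IsGood (aeval θ A) := by
  obtain ⟨A', q, hprim, hq, hdeg', hA'⟩ := exists_primitive_scaling hA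
  obtain ⟨B', c, hc, hB'⟩ := exists_integer_scaling B
  have hdvd : A' ∣ C (c : ℤ) ^ 2 * sextic ℤ - B' ^ 2 := by
    rw [IsPrimitive.Int.dvd_iff_map_cast_dvd_map_cast _ _ hprim, hA', Polynomial.map_sub, Polynomial.map_mul, sextic_map,
      Polynomial.map_pow, Polynomial.map_pow, hB', map_C, eq_intCast, Int.cast_natCast, mul_pow,
      ← mul_sub, (isUnit_C.2 hq.isUnit).mul_left_dvd]
    exact h.mul_left _
  obtain ⟨M, hM⟩ := hdvd
  have hval : (aeval Θ A' : 𝓞 K) = (q : K) * aeval θ A := by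
    rw [← aeval_θ_map, hA', map_mul, aeval_C, eq_ratCast]
  have hqK : (q : K) ≠ 0 := Rat.cast_ne_zero.2 hq
  have ha : aeval Θ A' ≠ 0 := by
    intro hz
    rw [hz, RingOfIntegers.coe_eq_algebraMap, map_zero, eq_comm] at hval
    exact mul_ne_zero hqK h0 hval
  have hgood := isGood_of_odd_multiplicity ha fun π hπ hodd => isGood_of_dvd hπ <|
    dvd_two_three_five hprim (hdeg'.trans_le hdeg) hπ ha hodd c B' M hc (by rw [← hM]; ring)
  rw [hval] at hgood
  have := hgood.mul (isGood_ratCast (inv_ne_zero hq))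
  convert! this using 1
  push_cast
  field_simp

lemma norm_quadratic_Θ (d a b : ℤ) :
    Algebra.norm ℤ ((d : 𝓞 K) * Θ ^ 2 + a * Θ + b) =
      b ^ 5 + 102400 * d ^ 5 + 320 * a ^ 5 - 1600 * a ^ 4 * d + 12800 * a ^ 3 * d ^ 2
      + 25600 * a ^ 2 * d ^ 3 + 102400 * a * d ^ 4 - 55 * b ^ 4 * d - 5 * b ^ 4 * a
      + 3040 * b ^ 3 * d ^ 2 + 40 * b ^ 3 * a ^ 2 - 440 * b ^ 3 * a * d - 22400 * b ^ 2 * d ^ 3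
      + 80 * b ^ 2 * a ^ 3 - 1680 * b ^ 2 * a ^ 2 * d + 9600 * b ^ 2 * a * d ^ 2 + 51200 * b * d ^ 4
      + 320 * b * a ^ 4 - 3200 * b * a ^ 3 * d + 19200 * b * a ^ 2 * d ^ 2
      - 12800 * b * a * d ^ 3 := by
  have h : (d : 𝓞 K) * Θ ^ 2 + a * Θ + b =
      evO ![b + 3 * a - 55 * d, -8 * a + 28 * d, -5 * a + 55 * d, 2 * a - 4 * d, a - 11 * d] := by
    rw [Θ_pow_two]
    simp [Θ, evO]
    ring
  rw [h, norm_evO_eq_normForm]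
  simp [normForm, det5, det3]
  ring

lemma norm_quadratic_θ (d a b : ℚ) :
    Algebra.norm ℚ ((d : K) * θ ^ 2 + a * θ + b) =
      b ^ 5 + 102400 * d ^ 5 + 320 * a ^ 5 - 1600 * a ^ 4 * d + 12800 * a ^ 3 * d ^ 2
      + 25600 * a ^ 2 * d ^ 3 + 102400 * a * d ^ 4 - 55 * b ^ 4 * d - 5 * b ^ 4 * a
      + 3040 * b ^ 3 * d ^ 2 + 40 * b ^ 3 * a ^ 2 - 440 * b ^ 3 * a * d - 22400 * b ^ 2 * d ^ 3
      + 80 * b ^ 2 * a ^ 3 - 1680 * b ^ 2 * a ^ 2 * d + 9600 * b ^ 2 * a * d ^ 2 + 51200 * b * d ^ 4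
      + 320 * b * a ^ 4 - 3200 * b * a ^ 3 * d + 19200 * b * a ^ 2 * d ^ 2
      - 12800 * b * a * d ^ 3 := by
  obtain ⟨m, hm⟩ := IsLocalization.exist_integer_multiples_of_finset (nonZeroDivisors ℤ) {d, a, b}
  have hm0 : ((m : ℤ) : ℚ) ≠ 0 := Int.cast_ne_zero.2 (nonZeroDivisors.ne_zero m.2)
  obtain ⟨d', hd⟩ := hm d (by simp)
  obtain ⟨a', ha⟩ := hm a (by simp)
  obtain ⟨b', hb⟩ := hm b (by simp)
  simp only [eq_intCast, zsmul_eq_mul] at hd ha hb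
  have h1 := Algebra.coe_norm_int ((d' : 𝓞 K) * Θ ^ 2 + (a' : 𝓞 K) * Θ + (b' : 𝓞 K))
  rw [norm_quadratic_Θ] at h1
  have h2 : (((d' : 𝓞 K) * Θ ^ 2 + (a' : 𝓞 K) * Θ + (b' : 𝓞 K) : 𝓞 K) : K) =
      algebraMap ℚ K ((m : ℤ) : ℚ) * ((d : K) * θ ^ 2 + a * θ + b) := by
    have hd' : ((d' : ℚ) : K) = ((((m : ℤ) : ℚ) * d : ℚ) : K) := congrArg _ hd
    have ha' : ((a' : ℚ) : K) = ((((m : ℤ) : ℚ) * a : ℚ) : K) := congrArg _ ha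
    have hb' : ((b' : ℚ) : K) = ((((m : ℤ) : ℚ) * b : ℚ) : K) := congrArg _ hb
    push_cast at hd' ha' hb'
    rw [RingOfIntegers.coe_eq_algebraMap]
    simp only [map_add, map_mul, map_pow, map_intCast, hd', ha', hb', θ,
      RingOfIntegers.coe_eq_algebraMap]
    ring
  rw [h2, map_mul, Algebra.norm_algebraMap, finrank_K] at h1
  refine mul_left_cancel₀ (pow_ne_zero 5 hm0) (h1.symm.trans ?_)
  push_cast
  rw [hd, ha, hb]
  ring

/-- Mumford representation of a divisor on the curve `Y² = sextic`. -/
structure IsMumford (A B : ℚ[X]) : Prop where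
  monic : A.Monic
  natDegree_pos : 0 < A.natDegree
  natDegree_le : A.natDegree ≤ 2
  dvd : A ∣ sextic ℚ - B ^ 2

/-- The scalar making the image of a divisor under the descent map have square norm. -/
def twist (A : ℚ[X]) : ℚ := if A.natDegree = 2 then 1 else -5

lemma twist_ne_zero (A : ℚ[X]) : twist A ≠ 0 := by
  unfold twist; split_ifs <;> norm_num

lemma eq_quadratic {A : ℚ[X]} (hA : A.Monic) (h : A.natDegree = 2) :
    A = X ^ 2 + C (A.coeff 1) * X + C (A.coeff 0) := by
  conv_lhs => rw [hA.as_sum, h]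
  simp [Finset.sum_range_succ]
  ring

lemma isSquare_norm {A B : ℚ[X]} (h : IsMumford A B) :
    IsSquare (Algebra.norm ℚ ((twist A : K) * aeval θ A)) := by
  obtain ⟨hA, h1, h2, M, hM⟩ := h
  obtain hd | hd : A.natDegree = 1 ∨ A.natDegree = 2 := by omega
  · obtain ⟨r, rfl⟩ : ∃ r, A = X + C r := ⟨_, hA.eq_X_add_C hd⟩
    have hF := congrArg (eval (-r)) hM
    simp [sextic] at hF
    refine ⟨25 * B.eval (-r), ?_⟩
    have := norm_quadratic_θ 0 (-5) (-5 * r)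
    rw [twist, if_neg (by omega)]
    convert! this using 1
    · congr 1; push_cast; simp; ring
    · linear_combination (-625) * hF
  · obtain ⟨a, b, rfl⟩ : ∃ a b, A = X ^ 2 + C a * X + C b := ⟨_, _, eq_quadratic hA hd⟩
    obtain ⟨u, v, N, hB⟩ : ∃ u v N, B = C u * X + C v + (X ^ 2 + C a * X + C b) * N := by
      have hlt := natDegree_modByMonic_lt B hA (by rintro h; rw [h] at hd; simp at hd)
      rw [hd] at hlt
      refine ⟨(B %ₘ (X ^ 2 + C a * X + C b)).coeff 1, (B %ₘ (X ^ 2 + C a * X + C b)).coeff 0,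
        B /ₘ (X ^ 2 + C a * X + C b), ?_⟩
      rw [← eq_X_add_C_of_natDegree_le_one (by omega), modByMonic_add_div]
    have h0 : 5 * (320 - b * (40 - b - a * (5 - a)) - a * (-80 - b * (5 - a) - a * (40 - b - a * (5 - a))))
        = 2 * u * v - a * u ^ 2 ∧
        5 * (-320 - b * (-80 - b * (5 - a) - a * (40 - b - a * (5 - a)))) = v ^ 2 - b * u ^ 2 := by
      set p := 5 * (320 - b * (40 - b - a * (5 - a)) - a * (-80 - b * (5 - a) - a * (40 - b - a * (5 - a))))
        - (2 * u * v - a * u ^ 2) with hp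
      set q := 5 * (-320 - b * (-80 - b * (5 - a) - a * (40 - b - a * (5 - a)))) - (v ^ 2 - b * u ^ 2) with hq
      have hdvd : (X ^ 2 + C a * X + C b) ∣ C p * X + C q := by
        refine ⟨M - 5 * (X ^ 3 + C (5 - a) * X ^ 2 + C (40 - b - a * (5 - a)) * X +
          C (-80 - b * (5 - a) - a * (40 - b - a * (5 - a)))) + C u ^ 2 + 2 * N * (C u * X + C v)
            + (X ^ 2 + C a * X + C b) * N ^ 2, ?_⟩
        rw [hB] at hM
        simp only [hp, hq, C_sub, C_mul, C_pow, C_neg, map_ofNat]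
        unfold sextic at hM
        linear_combination hM
      have hz := eq_zero_of_dvd_of_natDegree_lt hdvd
        (natDegree_linear_le.trans_lt (by rw [hd]; norm_num))
      have hz1 := congrArg (coeff · 1) hz
      have hz0 := congrArg (coeff · 0) hz
      simp at hz1 hz0
      exact ⟨sub_eq_zero.1 hz1, sub_eq_zero.1 hz0⟩
    obtain ⟨hr1, hr0⟩ := h0
    refine ⟨(v ^ 2 - a * u * v + b * u ^ 2) / 5, ?_⟩
    have := norm_quadratic_θ 1 a b
    rw [twist, if_pos hd]
    convert! this using 1
    · congr 1; simp
    · rw [← sq, div_pow, show (v ^ 2 - a * u * v + b * u ^ 2) ^ 2 = (v ^ 2 - b * u ^ 2) ^ 2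
        - a * (v ^ 2 - b * u ^ 2) * (2 * u * v - a * u ^ 2) + b * (2 * u * v - a * u ^ 2) ^ 2 by ring,
        ← hr0, ← hr1]
      ring

/-- The monic quintic with `sextic = 5 * monicQuintic`. -/
noncomputable def monicQuintic (R : Type*) [CommRing R] : R[X] :=
  X ^ 5 + 5 * X ^ 4 + 40 * X ^ 3 - 80 * X ^ 2 + 320 * X - 320

lemma monicQuintic_monic (R : Type*) [CommRing R] [Nontrivial R] : (monicQuintic R).Monic := by
  unfold monicQuintic; monicity!

lemma natDegree_monicQuintic (R : Type*) [CommRing R] [Nontrivial R] :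
    (monicQuintic R).natDegree = 5 := by
  unfold monicQuintic; compute_degree!

lemma monicQuintic_irreducible : Irreducible (monicQuintic ℚ) := by
  have := irreducible_of_eisenstein_five (a := 5) (b := 40) (c := -80) (d := 320) (e := -320)
    (by norm_num) (by norm_num) (by norm_num) (by norm_num) (by norm_num) (by norm_num)
  convert! this using 1
  simp only [monicQuintic, Int.cast_ofNat, Int.cast_neg, map_ofNat, map_neg]
  ring

lemma aeval_θ_monicQuintic : aeval θ (monicQuintic ℚ) = 0 := by
  have h := aeval_θ_sextic
  rw [show sextic ℚ = 5 * monicQuintic ℚ from rfl, map_mul, map_ofNat] at h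
  exact (mul_eq_zero.1 h).resolve_left (by norm_num)

lemma minpoly_θ : minpoly ℚ θ = monicQuintic ℚ :=
  (minpoly.eq_of_irreducible_of_monic monicQuintic_irreducible aeval_θ_monicQuintic
    (monicQuintic_monic ℚ)).symm

lemma aeval_θ_ne_zero {A : ℚ[X]} (hA : A ≠ 0) (h : A.natDegree < 5) : aeval θ A ≠ 0 := by
  intro h0
  have := natDegree_le_of_dvd (minpoly.dvd ℚ θ h0) hA
  rw [minpoly_θ, natDegree_monicQuintic] at this
  omega

lemma norm_coe_ρ₂ : Algebra.norm ℚ (ρ₂ : K) = 4 := by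
  rw [← Algebra.coe_norm_int, ρ₂, norm_evO_eq_normForm]
  exact congrArg Int.cast (show normForm _ = 4 by decide +kernel)

lemma norm_coe_ρ₃ : Algebra.norm ℚ (ρ₃ : K) = 9 := by
  rw [← Algebra.coe_norm_int, ρ₃, norm_evO_eq_normForm]
  exact congrArg Int.cast (show normForm _ = 9 by decide +kernel)

lemma norm_coe_e₁ : Algebra.norm ℚ (e₁ : K) = 1 := by
  rw [← Algebra.coe_norm_int, norm_e₁, Int.cast_one]

lemma norm_coe_e₃ : Algebra.norm ℚ (e₃ : K) = 1 := by
  rw [← Algebra.coe_norm_int, norm_e₃, Int.cast_one]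

lemma exists_pow_mod_two {x : K} (hx : x ≠ 0) (n : ℕ) :
    ∃ (m : Fin 2) (y : K), y ≠ 0 ∧ x ^ n = x ^ (m : ℕ) * y ^ 2 :=
  ⟨⟨n % 2, Nat.mod_lt _ two_pos⟩, x ^ (n / 2), pow_ne_zero _ hx, by
    rw [← pow_mul, ← pow_add, mul_comm, Nat.mod_add_div]⟩

/-- Representatives of the classes in the image of the descent map. -/
noncomputable def classRep (a b c d : Fin 2) : K :=
  (e₁ : K) ^ (a : ℕ) * (e₃ : K) ^ (b : ℕ) * (ρ₂ : K) ^ (c : ℕ) * (ρ₃ : K) ^ (d : ℕ)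

theorem exists_class {A B : ℚ[X]} (h : IsMumford A B) : ∃ (a b c d : Fin 2) (s : K), s ≠ 0 ∧
    (twist A : K) * aeval θ A = classRep a b c d * s ^ 2 := by
  have hA0 : aeval θ A ≠ 0 := aeval_θ_ne_zero h.monic.ne_zero (by have := h.natDegree_le; omega)
  obtain ⟨q, a, b, c, d, z, hq, hz, heq⟩ := (isGood_ratCast (twist_ne_zero A)).mul
    (isGood_aeval h.monic.ne_zero h.natDegree_le h.dvd hA0)
  have hsq := isSquare_norm h
  rw [heq] at hsq
  simp only [map_mul, map_pow, norm_coe_ρ₂, norm_coe_ρ₃, norm_coe_e₁, norm_coe_e₃, one_pow,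
    mul_one] at hsq
  rw [← eq_ratCast (algebraMap ℚ K), Algebra.norm_algebraMap, finrank_K] at hsq
  obtain ⟨t, ht⟩ := hsq
  have hn : Algebra.norm ℚ z ≠ 0 := Algebra.norm_ne_zero_iff.2 hz
  have hqsq : q = (t / (q ^ 2 * 2 ^ c * 3 ^ d * Algebra.norm ℚ z)) ^ 2 := by
    rw [div_pow, eq_div_iff (by positivity)]
    rw [show (4 : ℚ) ^ c = (2 ^ c) ^ 2 by rw [pow_right_comm]; norm_num,
      show (9 : ℚ) ^ d = (3 ^ d) ^ 2 by rw [pow_right_comm]; norm_num] at ht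
    linear_combination ht
  obtain ⟨r, hr⟩ : ∃ r : ℚ, q = r ^ 2 := ⟨_, hqsq⟩
  have hr0 : (r : K) ≠ 0 := by
    rintro h0
    rw [Rat.cast_eq_zero.1 h0] at hr
    exact hq (by simpa using hr)
  obtain ⟨a', y₁, h1, ha⟩ := exists_pow_mod_two e₁_ne_zero a
  obtain ⟨b', y₂, h2, hb⟩ := exists_pow_mod_two e₃_ne_zero b
  obtain ⟨c', y₃, h3, hc⟩ := exists_pow_mod_two ρ₂_ne_zero c
  obtain ⟨d', y₄, h4, hd⟩ := exists_pow_mod_two ρ₃_ne_zero d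
  refine ⟨a', b', c', d', r * y₁ * y₂ * y₃ * y₄ * z, by simp [*], ?_⟩
  rw [heq, ha, hb, hc, hd, hr, classRep]
  push_cast
  ring

end RingOfIntegers

section LinearForm

variable {L : Type*} [Field L] {h : L[X]}

/-- The linear form on `L[X]/(h)` reading off the coefficient of the fourth power of the root. -/
noncomputable def topCoeff (hm : h.Monic) : AdjoinRoot h →ₗ[L] L :=
  (lcoeff L 4).comp (AdjoinRoot.modByMonicHom hm)

theorem topCoeff_mk (hm : h.Monic) (f : L[X]) :
    topCoeff hm (AdjoinRoot.mk h f) = (f %ₘ h).coeff 4 := by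
  simp [topCoeff, AdjoinRoot.modByMonicHom_mk]

theorem topCoeff_mk_of_natDegree_le (hm : h.Monic) (hd : h.natDegree = 5) {f : L[X]}
    (hf : f.natDegree ≤ 4) : topCoeff hm (AdjoinRoot.mk h f) = f.coeff 4 := by
  rw [topCoeff_mk, (modByMonic_eq_self_iff hm).2]
  exact degree_lt_degree (by omega)

theorem topCoeff_mk_eq_zero (hm : h.Monic) (hd : h.natDegree = 5) {f : L[X]}
    (hf : f.natDegree ≤ 3) : topCoeff hm (AdjoinRoot.mk h f) = 0 := by
  rw [topCoeff_mk_of_natDegree_le hm hd (by omega)]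
  exact coeff_eq_zero_of_natDegree_lt (by omega)

theorem eq_zero_of_mk_eq_zero (hd : h.natDegree = 5) {f : L[X]} (hf : f.natDegree ≤ 4)
    (h0 : AdjoinRoot.mk h f = 0) : f = 0 := by
  rw [AdjoinRoot.mk_eq_zero] at h0
  exact eq_zero_of_dvd_of_natDegree_lt h0 (by omega)

/-- A Mumford pair `(P, B)` over a field gives a totally isotropic plane for the form attached
to `P`. -/
theorem exists_isotropic_plane (hm : h.Monic) (hd : h.natDegree = 5) {ε : L} (hε : ε ≠ 0)
    {P B M : L[X]} (hPm : P.Monic) (hP2 : 2 ≤ P.natDegree) (hP4 : P.natDegree ≤ 4)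
    (hB : B.natDegree < P.natDegree) (hF : C ε * h = B ^ 2 + P * M) (hcop : IsCoprime P h) :
    ∃ y₁ y₂ : AdjoinRoot h,
      (∀ u v : L, topCoeff hm (AdjoinRoot.mk h P * (u • y₁ + v • y₂) ^ 2) = 0) ∧
      ∀ u v : L, u • y₁ + v • y₂ = 0 → u = 0 ∧ v = 0 := by
  have hdF : (C ε * h).natDegree = 5 := by rw [natDegree_C_mul hε, hd]
  have hPu : ¬ IsUnit P := fun hu => by
    have := natDegree_eq_zero_of_isUnit hu
    omega
  have hB0 : B ≠ 0 := by
    rintro rfl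
    apply hPu
    have h1 : P ∣ C ε * h := ⟨M, by rw [hF]; ring⟩
    have h2 : IsUnit (C ε : L[X]) := isUnit_C.2 (isUnit_iff_ne_zero.2 hε)
    exact hcop.isUnit_of_dvd' dvd_rfl ((IsUnit.dvd_mul_left h2).1 h1)
  have hM0 : M ≠ 0 := by
    rintro rfl
    have h1 : (C ε * h).natDegree = 2 * B.natDegree := by
      rw [hF, mul_zero, add_zero, natDegree_pow]
    omega
  have hPM : (P * M).natDegree = P.natDegree + M.natDegree := natDegree_mul hPm.ne_zero hM0
  have hPM' : (P * M).natDegree ≤ max 5 (2 * B.natDegree) := by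
    have : P * M = C ε * h - B ^ 2 := by rw [hF]; ring
    rw [this]
    refine (natDegree_sub_le _ _).trans ?_
    rw [hdF, natDegree_pow]
  have hF' : 5 ≤ max (2 * B.natDegree) (P.natDegree + M.natDegree) := by
    rw [← hdF, hF, ← hPM, ← natDegree_pow]
    exact natDegree_add_le _ _
  obtain ⟨a, b, hab⟩ := hcop
  set p := AdjoinRoot.mk h P with hp
  set q := AdjoinRoot.mk h a with hq
  have hpq : p * q = 1 := by
    have h1 := congrArg (AdjoinRoot.mk h) hab
    simpa [mul_comm, hp, hq] using h1
  have hb2 : (AdjoinRoot.mk h B) ^ 2 = - (p * AdjoinRoot.mk h M) := by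
    have h1 := congrArg (AdjoinRoot.mk h) hF
    simp only [map_mul, map_add, map_pow, AdjoinRoot.mk_self, mul_zero] at h1
    linear_combination -h1
  have smul_eq (u : L) (x : AdjoinRoot h) : u • x = AdjoinRoot.mk h (C u) * x := by
    rw [Algebra.smul_def]; rfl
  rcases Nat.lt_or_ge 2 P.natDegree with h3 | h3
  · rcases Nat.lt_or_ge 1 M.natDegree with hM | hM
    · have hM2 : M.natDegree = 2 := by
        rw [hPM] at hPM'
        rcases le_max_iff.1 hPM' with h5 | h5 <;> omega
      obtain ⟨H, R, hBR, hR⟩ : ∃ H R : L[X], B = R - H * M ∧ R.natDegree ≤ 1 := by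
        refine ⟨-(B / M), B % M, ?_, ?_⟩
        · linear_combination -EuclideanDomain.mod_add_div B M
        · have := natDegree_mod_lt B (q := M) (by omega)
          omega
      have hH : H.natDegree ≤ 1 ∧ H.natDegree + B.natDegree ≤ 4 := by
        by_cases hH0 : H = 0
        · subst hH0; simp; omega
        have h5 : (H * M).natDegree = H.natDegree + M.natDegree := natDegree_mul hH0 hM0
        have h6 : (H * M).natDegree ≤ max 1 B.natDegree := by
          have : H * M = R - B := by rw [hBR]; ring
          rw [this]
          exact (natDegree_sub_le _ _).trans (max_le_max hR le_rfl)
        rcases le_max_iff.1 h6 with h7 | h7 <;> omega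
      set N := P - 2 * H * R + H ^ 2 * M with hN
      have hNd : N.natDegree ≤ 3 := by
        by_cases hN0 : N = 0
        · simp [hN0]
        have h5 : (M * N).natDegree = M.natDegree + N.natDegree := natDegree_mul hM0 hN0
        have h6 : (M * N).natDegree ≤ 5 := by
          have : M * N = C ε * h - R ^ 2 := by rw [hF, hN, hBR]; ring
          rw [this]
          refine (natDegree_sub_le _ _).trans (max_le hdF.le ?_)
          rw [natDegree_pow]; omega
        omega
      refine ⟨AdjoinRoot.mk h B * q, 1 - AdjoinRoot.mk h (H * B) * q, fun u v => ?_,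
        fun u v h0 => ?_⟩
      · have h1 : p * (u • (AdjoinRoot.mk h B * q) + v • (1 - AdjoinRoot.mk h (H * B) * q)) ^ 2 =
            AdjoinRoot.mk h (C v ^ 2 * N + 2 * C u * C v * R - C u ^ 2 * M) := by
          have h5 := congrArg (AdjoinRoot.mk h) hBR
          have h6 := congrArg (AdjoinRoot.mk h) hN
          rw [smul_eq, smul_eq]
          simp only [map_mul, map_add, map_pow, map_sub, map_ofNat] at h5 h6 ⊢
          rw [h6, ← hp]
          generalize AdjoinRoot.mk h (C u) = u'
          generalize AdjoinRoot.mk h (C v) = v'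
          generalize AdjoinRoot.mk h B = β at *
          generalize AdjoinRoot.mk h M = μ at *
          generalize AdjoinRoot.mk h H = η at *
          generalize AdjoinRoot.mk h R = ρ at *
          have e1 : p * (β * q) ^ 2 = - μ := by
            linear_combination (p * q ^ 2) * hb2 - (p * q + 1) * μ * hpq
          have e2 : p * (β * q) = β := by linear_combination β * hpq
          linear_combination (u' - v' * η) ^ 2 * e1 + 2 * v' * (u' - v' * η) * e2 +
            2 * v' * (u' - v' * η) * h5
        rw [h1]
        apply topCoeff_mk_eq_zero hm hd
        have e1 : (C v ^ 2 * N).natDegree ≤ 3 := by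
          rw [← C_pow]; exact (natDegree_C_mul_le _ _).trans (by omega)
        have e2 : (2 * C u * C v * R).natDegree ≤ 3 := by
          have : (2 * C u * C v * R) = C (2 * u * v) * R := by rw [C_mul, C_mul]; rfl
          rw [this]; exact (natDegree_C_mul_le _ _).trans (by omega)
        have e3 : (C u ^ 2 * M).natDegree ≤ 3 := by
          rw [← C_pow]; exact (natDegree_C_mul_le _ _).trans (by omega)
        exact (natDegree_sub_le _ _).trans
          (max_le ((natDegree_add_le _ _).trans (max_le e1 e2)) e3)
      · have h1 : AdjoinRoot.mk h (C u * B + C v * (P - H * B)) = 0 := by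
          rw [smul_eq, smul_eq] at h0
          simp only [map_mul, map_add, map_sub] at h0 ⊢
          rw [← hp]
          linear_combination p * h0 - (AdjoinRoot.mk h (C u) - AdjoinRoot.mk h (C v) *
            AdjoinRoot.mk h H) * AdjoinRoot.mk h B * hpq
        have h2 : C u * B + C v * (P - H * B) = 0 := by
          refine eq_zero_of_mk_eq_zero hd ?_ h1
          have e1 : (C u * B).natDegree ≤ 4 := (natDegree_C_mul_le _ _).trans (by omega)
          have e2 : (C v * (P - H * B)).natDegree ≤ 4 := by
            refine (natDegree_C_mul_le _ _).trans ((natDegree_sub_le _ _).trans (max_le hP4 ?_))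
            exact natDegree_mul_le.trans hH.2
          exact (natDegree_add_le _ _).trans (max_le e1 e2)
        have hv : v = 0 := by
          by_contra hv
          have hvC : C v⁻¹ * C v = (1 : L[X]) := by rw [← C_mul, inv_mul_cancel₀ hv, C_1]
          have h5 : B ∣ P := ⟨H - C (v⁻¹ * u), by
            rw [C_mul]; linear_combination C v⁻¹ * h2 - (P - H * B) * hvC⟩
          have h6 : B ∣ C ε * h := by
            rw [hF]
            exact dvd_add (dvd_pow_self B two_ne_zero) (h5.mul_right M)
          have h7 : IsUnit (C ε : L[X]) := isUnit_C.2 (isUnit_iff_ne_zero.2 hε)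
          have h8 : IsUnit B :=
            IsCoprime.isUnit_of_dvd' ⟨a, b, hab⟩ h5 ((IsUnit.dvd_mul_left h7).1 h6)
          have h9 := natDegree_eq_zero_of_isUnit h8
          obtain ⟨G, hG⟩ := h5
          have hG0 : G ≠ 0 := by rintro rfl; exact hPm.ne_zero (by simpa using hG)
          have h10 : C v * (G - (H - C (v⁻¹ * u))) * B = 0 := by
            rw [C_mul]; linear_combination h2 - C v * hG + C u * B * hvC
          have h11 : G = H - C (v⁻¹ * u) := by
            have := (mul_eq_zero.1 h10).resolve_right hB0
            exact sub_eq_zero.1 ((mul_eq_zero.1 this).resolve_left (by simpa using hv))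
          have h12 : P.natDegree ≤ 1 := by
            rw [hG, h11]
            refine natDegree_mul_le.trans ?_
            have := (natDegree_sub_le H (C (v⁻¹ * u)))
            rw [natDegree_C] at this
            have h13 := le_max_iff.1 this
            omega
          omega
        refine ⟨?_, hv⟩
        subst hv
        simpa [hB0] using h2
    · have hBd : B.natDegree ≤ 2 := by
        by_contra hcon
        have h1 : (B ^ 2).natDegree ≤ max 5 (P.natDegree + M.natDegree) := by
          have : B ^ 2 = C ε * h - P * M := by rw [hF]; ring
          rw [this]
          refine (natDegree_sub_le _ _).trans ?_
          rw [hdF, hPM]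
        rw [natDegree_pow] at h1
        omega
      refine ⟨AdjoinRoot.mk h B * q, AdjoinRoot.mk h (X * B) * q, fun u v => ?_, fun u v h0 => ?_⟩
      · have h1 : p * (u • (AdjoinRoot.mk h B * q) + v • (AdjoinRoot.mk h (X * B) * q)) ^ 2 =
            AdjoinRoot.mk h (-((C u + C v * X) ^ 2 * M)) := by
          rw [smul_eq, smul_eq]
          simp only [map_mul, map_add, map_pow, map_neg]
          generalize AdjoinRoot.mk h (C u) = u'
          generalize AdjoinRoot.mk h (C v) = v'
          generalize AdjoinRoot.mk h X = t
          linear_combination (p * q ^ 2 * (u' + v' * t) ^ 2) * hb2 -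
            (p * q + 1) * (u' + v' * t) ^ 2 * AdjoinRoot.mk h M * hpq
        rw [h1]
        apply topCoeff_mk_eq_zero hm hd
        rw [natDegree_neg]
        refine natDegree_mul_le.trans ?_
        have : ((C u + C v * X) ^ 2).natDegree ≤ 2 := by compute_degree
        omega
      · have h1 : AdjoinRoot.mk h ((C u + C v * X) * B) = 0 := by
          rw [smul_eq, smul_eq] at h0
          simp only [map_mul, map_add] at h0 ⊢
          linear_combination p * h0 - (AdjoinRoot.mk h (C u) + AdjoinRoot.mk h (C v) *
            AdjoinRoot.mk h X) * AdjoinRoot.mk h B * hpq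
        have h2 : (C u + C v * X) * B = 0 := by
          refine eq_zero_of_mk_eq_zero hd ?_ h1
          refine natDegree_mul_le.trans ?_
          have : (C u + C v * X).natDegree ≤ 1 := by compute_degree
          omega
        have h4 := (mul_eq_zero.1 h2).resolve_right hB0
        constructor
        · simpa using congrArg (coeff · 0) h4
        · simpa using congrArg (coeff · 1) h4
  · refine ⟨1, AdjoinRoot.mk h B * q, fun u v => ?_, fun u v h0 => ?_⟩
    · have h1 : p * (u • 1 + v • (AdjoinRoot.mk h B * q)) ^ 2 =
          AdjoinRoot.mk h (C u ^ 2 * P + 2 * C u * C v * B - C v ^ 2 * M) := by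
        rw [smul_eq, smul_eq]
        simp only [map_mul, map_add, map_pow, map_sub, map_ofNat]
        rw [← hp]
        generalize AdjoinRoot.mk h (C u) = u'
        generalize AdjoinRoot.mk h (C v) = v'
        linear_combination (p * q ^ 2 * v' ^ 2) * hb2 -
            (p * q + 1) * v' ^ 2 * AdjoinRoot.mk h M * hpq +
            2 * u' * v' * AdjoinRoot.mk h B * hpq
      rw [h1]
      apply topCoeff_mk_eq_zero hm hd
      have e1 : (C u ^ 2 * P).natDegree ≤ 3 := by
        rw [← C_pow]; exact (natDegree_C_mul_le _ _).trans (by omega)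
      have e2 : (2 * C u * C v * B).natDegree ≤ 3 := by
        have : (2 * C u * C v * B) = C (2 * u * v) * B := by rw [C_mul, C_mul]; rfl
        rw [this]; exact (natDegree_C_mul_le _ _).trans (by omega)
      have e3 : (C v ^ 2 * M).natDegree ≤ 3 := by
        rw [← C_pow]; exact (natDegree_C_mul_le _ _).trans (by omega)
      exact (natDegree_sub_le _ _).trans (max_le ((natDegree_add_le _ _).trans (max_le e1 e2)) e3)
    · have h1 : AdjoinRoot.mk h (C u * P + C v * B) = 0 := by
        rw [smul_eq, smul_eq] at h0
        simp only [map_mul, map_add] at h0 ⊢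
        rw [← hp]
        linear_combination p * h0 - AdjoinRoot.mk h (C v) * AdjoinRoot.mk h B * hpq
      have h2 : C u * P + C v * B = 0 := by
        refine eq_zero_of_mk_eq_zero hd ?_ h1
        have e1 : (C u * P).natDegree ≤ 4 := (natDegree_C_mul_le _ _).trans (by omega)
        have e2 : (C v * B).natDegree ≤ 4 := (natDegree_C_mul_le _ _).trans (by omega)
        exact (natDegree_add_le _ _).trans (max_le e1 e2)
      have hu : u = 0 := by
        have h5 := congrArg (coeff · P.natDegree) h2
        simpa [coeff_eq_zero_of_natDegree_lt hB, hPm.leadingCoeff] using h5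
      refine ⟨hu, ?_⟩
      subst hu
      simpa [hB0] using h2

end LinearForm

theorem exists_aeval_θ_eq (s : K) : ∃ S : ℚ[X], aeval θ S = s := by
  have h : IntermediateField.adjoin ℚ {θ} = ⊤ := by
    rw [Field.primitive_element_iff_minpoly_natDegree_eq, minpoly_θ, natDegree_monicQuintic,
      finrank_K]
  have h1 : s ∈ IntermediateField.adjoin ℚ {θ} := h ▸ IntermediateField.mem_top
  rw [← IntermediateField.mem_toSubalgebra,
    IntermediateField.adjoin_simple_toSubalgebra_of_isAlgebraic
      (Algebra.IsIntegral.isIntegral θ).isAlgebraic, Algebra.adjoin_singleton_eq_range_aeval] at h1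
  exact h1

theorem isCoprime_monicQuintic_iff {S : ℚ[X]} : IsCoprime S (monicQuintic ℚ) ↔ aeval θ S ≠ 0 := by
  rw [isCoprime_comm, monicQuintic_irreducible.coprime_iff_not_dvd, ← minpoly_θ,
    minpoly.dvd_iff]

theorem monicQuintic_map {R S : Type*} [CommRing R] [CommRing S] (f : R →+* S) :
    (monicQuintic R).map f = monicQuintic S := by
  simp [monicQuintic]

/-- The coefficient of the fourth power of the root in `L[X]/(monicQuintic L)`. -/
noncomputable abbrev quinticTop (L : Type*) [Field L] :
    AdjoinRoot (monicQuintic L) →ₗ[L] L := topCoeff (monicQuintic_monic L)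

theorem exists_isotropic {L : Type*} [Field L] [CharZero L] (i : ℚ →+* L) {A B E g : ℚ[X]}
    {BE : L[X]} {κ s : K} (h : IsMumford A B) (hE : E.Monic) (hE1 : 1 ≤ E.natDegree)
    (hE2 : E.natDegree ≤ 2) (hirr : Irreducible E) (hEA : ¬ E ∣ A)
    (hBE : E.map i ∣ sextic L - BE ^ 2) (hs0 : s ≠ 0) (hs : (twist A : K) * aeval θ A = κ * s ^ 2)
    (hg : κ * aeval θ E = aeval θ g) (r : L[X] →ₗ[L] L) :
    ∃ f : L[X], f ≠ 0 ∧ f.natDegree ≤ 4 ∧ r f = 0 ∧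
      quinticTop L (AdjoinRoot.mk _ (g.map i * f ^ 2)) = 0 := by
  have hd := natDegree_monicQuintic L
  have hm := monicQuintic_monic L
  have hcop : IsCoprime A E := isCoprime_comm.1 ((hirr.coprime_iff_not_dvd).2 hEA)
  have hPm : (A * E).Monic := h.monic.mul hE
  have hPd : (A * E).natDegree = A.natDegree + E.natDegree := h.monic.natDegree_mul hE
  have hA1 := h.natDegree_pos
  have hA2 := h.natDegree_le
  have hPθ : aeval θ (A * E) ≠ 0 := aeval_θ_ne_zero hPm.ne_zero (by omega)
  have hPc := (isCoprime_monicQuintic_iff.2 hPθ).map (mapRingHom i)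
  obtain ⟨S, hS⟩ := exists_aeval_θ_eq s
  have hSc := (isCoprime_monicQuintic_iff.2 (hS ▸ hs0 : aeval θ S ≠ 0)).map (mapRingHom i)
  simp only [coe_mapRingHom, monicQuintic_map] at hPc hSc
  have hrel : monicQuintic ℚ ∣ C (twist A) * (A * E) - g * S ^ 2 := by
    rw [← minpoly_θ]
    apply minpoly.dvd
    rw [map_sub, map_mul, map_mul, map_mul, map_pow, hS, aeval_C, ← hg]
    have : algebraMap ℚ K (twist A) = (twist A : K) := rfl
    rw [this]
    linear_combination aeval θ E * hs
  obtain ⟨a, b, hab⟩ := hcop.map (mapRingHom i)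
  simp only [coe_mapRingHom] at hab
  have hAd : A.map i ∣ sextic L - (B.map i) ^ 2 := by
    have := Polynomial.map_dvd i h.dvd
    rwa [Polynomial.map_sub, Polynomial.map_pow, sextic_map] at this
  have hPd' : (A * E).map i ∣ sextic L - (BE * (a * A.map i) + B.map i * (b * E.map i)) ^ 2 := by
    rw [Polynomial.map_mul]
    refine IsCoprime.mul_dvd ⟨a, b, hab⟩ ?_ ?_
    · obtain ⟨k, hk⟩ := hAd
      exact ⟨k - a * (BE - B.map i) * (2 * B.map i + a * A.map i * (BE - B.map i)), by
        rw [show b * E.map i = 1 - a * A.map i by linear_combination hab]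
        linear_combination hk⟩
    · obtain ⟨k, hk⟩ := hBE
      exact ⟨k - b * (B.map i - BE) * (2 * BE + b * E.map i * (B.map i - BE)), by
        rw [show a * A.map i = 1 - b * E.map i by linear_combination hab]
        linear_combination hk⟩
  have hPm' : ((A * E).map i).Monic := hPm.map i
  have hPdeg : ((A * E).map i).natDegree = A.natDegree + E.natDegree := by
    rw [natDegree_map, hPd]
  set P := (A * E).map i with hP
  set B' := BE * (a * A.map i) + B.map i * (b * E.map i) with hB'
  obtain ⟨M, hM⟩ : P ∣ sextic L - (B' %ₘ P) ^ 2 := by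
    obtain ⟨k, hk⟩ := hPd'
    have := modByMonic_add_div B' P
    exact ⟨k + (B' /ₘ P) * (B' + B' %ₘ P), by linear_combination hk - (B' + B' %ₘ P) * this⟩
  have hF : C (5 : L) * monicQuintic L = (B' %ₘ P) ^ 2 + P * M := by
    have : sextic L = 5 * monicQuintic L := rfl
    have h5 : (C (5 : L) : L[X]) = 5 := map_ofNat C 5
    rw [h5]
    linear_combination hM - this
  have hBd : (B' %ₘ P).natDegree < P.natDegree :=
    natDegree_modByMonic_lt _ hPm' (by
      intro h1
      rw [h1, natDegree_one] at hPdeg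
      omega)
  obtain ⟨y₁, y₂, hiso, hind⟩ := exists_isotropic_plane hm hd (by norm_num : (5 : L) ≠ 0) hPm'
    (by omega) (by omega) hBd hF hPc
  obtain ⟨c, d, hcd⟩ := hSc
  set σ := AdjoinRoot.mk (monicQuintic L) (S.map i) with hσ
  obtain ⟨τ, hτ⟩ : ∃ τ, τ * σ = 1 := ⟨AdjoinRoot.mk (monicQuintic L) c, by
    have h1 := congrArg (AdjoinRoot.mk (monicQuintic L)) hcd
    simpa [hσ] using h1⟩
  have hrel' : AdjoinRoot.mk (monicQuintic L) (g.map i) * σ ^ 2 =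
      (i (twist A)) • AdjoinRoot.mk (monicQuintic L) P := by
    have h1 := Polynomial.map_dvd i hrel
    rw [monicQuintic_map, ← AdjoinRoot.mk_eq_zero] at h1
    simp only [Polynomial.map_sub, Polynomial.map_mul, Polynomial.map_pow, map_C, map_sub, map_mul,
      map_pow] at h1
    rw [Algebra.smul_def, hP, Polynomial.map_mul, map_mul]
    change _ = AdjoinRoot.mk (monicQuintic L) (C (i (twist A))) * _
    linear_combination -h1
  let ρ : AdjoinRoot (monicQuintic L) →ₗ[L] L := r.comp (AdjoinRoot.modByMonicHom hm)
  obtain ⟨u, v, huv, hρ⟩ : ∃ u v : L, ¬ (u = 0 ∧ v = 0) ∧ ρ (u • (σ * y₁) + v • (σ * y₂)) = 0 := by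
    by_cases h1 : ρ (σ * y₁) = 0
    · exact ⟨1, 0, by simp, by simpa using h1⟩
    · refine ⟨ρ (σ * y₂), -ρ (σ * y₁), by simp [h1], ?_⟩
      rw [map_add, map_smul, map_smul, smul_eq_mul, smul_eq_mul]
      ring
  set z := u • (σ * y₁) + v • (σ * y₂) with hz
  have hzσ : z = σ * (u • y₁ + v • y₂) := by
    rw [hz, mul_add, mul_smul_comm, mul_smul_comm]
  have hmk : AdjoinRoot.mk (monicQuintic L) (AdjoinRoot.modByMonicHom hm z) = z :=
    AdjoinRoot.mk_leftInverse hm z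
  refine ⟨AdjoinRoot.modByMonicHom hm z, ?_, ?_, hρ, ?_⟩
  · intro h0
    rw [h0, map_zero] at hmk
    refine huv (hind u v ?_)
    linear_combination (-(u • y₁ + v • y₂)) * hτ - τ * hmk - τ * hzσ
  · obtain ⟨f, hf⟩ := AdjoinRoot.mk_surjective z
    rw [← hf, AdjoinRoot.modByMonicHom_mk]
    have := natDegree_modByMonic_lt f hm (by
      intro h1
      rw [h1, natDegree_one] at hd
      omega)
    omega
  · rw [map_mul, map_pow, hmk, hzσ, mul_pow, ← mul_assoc, hrel', smul_mul_assoc, map_smul,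
      hiso, smul_zero]

/-- The traces `quinticTop (root ^ n)`. -/
def topSeq : ℕ → ℤ
  | 0 => 0
  | 1 => 0
  | 2 => 0
  | 3 => 0
  | 4 => 1
  | n + 5 => -5 * topSeq (n + 4) - 40 * topSeq (n + 3) + 80 * topSeq (n + 2)
      - 320 * topSeq (n + 1) + 320 * topSeq n

theorem quinticTop_root_pow {L : Type*} [Field L] (n : ℕ) :
    quinticTop L (AdjoinRoot.root (monicQuintic L) ^ n) = topSeq n := by
  have hlow (m : ℕ) (hm : m ≤ 4) :
      quinticTop L (AdjoinRoot.root (monicQuintic L) ^ m) = (X ^ m : L[X]).coeff 4 := by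
    rw [← AdjoinRoot.mk_X, ← map_pow]
    exact topCoeff_mk_of_natDegree_le _ (natDegree_monicQuintic L) (by simpa using hm)
  induction n using Nat.strong_induction_on with
  | _ n ih =>
    match n, ih with
    | 0, _ => rw [hlow 0 (by norm_num)]; simp [topSeq, coeff_one]
    | 1, _ => rw [hlow 1 (by norm_num)]; simp [topSeq, coeff_X]
    | 2, _ => rw [hlow 2 (by norm_num)]; simp [topSeq, coeff_X_pow]
    | 3, _ => rw [hlow 3 (by norm_num)]; simp [topSeq, coeff_X_pow]
    | 4, _ => rw [hlow 4 (by norm_num)]; simp [topSeq, coeff_X_pow]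
    | n + 5, ih =>
      have h0 : AdjoinRoot.mk (monicQuintic L) (monicQuintic L) = 0 := AdjoinRoot.mk_self
      set t := AdjoinRoot.root (monicQuintic L)
      have h1 : t ^ 5 + 5 * t ^ 4 + 40 * t ^ 3 - 80 * t ^ 2 + 320 * t - 320 = 0 := by
        rw [← h0]
        conv_rhs => arg 2; rw [monicQuintic]
        simp only [map_add, map_sub, map_mul, map_pow, map_ofNat, AdjoinRoot.mk_X, t]
      have h2 : t ^ (n + 5) = (-5 : L) • t ^ (n + 4) + (-40 : L) • t ^ (n + 3)
          + (80 : L) • t ^ (n + 2) + (-320 : L) • t ^ (n + 1) + (320 : L) • t ^ n := by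
        simp only [Algebra.smul_def, map_neg, map_ofNat]
        linear_combination t ^ n * h1
      rw [h2]
      simp only [map_add, map_smul, smul_eq_mul]
      rw [ih n (by omega), ih (n + 1) (by omega), ih (n + 2) (by omega), ih (n + 3) (by omega),
        ih (n + 4) (by omega), topSeq]
      push_cast
      ring

/-- The value at `z` of the quadratic form with Hankel matrix `H`. -/
def hankelForm {L : Type*} [CommRing L] (H : ℕ → L) (z : ℕ → L) : L :=
  z 0 ^ 2 * H 0 + 2 * z 0 * z 1 * H 1 + (z 1 ^ 2 + 2 * z 0 * z 2) * H 2 +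
  (2 * z 0 * z 3 + 2 * z 1 * z 2) * H 3 + (z 2 ^ 2 + 2 * z 0 * z 4 + 2 * z 1 * z 3) * H 4 +
  (2 * z 1 * z 4 + 2 * z 2 * z 3) * H 5 + (z 3 ^ 2 + 2 * z 2 * z 4) * H 6 +
  2 * z 3 * z 4 * H 7 + z 4 ^ 2 * H 8

/-- The trace sequence of `g`. -/
def traceSeq (g : ℕ → ℤ) (n : ℕ) : ℤ :=
  g 0 * topSeq n + g 1 * topSeq (n + 1) + g 2 * topSeq (n + 2) + g 3 * topSeq (n + 3)
    + g 4 * topSeq (n + 4)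

/-- The integral polynomial with coefficients `g 0, …, g 4`. -/
noncomputable def quarticOf (R : Type*) [CommRing R] (g : ℕ → ℤ) : R[X] :=
  C (g 0 : R) + C (g 1 : R) * X + C (g 2 : R) * X ^ 2 + C (g 3 : R) * X ^ 3 + C (g 4 : R) * X ^ 4

theorem quinticTop_mul_sq {L : Type*} [Field L] (g : ℕ → ℤ) {f : L[X]} (hf : f.natDegree ≤ 4) :
    quinticTop L (AdjoinRoot.mk _ (quarticOf L g * f ^ 2)) =
      hankelForm (fun n => (traceSeq g n : L)) f.coeff := by
  have hf' : f = C (f.coeff 0) + C (f.coeff 1) * X + C (f.coeff 2) * X ^ 2 + C (f.coeff 3) * X ^ 3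
      + C (f.coeff 4) * X ^ 4 := by
    conv_lhs => rw [f.as_sum_range_C_mul_X_pow' (n := 5) (by omega)]
    simp [Finset.sum_range_succ]
  have hmk (c : L) (n : ℕ) : quinticTop L (AdjoinRoot.mk (monicQuintic L) (C c) *
      AdjoinRoot.root (monicQuintic L) ^ n) = c * topSeq n := by
    have : AdjoinRoot.mk (monicQuintic L) (C c) * AdjoinRoot.root (monicQuintic L) ^ n =
        c • AdjoinRoot.root (monicQuintic L) ^ n := by
      rw [Algebra.smul_def]; rfl
    rw [this, map_smul, quinticTop_root_pow, smul_eq_mul]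
  generalize f.coeff = z at *
  let q : ℕ → L
    | 0 => z 0 ^ 2
    | 1 => 2 * z 0 * z 1
    | 2 => z 1 ^ 2 + 2 * z 0 * z 2
    | 3 => 2 * z 0 * z 3 + 2 * z 1 * z 2
    | 4 => z 2 ^ 2 + 2 * z 0 * z 4 + 2 * z 1 * z 3
    | 5 => 2 * z 1 * z 4 + 2 * z 2 * z 3
    | 6 => z 3 ^ 2 + 2 * z 2 * z 4
    | 7 => 2 * z 3 * z 4
    | _ => z 4 ^ 2
  have key : AdjoinRoot.mk (monicQuintic L) (quarticOf L g * f ^ 2) =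
      ∑ m ∈ Finset.range 9, ∑ k ∈ Finset.range 5,
        AdjoinRoot.mk (monicQuintic L) (C (q m * g k)) *
          AdjoinRoot.root (monicQuintic L) ^ (m + k) := by
    rw [hf', quarticOf]
    simp only [Finset.sum_range_succ, Finset.sum_range_zero, q, map_add, map_mul, map_pow,
      AdjoinRoot.mk_X, map_ofNat]
    ring
  rw [key, map_sum, Finset.sum_congr rfl fun m _ => (map_sum _ _ _).trans
    (Finset.sum_congr rfl fun k _ => hmk _ _)]
  simp only [hankelForm, traceSeq, Finset.sum_range_succ, Finset.sum_range_zero, q]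
  push_cast
  ring

section Anisotropic

variable {p : ℕ} [Fact p.Prime]

theorem exists_padicInt_scaling {n : ℕ} {x : Fin n → ℚ_[p]} (hx : x ≠ 0) :
    ∃ (c : ℚ_[p]) (y : Fin n → ℤ_[p]), c ≠ 0 ∧ (∀ i, x i = c * y i) ∧ ∃ i, y i = 1 := by
  obtain ⟨j, hj⟩ := Function.ne_iff.1 hx
  obtain ⟨i, -, hi⟩ := Finset.exists_max_image Finset.univ (fun i => ‖x i‖) ⟨j, Finset.mem_univ j⟩
  have hi0 : x i ≠ 0 := by
    have h1 := norm_pos_iff.2 hj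
    have h2 := hi j (Finset.mem_univ j)
    exact norm_pos_iff.1 (h1.trans_le h2)
  refine ⟨x i, fun k => ⟨x k / x i, ?_⟩, hi0, fun k => ?_, i, ?_⟩
  · rw [norm_div]
    exact div_le_one_of_le₀ (hi k (Finset.mem_univ k)) (norm_nonneg _)
  · exact (mul_div_cancel₀ _ hi0).symm
  · apply Subtype.ext
    simp [hi0]

/-- A quaternary form with integral coefficients. -/
def quadForm (R : Type*) [CommRing R] (k : Fin 10 → ℤ) (x : Fin 4 → R) : R :=
  k 0 * x 0 ^ 2 + k 1 * (x 0 * x 1) + k 2 * (x 0 * x 2) + k 3 * (x 0 * x 3) + k 4 * x 1 ^ 2 +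
  k 5 * (x 1 * x 2) + k 6 * (x 1 * x 3) + k 7 * x 2 ^ 2 + k 8 * (x 2 * x 3) + k 9 * x 3 ^ 2

theorem map_quadForm {R S : Type*} [CommRing R] [CommRing S] (f : R →+* S) (k : Fin 10 → ℤ)
    (x : Fin 4 → R) : f (quadForm R k x) = quadForm S k (fun i => f (x i)) := by
  simp [quadForm]

theorem quadForm_padic_ne_zero {m n : ℕ} (hm : p ^ n = m) (k : Fin 10 → ℤ)
    (hk : ∀ (i : Fin 4) (x : Fin 4 → ZMod m), x i = 1 → quadForm _ k x ≠ 0)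
    {x : Fin 4 → ℚ_[p]} (h : quadForm _ k x = 0) : x = 0 := by
  subst hm
  by_contra hx
  obtain ⟨c, y, hc, hxy, i, hi⟩ := exists_padicInt_scaling hx
  have h1 : quadForm ℚ_[p] k x = c ^ 2 * quadForm ℚ_[p] k (fun i => (y i : ℚ_[p])) := by
    simp only [quadForm, hxy]; ring
  have h2 : quadForm ℤ_[p] k y = 0 := by
    have h3 := (mul_eq_zero.1 (h1.symm.trans h)).resolve_left (pow_ne_zero 2 hc)
    have h4 := map_quadForm (PadicInt.Coe.ringHom (p := p)) k y
    apply Subtype.coe_injective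
    exact h4.trans (h3.trans PadicInt.coe_zero.symm)
  have h5 := map_quadForm (PadicInt.toZModPow (p := p) n) k y
  rw [h2, map_zero] at h5
  exact hk i _ (by rw [hi, map_one]) h5.symm

theorem quadForm_congr {m : ℕ} {k l : Fin 10 → ℤ} (h : ∀ i, (m : ℤ) ∣ k i - l i)
    (x : Fin 4 → ZMod m) : quadForm _ k x = quadForm _ l x := by
  have (i : Fin 10) : ((k i : ℤ) : ZMod m) = (l i : ℤ) := by
    rw [← sub_eq_zero, ← Int.cast_sub, ZMod.intCast_zmod_eq_zero_iff_dvd]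
    exact h i
  simp only [quadForm, this]

theorem two_adic_anisotropic {k : Fin 10 → ℤ}
    (hk : ∀ i, (4 : ℤ) ∣ k i - (![1, 1, 0, 0, 1, 0, 0, 2, 2, 2] : Fin 10 → ℤ) i)
    {x : Fin 4 → ℚ_[2]} (h : quadForm _ k x = 0) : x = 0 := by
  refine quadForm_padic_ne_zero (m := 4) (n := 2) (by norm_num) k (fun i x hi h0 => ?_) h
  rw [quadForm_congr hk] at h0
  have : ∀ (x₀ x₁ x₂ x₃ : ZMod 4), x₀ ^ 2 + x₀ * x₁ + x₁ ^ 2 + 2 * (x₂ ^ 2 + x₂ * x₃ + x₃ ^ 2) = 0 →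
    x₀ ≠ 1 ∧ x₁ ≠ 1 ∧ x₂ ≠ 1 ∧ x₃ ≠ 1 := by decide +kernel
  obtain ⟨h1, h2, h3, h4⟩ := this (x 0) (x 1) (x 2) (x 3) (by
    rw [← h0]; simp [quadForm]; ring)
  fin_cases i <;> contradiction

theorem three_adic_anisotropic {k : Fin 10 → ℤ}
    (hk : ∀ i, (9 : ℤ) ∣ k i - (![1, 0, 0, 0, 1, 0, 0, 3, 0, 3] : Fin 10 → ℤ) i)
    {x : Fin 4 → ℚ_[3]} (h : quadForm _ k x = 0) : x = 0 := by
  refine quadForm_padic_ne_zero (m := 9) (n := 2) (by norm_num) k (fun i x hi h0 => ?_) h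
  rw [quadForm_congr hk] at h0
  have : ∀ (x₀ x₁ x₂ x₃ : ZMod 9), x₀ ^ 2 + x₁ ^ 2 + 3 * (x₂ ^ 2 + x₃ ^ 2) = 0 →
    x₀ ≠ 1 ∧ x₁ ≠ 1 ∧ x₂ ≠ 1 ∧ x₃ ≠ 1 := by decide +kernel
  obtain ⟨h1, h2, h3, h4⟩ := this (x 0) (x 1) (x 2) (x 3) (by
    rw [← h0]; simp [quadForm]; ring)
  fin_cases i <;> contradiction

end Anisotropic

/-- The form attached to `g` has no nontrivial zero on some hyperplane over `ℚ_[p]`. -/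
def AnisotropicOnHyperplane (p : ℕ) [Fact p.Prime] (g : ℕ → ℤ) : Prop :=
  ∃ r : Fin 5 → ℤ, ∀ z : ℕ → ℚ_[p],
    r 0 * z 0 + r 1 * z 1 + r 2 * z 2 + r 3 * z 3 + r 4 * z 4 = 0 →
    hankelForm (fun n => (traceSeq g n : ℚ_[p])) z = 0 →
    z 0 = 0 ∧ z 1 = 0 ∧ z 2 = 0 ∧ z 3 = 0 ∧ z 4 = 0

theorem false_of_anisotropicOnHyperplane {p : ℕ} [Fact p.Prime] {A B E : ℚ[X]} {g : ℕ → ℤ}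
    {BE : ℚ_[p][X]} {κ s : K} {N : ℤ} (h : IsMumford A B) (hE : E.Monic) (hE1 : 1 ≤ E.natDegree)
    (hE2 : E.natDegree ≤ 2) (hirr : Irreducible E) (hEA : ¬ E ∣ A)
    (hBE : E.map (algebraMap ℚ ℚ_[p]) ∣ sextic ℚ_[p] - BE ^ 2) (hs0 : s ≠ 0)
    (hs : (twist A : K) * aeval θ A = κ * s ^ 2) (hN : N ≠ 0)
    (hg : N * κ * aeval θ E = aeval θ (quarticOf ℚ g)) (ha : AnisotropicOnHyperplane p g) :
    False := by
  obtain ⟨r, hr⟩ := ha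
  let ρ : ℚ_[p][X] →ₗ[ℚ_[p]] ℚ_[p] := (r 0 : ℚ_[p]) • lcoeff _ 0 + (r 1 : ℚ_[p]) • lcoeff _ 1 +
    (r 2 : ℚ_[p]) • lcoeff _ 2 + (r 3 : ℚ_[p]) • lcoeff _ 3 + (r 4 : ℚ_[p]) • lcoeff _ 4
  have hN' : (N : ℚ) ≠ 0 := Int.cast_ne_zero.2 hN
  have hNK : (N : K) ≠ 0 := Int.cast_ne_zero.2 hN
  obtain ⟨f, hf0, hfd, hrf, hf⟩ := exists_isotropic (algebraMap ℚ ℚ_[p]) (g := C (N : ℚ)⁻¹ *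
    quarticOf ℚ g) h hE hE1 hE2 hirr hEA hBE hs0 hs (by
      rw [map_mul, ← hg, aeval_C, map_inv₀, map_intCast]
      field_simp) ρ
  have hq : (quarticOf ℚ g).map (algebraMap ℚ ℚ_[p]) = quarticOf ℚ_[p] g := by
    simp [quarticOf]
  have hmk (c : ℚ_[p]) (y : ℚ_[p][X]) : quinticTop ℚ_[p] (AdjoinRoot.mk _ (C c * y)) =
      c * quinticTop ℚ_[p] (AdjoinRoot.mk _ y) := by
    have : AdjoinRoot.mk (monicQuintic ℚ_[p]) (C c * y) = c • AdjoinRoot.mk _ y := by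
      rw [Algebra.smul_def, map_mul]; rfl
    rw [this, map_smul, smul_eq_mul]
  rw [Polynomial.map_mul, map_C, hq, mul_assoc, hmk, quinticTop_mul_sq g hfd] at hf
  have hc : algebraMap ℚ ℚ_[p] (N : ℚ)⁻¹ ≠ 0 := by
    simpa using hN
  obtain ⟨h0, h1, h2, h3, h4⟩ := hr f.coeff (by simpa [ρ] using hrf)
    ((mul_eq_zero.1 hf).resolve_left hc)
  apply hf0
  rw [f.as_sum_range_C_mul_X_pow' (n := 5) (by omega)]
  simp [Finset.sum_range_succ, h0, h1, h2, h3, h4]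

section HalfMaps

open NumberField

set_option linter.unusedSimpArgs false

/-- The finite sequence `a, b, c, d, e`. -/
def seqOf (a b c d e : ℤ) : ℕ → ℤ
  | 0 => a
  | 1 => b
  | 2 => c
  | 3 => d
  | 4 => e
  | _ => 0

/-- The class `classRep a b c d` is excluded by the local point with polynomial `E` at `p`. -/
def IsObstructed (p : ℕ) [Fact p.Prime] (E : ℚ[X]) (a b c d : Fin 2) : Prop :=
  ∃ (N : ℤ) (g : ℕ → ℤ), N ≠ 0 ∧ N * classRep a b c d * aeval θ E = aeval θ (quarticOf ℚ g) ∧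
    AnisotropicOnHyperplane p g

theorem obstructed_sub_seven_0001 : IsObstructed 2 (X - 7) 0 0 0 1 := by
  have h : (288 : 𝓞 K) * (ρ₃) * (Θ - 7) = -18544 + 1760 * Θ - 3078 * Θ ^ 2 - 373 * Θ ^ 3 - 67 * Θ ^ 4 := by
    simp only [Θ_pow_two, Θ_pow_three, Θ_pow_four]
    simp [Θ, ρ₃, evO]
    linear_combination ((864) * W ^ 0 + (1152) * W ^ 1 + (288) * W ^ 2) * W_pow_five
  refine ⟨288, seqOf (-18544) (1760) (-3078) (-373) (-67), by norm_num, ?_, ![-209, 800, 4810, -76930, 328330], fun z h₁ h₂ => ?_⟩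
  · have h' := congrArg (algebraMap (𝓞 K) K) h
    simp only [map_mul, map_add, map_sub, map_pow, map_ofNat, map_neg, map_one] at h'
    simp [classRep, quarticOf, seqOf, θ, map_ofNat, RingOfIntegers.coe_eq_algebraMap]
    linear_combination h'
  · simp [hankelForm, traceSeq, seqOf, topSeq] at h₁ h₂
    have h₃ : (![(241 / 209) * z 1 + (-560 / 209) * z 2 + (16 / 209) * z 3 + (8 / 209) * z 4, (-32 / 209) * z 1 + (560 / 209) * z 2 + (-16 / 209) * z 3 + (-8 / 209) * z 4, (-207 / 418) * z 1 + (-1115 / 836) * z 2 + (211 / 836) * z 3 + (1 / 836) * z 4, (-659 / 418) * z 1 + (698 / 209) * z 2 + (-8 / 209) * z 3 + (-4 / 209) * z 4] : Fin 4 → ℚ_[2]) = 0 := by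
      apply two_adic_anisotropic (k := ![-632890755, 197915601, 321755796, -1046022756, -15378627, -50120624, 163476956, -40800070, 265816590, -432192782])
      · decide
      · simp [quadForm]
        linear_combination (1 / 288) * h₂ - ((67 / 60192) * z 0 + (17371 / 3145032) * z 1 + (204607 / 6290064) * z 2 + (-2359795 / 6290064) * z 3 + (8203471 / 6290064) * z 4) * h₁
    have x₀ : (241 / 209) * z 1 + (-560 / 209) * z 2 + (16 / 209) * z 3 + (8 / 209) * z 4 = 0 := congrFun h₃ 0
    have x₁ : (-32 / 209) * z 1 + (560 / 209) * z 2 + (-16 / 209) * z 3 + (-8 / 209) * z 4 = 0 := congrFun h₃ 1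
    have x₂ : (-207 / 418) * z 1 + (-1115 / 836) * z 2 + (211 / 836) * z 3 + (1 / 836) * z 4 = 0 := congrFun h₃ 2
    have x₃ : (-659 / 418) * z 1 + (698 / 209) * z 2 + (-8 / 209) * z 3 + (-4 / 209) * z 4 = 0 := congrFun h₃ 3
    refine ⟨?_, ?_, ?_, ?_, ?_⟩
    · linear_combination (56030) * x₀ + (-8560) * x₁ + (-14040) * x₂ + (46220) * x₃ + (-1 / 209) * h₁
    · linear_combination (1) * x₀ + (1) * x₁
    · linear_combination (3 / 4) * x₀ + (1 / 2) * x₁ + (1 / 2) * x₃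
    · linear_combination (23 / 4) * x₀ + (37 / 8) * x₁ + (4) * x₂ + (5 / 2) * x₃
    · linear_combination (37) * x₀ + (-35 / 8) * x₁ + (-8) * x₂ + (30) * x₃

theorem obstructed_sub_seven_0010 : IsObstructed 2 (X - 7) 0 0 1 0 := by
  have h : (288 : 𝓞 K) * (ρ₂) * (Θ - 7) = -8704 + 1496 * Θ - 1428 * Θ ^ 2 - 175 * Θ ^ 3 - 31 * Θ ^ 4 := by
    simp only [Θ_pow_two, Θ_pow_three, Θ_pow_four]
    simp [Θ, ρ₂, evO]
    linear_combination ((864) * W ^ 0 + (288) * W ^ 1) * W_pow_five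
  refine ⟨288, seqOf (-8704) (1496) (-1428) (-175) (-31), by norm_num, ?_, ![-11, 147, -460, -4000, 53400], fun z h₁ h₂ => ?_⟩
  · have h' := congrArg (algebraMap (𝓞 K) K) h
    simp only [map_mul, map_add, map_sub, map_pow, map_ofNat, map_neg, map_one] at h'
    simp [classRep, quarticOf, seqOf, θ, map_ofNat, RingOfIntegers.coe_eq_algebraMap]
    linear_combination h'
  · simp [hankelForm, traceSeq, seqOf, topSeq] at h₁ h₂
    have h₃ : (![(-7 / 4) * z 1 + (-1) * z 2 + (2) * z 3, (2) * z 1 + (-8) * z 2, (-123 / 88) * z 1 + (173 / 22) * z 2 + (-36 / 11) * z 3 + (1 / 11) * z 4, (4) * z 2] : Fin 4 → ℚ_[2]) = 0 := by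
      apply two_adic_anisotropic (k := ![-7293469275, -19008007095, -8933430300, -24098779440, -12384515291, -11641009964, -31402735620, -2735535050, -14758735818, -19906547418])
      · decide
      · simp [quadForm]
        linear_combination (1 / 32) * h₂ - ((31 / 352) * z 0 + (4997 / 3872) * z 1 + (-3081 / 968) * z 2 + (-4051 / 121) * z 3 + (201821 / 484) * z 4) * h₁
    have x₀ : (-7 / 4) * z 1 + (-1) * z 2 + (2) * z 3 = 0 := congrFun h₃ 0
    have x₁ : (2) * z 1 + (-8) * z 2 = 0 := congrFun h₃ 1
    have x₂ : (-123 / 88) * z 1 + (173 / 22) * z 2 + (-36 / 11) * z 3 + (1 / 11) * z 4 = 0 := congrFun h₃ 2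
    have x₃ : (4) * z 2 = 0 := congrFun h₃ 3
    refine ⟨?_, ?_, ?_, ?_, ?_⟩
    · linear_combination (87200) * x₀ + (113626) * x₁ + (53400) * x₂ + (144062) * x₃ + (-1 / 11) * h₁
    · linear_combination (1 / 2) * x₁ + (1) * x₃
    · linear_combination (1 / 4) * x₃
    · linear_combination (1 / 2) * x₀ + (7 / 16) * x₁ + (1) * x₃
    · linear_combination (18) * x₀ + (375 / 16) * x₁ + (11) * x₂ + (119 / 4) * x₃

theorem obstructed_sub_seven_0011 : IsObstructed 2 (X - 7) 0 0 1 1 := by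
  have h : (288 : 𝓞 K) * (ρ₂ * ρ₃) * (Θ - 7) = -99616 + 9416 * Θ - 16056 * Θ ^ 2 - 2137 * Θ ^ 3 - 349 * Θ ^ 4 := by
    simp only [Θ_pow_two, Θ_pow_three, Θ_pow_four]
    simp [Θ, ρ₂, ρ₃, evO]
    linear_combination ((-4896) * W ^ 0 + (-1152) * W ^ 1 + (1728) * W ^ 2 + (1440) * W ^ 3 + (288) * W ^ 4) * W_pow_five
  refine ⟨288, seqOf (-99616) (9416) (-16056) (-2137) (-349), by norm_num, ?_, ![-53, 1429, -8268, -11872, 513080], fun z h₁ h₂ => ?_⟩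
  · have h' := congrArg (algebraMap (𝓞 K) K) h
    simp only [map_mul, map_add, map_sub, map_pow, map_ofNat, map_neg, map_one] at h'
    simp [classRep, quarticOf, seqOf, θ, map_ofNat, RingOfIntegers.coe_eq_algebraMap]
    linear_combination h'
  · simp [hankelForm, traceSeq, seqOf, topSeq] at h₁ h₂
    have h₃ : (![(15 / 212) * z 1 + (3) * z 2 + (2) * z 3 + (-128 / 53) * z 4, (4 / 53) * z 1 + (-80 / 53) * z 4, (4) * z 2, (-1 / 424) * z 1 + (-3 / 2) * z 2 + (29 / 53) * z 4] : Fin 4 → ℚ_[2]) = 0 := by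
      apply two_adic_anisotropic (k := ![-134379, 2640357, 18164088, 48144348, -13383063, -184704084, -489766284, -637482146, -3380865026, -4482600038])
      · decide
      · simp [quadForm]
        linear_combination (1 / 32) * h₂ - ((349 / 1696) * z 0 + (540273 / 89888) * z 1 + (-13543 / 424) * z 2 + (-2309 / 53) * z 3 + (22424667 / 11236) * z 4) * h₁
    have x₀ : (15 / 212) * z 1 + (3) * z 2 + (2) * z 3 + (-128 / 53) * z 4 = 0 := congrFun h₃ 0
    have x₁ : (4 / 53) * z 1 + (-80 / 53) * z 4 = 0 := congrFun h₃ 1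
    have x₂ : (4) * z 2 = 0 := congrFun h₃ 2
    have x₃ : (-1 / 424) * z 1 + (-3 / 2) * z 2 + (29 / 53) * z 4 = 0 := congrFun h₃ 3
    refine ⟨?_, ?_, ?_, ?_, ?_⟩
    · linear_combination (-112) * x₀ + (1094) * x₁ + (7626) * x₂ + (20216) * x₃ + (-1 / 53) * h₁
    · linear_combination (29 / 2) * x₁ + (15) * x₂ + (40) * x₃
    · linear_combination (1 / 4) * x₂
    · linear_combination (1 / 2) * x₀ + (-7 / 16) * x₁ + (1) * x₃
    · linear_combination (1 / 16) * x₁ + (3 / 4) * x₂ + (2) * x₃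

theorem obstructed_sub_seven_0100 : IsObstructed 2 (X - 7) 0 1 0 0 := by
  have h : (288 : 𝓞 K) * (e₃) * (Θ - 7) = -19696 + 17312 * Θ + 366 * Θ ^ 2 + 71 * Θ ^ 3 - 43 * Θ ^ 4 := by
    simp only [Θ_pow_two, Θ_pow_three, Θ_pow_four]
    simp [Θ, e₃, evO]
    linear_combination ((1440) * W ^ 0 + (-2880) * W ^ 1 + (576) * W ^ 3) * W_pow_five
  refine ⟨288, seqOf (-19696) (17312) (366) (71) (-43), by norm_num, ?_, ![-79, 100, -250, -1550, 46790], fun z h₁ h₂ => ?_⟩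
  · have h' := congrArg (algebraMap (𝓞 K) K) h
    simp only [map_mul, map_add, map_sub, map_pow, map_ofNat, map_neg, map_one] at h'
    simp [classRep, quarticOf, seqOf, θ, map_ofNat, RingOfIntegers.coe_eq_algebraMap]
    linear_combination h'
  · simp [hankelForm, traceSeq, seqOf, topSeq] at h₁ h₂
    have h₃ : (![(-256 / 79) * z 1 + (8 / 79) * z 2 + (-456 / 79) * z 3 + (-208 / 79) * z 4, (-10 / 79) * z 1 + (-4 / 237) * z 2 + (544 / 237) * z 3 + (104 / 237) * z 4, (545 / 158) * z 1 + (-39 / 316) * z 2 + (2223 / 316) * z 3 + (1093 / 316) * z 4, (69 / 158) * z 1 + (-2 / 237) * z 2 + (272 / 237) * z 3 + (52 / 237) * z 4] : Fin 4 → ℚ_[2]) = 0 := by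
      apply two_adic_anisotropic (k := ![296425, -462971, 226720, 2500852, 128737, -303328, -975676, -33266, 2142362, 685210])
      · decide
      · simp [quadForm]
        linear_combination (1 / 96) * h₂ - ((43 / 7584) * z 0 + (-5111 / 74892) * z 1 + (-57199 / 299568) * z 2 + (33667 / 299568) * z 3 + (1405409 / 299568) * z 4) * h₁
    have x₀ : (-256 / 79) * z 1 + (8 / 79) * z 2 + (-456 / 79) * z 3 + (-208 / 79) * z 4 = 0 := congrFun h₃ 0
    have x₁ : (-10 / 79) * z 1 + (-4 / 237) * z 2 + (544 / 237) * z 3 + (104 / 237) * z 4 = 0 := congrFun h₃ 1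
    have x₂ : (545 / 158) * z 1 + (-39 / 316) * z 2 + (2223 / 316) * z 3 + (1093 / 316) * z 4 = 0 := congrFun h₃ 2
    have x₃ : (69 / 158) * z 1 + (-2 / 237) * z 2 + (272 / 237) * z 3 + (52 / 237) * z 4 = 0 := congrFun h₃ 3
    refine ⟨?_, ?_, ?_, ?_, ?_⟩
    · linear_combination (2430) * x₀ + (-970) * x₁ + (2040) * x₂ + (1640) * x₃ + (-1 / 79) * h₁
    · linear_combination (-1) * x₁ + (2) * x₃
    · linear_combination (575 / 4) * x₀ + (-279 / 4) * x₁ + (104) * x₂ + (225) * x₃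
    · linear_combination (1 / 8) * x₀ + (1 / 4) * x₁ + (1) * x₃
    · linear_combination (39 / 8) * x₀ + (-2) * x₁ + (4) * x₂ + (4) * x₃

theorem obstructed_quadratic_twelve_0101 : IsObstructed 2 (X ^ 2 + 12 * X + 24) 0 1 0 1 := by
  have h : (18 : 𝓞 K) * (e₃ * ρ₃) * (Θ ^ 2 + 12 * Θ + 24) = -1552 + 1376 * Θ + 126 * Θ ^ 2 + 23 * Θ ^ 3 - 1 * Θ ^ 4 := by
    simp only [Θ_pow_two, Θ_pow_three, Θ_pow_four]
    simp [Θ, e₃, ρ₃, evO]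
    linear_combination ((288) * W ^ 0 + (2862) * W ^ 1 + (18) * W ^ 2 + (-3186) * W ^ 3 + (-216) * W ^ 4 + (720) * W ^ 5 + (36) * W ^ 6) * W_pow_five
  refine ⟨18, seqOf (-1552) (1376) (126) (23) (-1), by norm_num, ?_, ![31, 446, -3794, 3218, 161302], fun z h₁ h₂ => ?_⟩
  · have h' := congrArg (algebraMap (𝓞 K) K) h
    simp only [map_mul, map_add, map_sub, map_pow, map_ofNat, map_neg, map_one] at h'
    simp [classRep, quarticOf, seqOf, θ, map_ofNat, RingOfIntegers.coe_eq_algebraMap]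
    linear_combination h'
  · simp [hankelForm, traceSeq, seqOf, topSeq] at h₁ h₂
    have h₃ : (![(-345 / 31) * z 1 + (-523 / 31) * z 2 + (-153 / 31) * z 3 + (-251 / 31) * z 4, (249 / 31) * z 1 + (371 / 31) * z 2 + (449 / 31) * z 3 + (179 / 31) * z 4, (158 / 31) * z 1 + (152 / 31) * z 2 + (200 / 31) * z 3 + (72 / 31) * z 4, (153 / 31) * z 1 + (219 / 31) * z 2 + (-247 / 31) * z 3 + (107 / 31) * z 4] : Fin 4 → ℚ_[2]) = 0 := by
      apply two_adic_anisotropic (k := ![-180429867, -340937115, 74478672, -335812908, -161057199, 70366796, -317273096, -7685898, 69309178, -156252262])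
      · decide
      · simp [quadForm]
        linear_combination (1 / 18) * h₂ - ((-1 / 558) * z 0 + (1091 / 8649) * z 1 + (-1091 / 8649) * z 2 + (3035 / 8649) * z 3 + (72529 / 8649) * z 4) * h₁
    have x₀ : (-345 / 31) * z 1 + (-523 / 31) * z 2 + (-153 / 31) * z 3 + (-251 / 31) * z 4 = 0 := congrFun h₃ 0
    have x₁ : (249 / 31) * z 1 + (371 / 31) * z 2 + (449 / 31) * z 3 + (179 / 31) * z 4 = 0 := congrFun h₃ 1
    have x₂ : (158 / 31) * z 1 + (152 / 31) * z 2 + (200 / 31) * z 3 + (72 / 31) * z 4 = 0 := congrFun h₃ 2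
    have x₃ : (153 / 31) * z 1 + (219 / 31) * z 2 + (-247 / 31) * z 3 + (107 / 31) * z 4 = 0 := congrFun h₃ 3
    refine ⟨?_, ?_, ?_, ?_, ?_⟩
    · linear_combination (-114191 / 2) * x₀ + (-107889 / 2) * x₁ + (11792) * x₂ + (-53133) * x₃ + (1 / 31) * h₁
    · linear_combination (1 / 4) * x₀ + (1 / 2) * x₂ + (1 / 4) * x₃
    · linear_combination (-87 / 16) * x₀ + (-79 / 16) * x₁ + (3 / 4) * x₂ + (-5) * x₃
    · linear_combination (1 / 32) * x₀ + (1 / 16) * x₁ + (-1 / 32) * x₃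
    · linear_combination (347 / 32) * x₀ + (41 / 4) * x₁ + (-9 / 4) * x₂ + (323 / 32) * x₃

theorem obstructed_quadratic_twelve_0110 : IsObstructed 2 (X ^ 2 + 12 * X + 24) 0 1 1 0 := by
  have h : (18 : 𝓞 K) * (e₃ * ρ₂) * (Θ ^ 2 + 12 * Θ + 24) = 5248 - 5336 * Θ + 492 * Θ ^ 2 + 67 * Θ ^ 3 + 25 * Θ ^ 4 := by
    simp only [Θ_pow_two, Θ_pow_three, Θ_pow_four]
    simp [Θ, e₃, ρ₂, evO]
    linear_combination ((-1008) * W ^ 0 + (1440) * W ^ 1 + (-1602) * W ^ 2 + (-864) * W ^ 3 + (684) * W ^ 4 + (36) * W ^ 5) * W_pow_five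
  refine ⟨18, seqOf (5248) (-5336) (492) (67) (25), by norm_num, ?_, ![6, -43, -97, -555, 4975], fun z h₁ h₂ => ?_⟩
  · have h' := congrArg (algebraMap (𝓞 K) K) h
    simp only [map_mul, map_add, map_sub, map_pow, map_ofNat, map_neg, map_one] at h'
    simp [classRep, quarticOf, seqOf, θ, map_ofNat, RingOfIntegers.coe_eq_algebraMap]
    linear_combination h'
  · simp [hankelForm, traceSeq, seqOf, topSeq] at h₁ h₂
    have h₃ : (![(-12) * z 1 + (6) * z 2 + (-6) * z 3 + (-2) * z 4, (29 / 2) * z 1 + (7 / 2) * z 2 + (29 / 2) * z 3 + (7 / 2) * z 4, (12) * z 1 + (10) * z 2 + (6) * z 3 + (2) * z 4, (7 / 12) * z 1 + (-59 / 12) * z 2 + (13 / 4) * z 3 + (5 / 12) * z 4] : Fin 4 → ℚ_[2]) = 0 := by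
      apply two_adic_anisotropic (k := ![7764413, -52567271, 72760572, 129491372, 88972349, -246301452, -438342100, 170458506, 606728826, 539896214])
      · decide
      · simp [quadForm]
        linear_combination (1 / 2) * h₂ - ((25 / 12) * z 0 + (379 / 72) * z 1 + (-191 / 72) * z 2 + (4921 / 24) * z 3 + (-112879 / 72) * z 4) * h₁
    have x₀ : (-12) * z 1 + (6) * z 2 + (-6) * z 3 + (-2) * z 4 = 0 := congrFun h₃ 0
    have x₁ : (29 / 2) * z 1 + (7 / 2) * z 2 + (29 / 2) * z 3 + (7 / 2) * z 4 = 0 := congrFun h₃ 1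
    have x₂ : (12) * z 1 + (10) * z 2 + (6) * z 3 + (2) * z 4 = 0 := congrFun h₃ 2
    have x₃ : (7 / 12) * z 1 + (-59 / 12) * z 2 + (13 / 4) * z 3 + (5 / 12) * z 4 = 0 := congrFun h₃ 3
    refine ⟨?_, ?_, ?_, ?_, ?_⟩
    · linear_combination (1649 / 2) * x₀ + (-5591 / 2) * x₁ + (7737 / 2) * x₂ + (6881) * x₃ + (1 / 6) * h₁
    · linear_combination (-3 / 8) * x₁ + (1 / 2) * x₂ + (3 / 4) * x₃
    · linear_combination (1 / 16) * x₀ + (1 / 16) * x₂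
    · linear_combination (7 / 32) * x₀ + (-23 / 64) * x₁ + (19 / 32) * x₂ + (39 / 32) * x₃
    · linear_combination (-31 / 32) * x₀ + (213 / 64) * x₁ + (-147 / 32) * x₂ + (-261 / 32) * x₃

theorem obstructed_quadratic_twelve_0111 : IsObstructed 2 (X ^ 2 + 12 * X + 24) 0 1 1 1 := by
  have h : (18 : 𝓞 K) * (e₃ * ρ₂ * ρ₃) * (Θ ^ 2 + 12 * Θ + 24) = 512 + 632 * Θ - 252 * Θ ^ 2 - 37 * Θ ^ 3 - 7 * Θ ^ 4 := by
    simp only [Θ_pow_two, Θ_pow_three, Θ_pow_four]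
    simp [Θ, e₃, ρ₂, ρ₃, evO]
    linear_combination ((522) * W ^ 0 + (-2700) * W ^ 1 + (3132) * W ^ 2 + (6066) * W ^ 3 + (-2952) * W ^ 4 + (-4122) * W ^ 5 + (468) * W ^ 6 + (756) * W ^ 7 + (36) * W ^ 8) * W_pow_five
  refine ⟨18, seqOf (512) (632) (-252) (-37) (-7), by norm_num, ?_, ![-1, 0, -34, 58, 1470], fun z h₁ h₂ => ?_⟩
  · have h' := congrArg (algebraMap (𝓞 K) K) h
    simp only [map_mul, map_add, map_sub, map_pow, map_ofNat, map_neg, map_one] at h'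
    simp [classRep, quarticOf, seqOf, θ, map_ofNat, RingOfIntegers.coe_eq_algebraMap]
    linear_combination h'
  · simp [hankelForm, traceSeq, seqOf, topSeq] at h₁ h₂
    have h₃ : (![(-1) * z 1 + (-47) * z 2 + (-5) * z 3 + (1) * z 4, (8) * z 1, (-13) * z 1 + (-4) * z 2 + (8) * z 3, (16) * z 2] : Fin 4 → ℚ_[2]) = 0 := by
      apply two_adic_anisotropic (k := ![-6326435, -14447663, -7917088, -39127500, -8250083, -9042056, -44678016, -2477522, -24482862, -60498594])
      · decide
      · simp [quadForm]
        linear_combination (1 / 2) * h₂ - ((7 / 2) * z 0 + (2) * z 1 + (-157) * z 2 + (241) * z 3 + (3883) * z 4) * h₁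
    have x₀ : (-1) * z 1 + (-47) * z 2 + (-5) * z 3 + (1) * z 4 = 0 := congrFun h₃ 0
    have x₁ : (8) * z 1 = 0 := congrFun h₃ 1
    have x₂ : (-13) * z 1 + (-4) * z 2 + (8) * z 3 = 0 := congrFun h₃ 2
    have x₃ : (16) * z 2 = 0 := congrFun h₃ 3
    refine ⟨?_, ?_, ?_, ?_, ?_⟩
    · linear_combination (1470) * x₀ + (3377 / 2) * x₁ + (926) * x₂ + (9095 / 2) * x₃ + (-1) * h₁
    · linear_combination (1 / 8) * x₁
    · linear_combination (1 / 16) * x₃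
    · linear_combination (13 / 64) * x₁ + (1 / 8) * x₂ + (1 / 32) * x₃
    · linear_combination (1) * x₀ + (73 / 64) * x₁ + (5 / 8) * x₂ + (99 / 32) * x₃

theorem obstructed_quadratic_four_1000 : IsObstructed 2 (X ^ 2 + 4 * X - 4) 1 0 0 0 := by
  have h : (72 : 𝓞 K) * (e₁) * (Θ ^ 2 + 4 * Θ - 4) = 1712 - 1216 * Θ + 390 * Θ ^ 2 + 53 * Θ ^ 3 + 11 * Θ ^ 4 := by
    simp only [Θ_pow_two, Θ_pow_three, Θ_pow_four]
    simp [Θ, e₁, evO]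
    linear_combination ((504) * W ^ 0 + (288) * W ^ 1 + (-504) * W ^ 2) * W_pow_five
  refine ⟨72, seqOf (1712) (-1216) (390) (53) (11), by norm_num, ?_, ![-3, 38, -34, -1086, 10150], fun z h₁ h₂ => ?_⟩
  · have h' := congrArg (algebraMap (𝓞 K) K) h
    simp only [map_mul, map_add, map_sub, map_pow, map_ofNat, map_neg, map_one] at h'
    simp [classRep, quarticOf, seqOf, θ, map_ofNat, RingOfIntegers.coe_eq_algebraMap]
    linear_combination h'
  · simp [hankelForm, traceSeq, seqOf, topSeq] at h₁ h₂
    have h₃ : (![(10 / 3) * z 1 + (-44 / 3) * z 2 + (4) * z 3 + (20 / 3) * z 4, (-8 / 3) * z 1 + (-8 / 3) * z 2 + (-16 / 3) * z 4, (17 / 6) * z 1 + (5 / 6) * z 2 + (-3 / 2) * z 3 + (37 / 6) * z 4, (-5 / 3) * z 1 + (34 / 3) * z 2 + (-2) * z 3 + (-10 / 3) * z 4] : Fin 4 → ℚ_[2]) = 0 := by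
      apply two_adic_anisotropic (k := ![126289557, 268491429, 177404832, 376962012, 142702461, 188579856, 400710132, 62301490, 264767814, 281298690])
      · decide
      · simp [quadForm]
        linear_combination (1 / 8) * h₂ - ((-11 / 24) * z 0 + (-203 / 36) * z 1 + (307 / 36) * z 2 + (2047 / 12) * z 3 + (-55561 / 36) * z 4) * h₁
    have x₀ : (10 / 3) * z 1 + (-44 / 3) * z 2 + (4) * z 3 + (20 / 3) * z 4 = 0 := congrFun h₃ 0
    have x₁ : (-8 / 3) * z 1 + (-8 / 3) * z 2 + (-16 / 3) * z 4 = 0 := congrFun h₃ 1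
    have x₂ : (17 / 6) * z 1 + (5 / 6) * z 2 + (-3 / 2) * z 3 + (37 / 6) * z 4 = 0 := congrFun h₃ 2
    have x₃ : (-5 / 3) * z 1 + (34 / 3) * z 2 + (-2) * z 3 + (-10 / 3) * z 4 = 0 := congrFun h₃ 3
    refine ⟨?_, ?_, ?_, ?_, ?_⟩
    · linear_combination (9567) * x₀ + (10166) * x₁ + (6716) * x₂ + (14278) * x₃ + (-1 / 3) * h₁
    · linear_combination (-6) * x₀ + (-13 / 2) * x₁ + (-4) * x₂ + (-9) * x₃
    · linear_combination (1 / 8) * x₀ + (1 / 4) * x₃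
    · linear_combination (13 / 16) * x₀ + (5 / 16) * x₁ + (9 / 8) * x₃
    · linear_combination (47 / 16) * x₀ + (49 / 16) * x₁ + (2) * x₂ + (35 / 8) * x₃

theorem obstructed_add_four_1001 : IsObstructed 3 (X + 4) 1 0 0 1 := by
  have h : (48 : 𝓞 K) * (e₁ * ρ₃) * (Θ + 4) = 21088 - 2120 * Θ + 3408 * Θ ^ 2 + 445 * Θ ^ 3 + 73 * Θ ^ 4 := by
    simp only [Θ_pow_two, Θ_pow_three, Θ_pow_four]
    simp [Θ, e₁, ρ₃, evO]
    linear_combination ((576) * W ^ 0 + (48) * W ^ 1 + (-288) * W ^ 2 + (96) * W ^ 3 + (192) * W ^ 4 + (48) * W ^ 5) * W_pow_five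
  refine ⟨48, seqOf (21088) (-2120) (3408) (445) (73), by norm_num, ?_, ![17, 32, 72, -800, 3712], fun z h₁ h₂ => ?_⟩
  · have h' := congrArg (algebraMap (𝓞 K) K) h
    simp only [map_mul, map_add, map_sub, map_pow, map_ofNat, map_neg, map_one] at h'
    simp [classRep, quarticOf, seqOf, θ, map_ofNat, RingOfIntegers.coe_eq_algebraMap]
    linear_combination h'
  · simp [hankelForm, traceSeq, seqOf, topSeq] at h₁ h₂
    have h₃ : (![(396 / 17) * z 1 + (-27 / 17) * z 2 + (-108 / 17) * z 3 + (189 / 17) * z 4, (-81 / 17) * z 1 + (9 / 17) * z 2 + (36 / 17) * z 3 + (-63 / 17) * z 4, (223 / 102) * z 1 + (-19 / 51) * z 2 + (-45 / 34) * z 3 + (317 / 102) * z 4, (325 / 102) * z 1 + (-19 / 51) * z 2 + (-45 / 34) * z 3 + (215 / 102) * z 4] : Fin 4 → ℚ_[3]) = 0 := by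
      apply three_adic_anisotropic (k := ![163, -2070, 3672, -7992, 173593, -62244, 576684, 22998, -151380, 512022])
      · decide
      · simp [quadForm]
        linear_combination (1 / 24) * h₂ - ((73 / 408) * z 0 + (16 / 289) * z 1 + (-283 / 867) * z 2 + (7640 / 867) * z 3 + (-10996 / 289) * z 4) * h₁
    have x₀ : (396 / 17) * z 1 + (-27 / 17) * z 2 + (-108 / 17) * z 3 + (189 / 17) * z 4 = 0 := congrFun h₃ 0
    have x₁ : (-81 / 17) * z 1 + (9 / 17) * z 2 + (36 / 17) * z 3 + (-63 / 17) * z 4 = 0 := congrFun h₃ 1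
    have x₂ : (223 / 102) * z 1 + (-19 / 51) * z 2 + (-45 / 34) * z 3 + (317 / 102) * z 4 = 0 := congrFun h₃ 2
    have x₃ : (325 / 102) * z 1 + (-19 / 51) * z 2 + (-45 / 34) * z 3 + (215 / 102) * z 4 = 0 := congrFun h₃ 3
    refine ⟨?_, ?_, ?_, ?_, ?_⟩
    · linear_combination (-32 / 9) * x₀ + (2264 / 9) * x₁ + (-56) * x₂ + (440) * x₃ + (1 / 17) * h₁
    · linear_combination (1 / 9) * x₀ + (1 / 3) * x₁
    · linear_combination (-15) * x₁ + (-5) * x₂ + (-19) * x₃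
    · linear_combination (4 / 9) * x₀ + (50 / 9) * x₁ + (3) * x₂ + (3) * x₃
    · linear_combination (1 / 9) * x₀ + (1 / 3) * x₁ + (1) * x₂ + (-1) * x₃

theorem obstructed_sub_seven_1010 : IsObstructed 2 (X - 7) 1 0 1 0 := by
  have h : (288 : 𝓞 K) * (e₁ * ρ₂) * (Θ - 7) = -62944 + 5384 * Θ - 9648 * Θ ^ 2 - 1249 * Θ ^ 3 - 205 * Θ ^ 4 := by
    simp only [Θ_pow_two, Θ_pow_three, Θ_pow_four]
    simp [Θ, e₁, ρ₂, evO]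
    linear_combination ((-1440) * W ^ 0 + (-576) * W ^ 1 + (864) * W ^ 3 + (288) * W ^ 4) * W_pow_five
  refine ⟨288, seqOf (-62944) (5384) (-9648) (-1249) (-205), by norm_num, ?_, ![-67, -56, -208, 760, 5960], fun z h₁ h₂ => ?_⟩
  · have h' := congrArg (algebraMap (𝓞 K) K) h
    simp only [map_mul, map_add, map_sub, map_pow, map_ofNat, map_neg, map_one] at h'
    simp [classRep, quarticOf, seqOf, θ, map_ofNat, RingOfIntegers.coe_eq_algebraMap]
    linear_combination h'
  · simp [hankelForm, traceSeq, seqOf, topSeq] at h₁ h₂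
    have h₃ : (![(41 / 134) * z 1 + (928 / 67) * z 2 + (186 / 67) * z 3 + (-1038 / 67) * z 4, (-22 / 67) * z 1 + (-790 / 67) * z 2 + (-46 / 67) * z 3 + (1078 / 67) * z 4, (-41 / 134) * z 1 + (-660 / 67) * z 2 + (-186 / 67) * z 3 + (1038 / 67) * z 4, (3 / 67) * z 1 + (59 / 67) * z 2 + (55 / 67) * z 3 + (-147 / 67) * z 4] : Fin 4 → ℚ_[2]) = 0 := by
      apply two_adic_anisotropic (k := ![-3251, 14289, -33404, -79888, -15863, 73916, 176908, -86202, -412526, -493590])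
      · decide
      · simp [quadForm]
        linear_combination (1 / 288) * h₂ - ((205 / 19296) * z 0 + (2317 / 161604) * z 1 + (41 / 40401) * z 2 + (26443 / 161604) * z 3 + (153797 / 161604) * z 4) * h₁
    have x₀ : (41 / 134) * z 1 + (928 / 67) * z 2 + (186 / 67) * z 3 + (-1038 / 67) * z 4 = 0 := congrFun h₃ 0
    have x₁ : (-22 / 67) * z 1 + (-790 / 67) * z 2 + (-46 / 67) * z 3 + (1078 / 67) * z 4 = 0 := congrFun h₃ 1
    have x₂ : (-41 / 134) * z 1 + (-660 / 67) * z 2 + (-186 / 67) * z 3 + (1038 / 67) * z 4 = 0 := congrFun h₃ 2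
    have x₃ : (3 / 67) * z 1 + (59 / 67) * z 2 + (55 / 67) * z 3 + (-147 / 67) * z 4 = 0 := congrFun h₃ 3
    refine ⟨?_, ?_, ?_, ?_, ?_⟩
    · linear_combination (34) * x₀ + (-46) * x₁ + (130) * x₂ + (300) * x₃ + (-1 / 67) * h₁
    · linear_combination (15) * x₀ + (-111 / 2) * x₁ + (113) * x₂ + (285) * x₃
    · linear_combination (1 / 4) * x₀ + (1 / 4) * x₂
    · linear_combination (1 / 4) * x₀ + (3 / 16) * x₁ + (1 / 4) * x₂ + (11 / 8) * x₃
    · linear_combination (1 / 2) * x₀ + (-17 / 16) * x₁ + (5 / 2) * x₂ + (47 / 8) * x₃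

theorem obstructed_quadratic_four_1011 : IsObstructed 2 (X ^ 2 + 4 * X - 4) 1 0 1 1 := by
  have h : (36 : 𝓞 K) * (e₁ * ρ₂ * ρ₃) * (Θ ^ 2 + 4 * Θ - 4) = 27536 - 2776 * Θ + 4446 * Θ ^ 2 + 581 * Θ ^ 3 + 95 * Θ ^ 4 := by
    simp only [Θ_pow_two, Θ_pow_three, Θ_pow_four]
    simp [Θ, e₁, ρ₂, ρ₃, evO]
    linear_combination ((1692) * W ^ 0 + (-2844) * W ^ 2 + (-108) * W ^ 3 + (2448) * W ^ 4 + (684) * W ^ 5 + (-612) * W ^ 6 + (-252) * W ^ 7) * W_pow_five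
  refine ⟨36, seqOf (27536) (-2776) (4446) (581) (95), by norm_num, ?_, ![7, 38, 958, -7342, 7702], fun z h₁ h₂ => ?_⟩
  · have h' := congrArg (algebraMap (𝓞 K) K) h
    simp only [map_mul, map_add, map_sub, map_pow, map_ofNat, map_neg, map_one] at h'
    simp [classRep, quarticOf, seqOf, θ, map_ofNat, RingOfIntegers.coe_eq_algebraMap]
    linear_combination h'
  · simp [hankelForm, traceSeq, seqOf, topSeq] at h₁ h₂
    have h₃ : (![(-48 / 7) * z 1 + (-152 / 7) * z 2 + (-16 / 7) * z 3 + (-32 / 7) * z 4, (-20 / 7) * z 1 + (-110 / 7) * z 2 + (-2 / 7) * z 3 + (10 / 7) * z 4, (31 / 7) * z 1 + (48 / 7) * z 2 + (8 / 7) * z 3 + (16 / 7) * z 4, (-10 / 7) * z 1 + (-27 / 7) * z 2 + (-1 / 7) * z 3 + (5 / 7) * z 4] : Fin 4 → ℚ_[2]) = 0 := by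
      apply two_adic_anisotropic (k := ![31000289, -98142071, 114606180, 253905996, 77675849, -181413396, -401916660, 105923646, 469342926, 519912126])
      · decide
      · simp [quadForm]
        linear_combination (1 / 36) * h₂ - ((95 / 252) * z 0 + (-1063 / 882) * z 1 + (-44693 / 882) * z 2 + (348773 / 882) * z 3 + (-359153 / 882) * z 4) * h₁
    have x₀ : (-48 / 7) * z 1 + (-152 / 7) * z 2 + (-16 / 7) * z 3 + (-32 / 7) * z 4 = 0 := congrFun h₃ 0
    have x₁ : (-20 / 7) * z 1 + (-110 / 7) * z 2 + (-2 / 7) * z 3 + (10 / 7) * z 4 = 0 := congrFun h₃ 1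
    have x₂ : (31 / 7) * z 1 + (48 / 7) * z 2 + (8 / 7) * z 3 + (16 / 7) * z 4 = 0 := congrFun h₃ 2
    have x₃ : (-10 / 7) * z 1 + (-27 / 7) * z 2 + (-1 / 7) * z 3 + (5 / 7) * z 4 = 0 := congrFun h₃ 3
    refine ⟨?_, ?_, ?_, ?_, ?_⟩
    · linear_combination (-3434) * x₀ + (5437) * x₁ + (-6350) * x₂ + (-14072) * x₃ + (1 / 7) * h₁
    · linear_combination (1 / 2) * x₀ + (-1 / 2) * x₁ + (1) * x₂ + (1) * x₃
    · linear_combination (-1 / 8) * x₁ + (1 / 4) * x₃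
    · linear_combination (-45 / 16) * x₀ + (69 / 16) * x₁ + (-5) * x₂ + (-85 / 8) * x₃
    · linear_combination (7 / 16) * x₀ + (-13 / 16) * x₁ + (1) * x₂ + (21 / 8) * x₃

theorem obstructed_sub_seven_1100 : IsObstructed 2 (X - 7) 1 1 0 0 := by
  have h : (6 : 𝓞 K) * (e₁ * e₃) * (Θ - 7) = 618 - 927 * Θ + 275 * Θ ^ 2 + 40 * Θ ^ 3 + 8 * Θ ^ 4 := by
    simp only [Θ_pow_two, Θ_pow_three, Θ_pow_four]
    simp [Θ, e₁, e₃, evO]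
    linear_combination ((-228) * W ^ 0 + (114) * W ^ 1 + (-54) * W ^ 2 + (42) * W ^ 3 + (-72) * W ^ 4 + (12) * W ^ 6) * W_pow_five
  refine ⟨6, seqOf (618) (-927) (275) (40) (8), by norm_num, ?_, ![8, 0, -45, -62, 168], fun z h₁ h₂ => ?_⟩
  · have h' := congrArg (algebraMap (𝓞 K) K) h
    simp only [map_mul, map_add, map_sub, map_pow, map_ofNat, map_neg, map_one] at h'
    simp [classRep, quarticOf, seqOf, θ, map_ofNat, RingOfIntegers.coe_eq_algebraMap]
    linear_combination h'
  · simp [hankelForm, traceSeq, seqOf, topSeq] at h₁ h₂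
    have h₃ : (![(3 / 2) * z 2 + (1) * z 3 + (4) * z 4, (-11 / 4) * z 2 + (-5 / 2) * z 3, (1 / 2) * z 1, (-3 / 2) * z 2 + (-1) * z 3] : Fin 4 → ℚ_[2]) = 0 := by
      apply two_adic_anisotropic (k := ![21, 1073, 300, -2036, -1275, -628, 6056, -90, 1534, -6926])
      · decide
      · simp [quadForm]
        linear_combination (1 / 2) * h₂ - ((1 / 2) * z 0 + (-45 / 16) * z 2 + (-31 / 8) * z 3 + (21 / 2) * z 4) * h₁
    have x₀ : (3 / 2) * z 2 + (1) * z 3 + (4) * z 4 = 0 := congrFun h₃ 0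
    have x₁ : (-11 / 4) * z 2 + (-5 / 2) * z 3 = 0 := congrFun h₃ 1
    have x₂ : (1 / 2) * z 1 = 0 := congrFun h₃ 2
    have x₃ : (-3 / 2) * z 2 + (-1) * z 3 = 0 := congrFun h₃ 3
    refine ⟨?_, ?_, ?_, ?_, ?_⟩
    · linear_combination (-21 / 4) * x₀ + (-6) * x₁ + (2) * x₃ + (1 / 8) * h₁
    · linear_combination (2) * x₂
    · linear_combination (1) * x₁ + (-5 / 2) * x₃
    · linear_combination (-3 / 2) * x₁ + (11 / 4) * x₃
    · linear_combination (1 / 4) * x₀ + (1 / 4) * x₃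

theorem obstructed_sub_seven_1101 : IsObstructed 2 (X - 7) 1 1 0 1 := by
  have h : (144 : 𝓞 K) * (e₁ * e₃ * ρ₃) * (Θ - 7) = 1288 + 52 * Θ - 1953 * Θ ^ 2 - 287 * Θ ^ 3 - 38 * Θ ^ 4 := by
    simp only [Θ_pow_two, Θ_pow_three, Θ_pow_four]
    simp [Θ, e₁, e₃, ρ₃, evO]
    linear_combination ((1728) * W ^ 0 + (864) * W ^ 1 + (-1728) * W ^ 2 + (-1728) * W ^ 3 + (4320) * W ^ 4 + (2448) * W ^ 5 + (-3312) * W ^ 6 + (-2016) * W ^ 7 + (576) * W ^ 8 + (288) * W ^ 9) * W_pow_five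
  refine ⟨144, seqOf (1288) (52) (-1953) (-287) (-38), by norm_num, ?_, ![15, 5, -76, -120, 448], fun z h₁ h₂ => ?_⟩
  · have h' := congrArg (algebraMap (𝓞 K) K) h
    simp only [map_mul, map_add, map_sub, map_pow, map_ofNat, map_neg, map_one] at h'
    simp [classRep, quarticOf, seqOf, θ, map_ofNat, RingOfIntegers.coe_eq_algebraMap]
    linear_combination h'
  · simp [hankelForm, traceSeq, seqOf, topSeq] at h₁ h₂
    have h₃ : (![(1 / 6) * z 1 + (-56 / 15) * z 2 + (-2) * z 3 + (218 / 15) * z 4, (1 / 3) * z 1 + (-268 / 15) * z 2 + (-8) * z 3 + (304 / 15) * z 4, (1 / 6) * z 1 + (-14 / 15) * z 2 + (-2) * z 3 + (242 / 15) * z 4, (-32 / 5) * z 2 + (-24 / 5) * z 4] : Fin 4 → ℚ_[2]) = 0 := by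
      apply two_adic_anisotropic (k := ![240813, 8181, -518400, -227988, 81, -8676, -3960, 278506, 245170, 54106])
      · decide
      · simp [quadForm]
        linear_combination (1 / 16) * h₂ - ((-19 / 120) * z 0 + (-34 / 45) * z 1 + (-83 / 225) * z 2 + (4) * z 3 + (1904 / 225) * z 4) * h₁
    have x₀ : (1 / 6) * z 1 + (-56 / 15) * z 2 + (-2) * z 3 + (218 / 15) * z 4 = 0 := congrFun h₃ 0
    have x₁ : (1 / 3) * z 1 + (-268 / 15) * z 2 + (-8) * z 3 + (304 / 15) * z 4 = 0 := congrFun h₃ 1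
    have x₂ : (1 / 6) * z 1 + (-14 / 15) * z 2 + (-2) * z 3 + (242 / 15) * z 4 = 0 := congrFun h₃ 2
    have x₃ : (-32 / 5) * z 2 + (-24 / 5) * z 4 = 0 := congrFun h₃ 3
    refine ⟨?_, ?_, ?_, ?_, ?_⟩
    · linear_combination (-1) * x₁ + (2) * x₃ + (1 / 15) * h₁
    · linear_combination (-202) * x₀ + (-3) * x₁ + (214) * x₂ + (95) * x₃
    · linear_combination (-3 / 2) * x₀ + (3 / 2) * x₂ + (1 / 2) * x₃
    · linear_combination (-1 / 4) * x₁ + (1 / 2) * x₂ + (5 / 8) * x₃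
    · linear_combination (2) * x₀ + (-2) * x₂ + (-7 / 8) * x₃

theorem obstructed_quadratic_twelve_1110 : IsObstructed 2 (X ^ 2 + 12 * X + 24) 1 1 1 0 := by
  have h : (6 : 𝓞 K) * (e₁ * e₃ * ρ₂) * (Θ ^ 2 + 12 * Θ + 24) = -1024 + 3016 * Θ - 1460 * Θ ^ 2 - 215 * Θ ^ 3 - 37 * Θ ^ 4 := by
    simp only [Θ_pow_two, Θ_pow_three, Θ_pow_four]
    simp [Θ, e₁, e₃, ρ₂, evO]
    linear_combination ((798) * W ^ 0 + (-168) * W ^ 1 + (-420) * W ^ 2 + (-90) * W ^ 3 + (996) * W ^ 4 + (-750) * W ^ 5 + (-300) * W ^ 6 + (228) * W ^ 7 + (12) * W ^ 8) * W_pow_five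
  refine ⟨6, seqOf (-1024) (3016) (-1460) (-215) (-37), by norm_num, ?_, ![-240, -743, 477, 3111, 6965], fun z h₁ h₂ => ?_⟩
  · have h' := congrArg (algebraMap (𝓞 K) K) h
    simp only [map_mul, map_add, map_sub, map_pow, map_ofNat, map_neg, map_one] at h'
    simp [classRep, quarticOf, seqOf, θ, map_ofNat, RingOfIntegers.coe_eq_algebraMap]
    linear_combination h'
  · simp [hankelForm, traceSeq, seqOf, topSeq] at h₁ h₂
    have h₃ : (![(182 / 15) * z 1 + (-6 / 5) * z 2 + (-18 / 5) * z 3 + (-250 / 3) * z 4, (-339 / 80) * z 1 + (1 / 80) * z 2 + (83 / 80) * z 3 + (37 / 16) * z 4, (659 / 160) * z 1 + (-1 / 160) * z 2 + (-83 / 160) * z 3 + (-37 / 32) * z 4, (-137 / 15) * z 1 + (1 / 5) * z 2 + (3 / 5) * z 3 + (31 / 3) * z 4] : Fin 4 → ℚ_[2]) = 0 := by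
      apply two_adic_anisotropic (k := ![21, -1451, 800, 1088, -18151, -41980, -3944, 6554, 26438, 7578])
      · decide
      · simp [quadForm]
        linear_combination (1 / 2) * h₂ - ((37 / 480) * z 0 + (-13091 / 115200) * z 1 + (-21317 / 38400) * z 2 + (-26591 / 38400) * z 3 + (18257 / 4608) * z 4) * h₁
    have x₀ : (182 / 15) * z 1 + (-6 / 5) * z 2 + (-18 / 5) * z 3 + (-250 / 3) * z 4 = 0 := congrFun h₃ 0
    have x₁ : (-339 / 80) * z 1 + (1 / 80) * z 2 + (83 / 80) * z 3 + (37 / 16) * z 4 = 0 := congrFun h₃ 1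
    have x₂ : (659 / 160) * z 1 + (-1 / 160) * z 2 + (-83 / 160) * z 3 + (-37 / 32) * z 4 = 0 := congrFun h₃ 2
    have x₃ : (-137 / 15) * z 1 + (1 / 5) * z 2 + (3 / 5) * z 3 + (31 / 3) * z 4 = 0 := congrFun h₃ 3
    refine ⟨?_, ?_, ?_, ?_, ?_⟩
    · linear_combination (4) * x₀ + (78) * x₁ + (142) * x₂ + (67 / 2) * x₃ + (-1 / 240) * h₁
    · linear_combination (1 / 4) * x₁ + (1 / 2) * x₂
    · linear_combination (35 / 16) * x₀ + (29) * x₁ + (64) * x₂ + (293 / 16) * x₃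
    · linear_combination (5 / 64) * x₀ + (11 / 4) * x₁ + (7 / 2) * x₂ + (13 / 32) * x₃
    · linear_combination (-3 / 64) * x₀ + (-1 / 2) * x₁ + (-1) * x₂ + (-9 / 32) * x₃

theorem obstructed_sub_seven_1111 : IsObstructed 2 (X - 7) 1 1 1 1 := by
  have h : (288 : 𝓞 K) * (e₁ * e₃ * ρ₂ * ρ₃) * (Θ - 7) = -6016 - 7288 * Θ - 1404 * Θ ^ 2 - 175 * Θ ^ 3 - 7 * Θ ^ 4 := by
    simp only [Θ_pow_two, Θ_pow_three, Θ_pow_four]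
    simp [Θ, e₁, e₃, ρ₂, ρ₃, evO]
    linear_combination ((-4320) * W ^ 0 + (1152) * W ^ 1 + (8640) * W ^ 2 + (1728) * W ^ 3 + (-15552) * W ^ 4 + (288) * W ^ 5 + (20160) * W ^ 6 + (2304) * W ^ 7 + (-11808) * W ^ 8 + (-3456) * W ^ 9 + (1728) * W ^ 10 + (576) * W ^ 11) * W_pow_five
  refine ⟨288, seqOf (-6016) (-7288) (-1404) (-175) (-7), by norm_num, ?_, ![47, 46, -208, -272, 2240], fun z h₁ h₂ => ?_⟩
  · have h' := congrArg (algebraMap (𝓞 K) K) h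
    simp only [map_mul, map_add, map_sub, map_pow, map_ofNat, map_neg, map_one] at h'
    simp [classRep, quarticOf, seqOf, θ, map_ofNat, RingOfIntegers.coe_eq_algebraMap]
    linear_combination h'
  · simp [hankelForm, traceSeq, seqOf, topSeq] at h₁ h₂
    have h₃ : (![(23 / 94) * z 1 + (-52 / 47) * z 2 + (-162 / 47) * z 3 + (278 / 47) * z 4, (8 / 47) * z 1 + (-216 / 47) * z 2 + (-80 / 47) * z 3 + (128 / 47) * z 4, (4) * z 2, (-9 / 188) * z 1 + (-139 / 47) * z 2 + (46 / 47) * z 3 + (-36 / 47) * z 4] : Fin 4 → ℚ_[2]) = 0 := by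
      apply two_adic_anisotropic (k := ![-1139, 2697, 588, -2556, -1503, -36, 3636, 990, 2538, -630])
      · decide
      · simp [quadForm]
        linear_combination (1 / 288) * h₂ - ((-7 / 13536) * z 0 + (-6419 / 318096) * z 1 + (-1291 / 19881) * z 2 + (-871 / 39762) * z 3 + (8198 / 19881) * z 4) * h₁
    have x₀ : (23 / 94) * z 1 + (-52 / 47) * z 2 + (-162 / 47) * z 3 + (278 / 47) * z 4 = 0 := congrFun h₃ 0
    have x₁ : (8 / 47) * z 1 + (-216 / 47) * z 2 + (-80 / 47) * z 3 + (128 / 47) * z 4 = 0 := congrFun h₃ 1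
    have x₂ : (4) * z 2 = 0 := congrFun h₃ 2
    have x₃ : (-9 / 188) * z 1 + (-139 / 47) * z 2 + (46 / 47) * z 3 + (-36 / 47) * z 4 = 0 := congrFun h₃ 3
    refine ⟨?_, ?_, ?_, ?_, ?_⟩
    · linear_combination (-16) * x₀ + (6) * x₁ + (-26) * x₂ + (-40) * x₃ + (1 / 47) * h₁
    · linear_combination (-8) * x₀ + (37 / 2) * x₁ + (22) * x₂ + (4) * x₃
    · linear_combination (1 / 4) * x₂
    · linear_combination (9 / 16) * x₁ + (17 / 8) * x₂ + (2) * x₃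
    · linear_combination (1 / 2) * x₀ + (-7 / 16) * x₁ + (3 / 8) * x₂ + (1) * x₃

end HalfMaps

theorem norm_two_mul_lt_one (y : ℤ_[2]) : ‖2 * y‖ < 1 := by
  rw [PadicInt.norm_lt_one_iff_dvd]
  exact ⟨y, by norm_num⟩

theorem exists_root_two_adic (α b γ : ℤ_[2]) : ∃ x : ℤ_[2], 2 * α * x ^ 2 + (1 + 2 * b) * x + γ = 0 := by
  have hunit (y : ℤ_[2]) : ‖1 + 2 * y‖ = 1 := by
    have h := PadicInt.norm_add_eq_max_of_ne (p := 2) (q := 1) (r := 2 * y)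
      (by rw [norm_one]; exact (norm_two_mul_lt_one y).ne')
    rw [h, norm_one]
    exact max_eq_left (norm_two_mul_lt_one y).le
  obtain ⟨x, hx, -⟩ := hensels_lemma (p := 2) (R := ℤ_[2])
    (F := C (2 * α) * X ^ 2 + C (1 + 2 * b) * X + C γ) (a := γ) (by
      have h1 : aeval γ (C (2 * α) * X ^ 2 + C (1 + 2 * b) * X + C γ : ℤ_[2][X]) =
          2 * (α * γ ^ 2 + b * γ + γ) := by
        simp only [map_add, map_mul, aeval_C, map_pow, aeval_X, Algebra.algebraMap_self_apply]
        ring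
      have h2 : aeval γ (derivative (C (2 * α) * X ^ 2 + C (1 + 2 * b) * X + C γ : ℤ_[2][X])) =
          1 + 2 * (2 * α * γ + b) := by
        simp; ring
      rw [h1, h2, hunit, one_pow]
      exact norm_two_mul_lt_one _)
  refine ⟨x, ?_⟩
  rw [← hx]
  simp

theorem exists_sq_eq_two_adic (y : ℤ_[2]) : ∃ u : ℤ_[2], u ≠ 0 ∧ u ^ 2 = 1 + 8 * y := by
  obtain ⟨z, hz⟩ := exists_root_two_adic 1 0 (-y)
  refine ⟨1 + 4 * z, fun h => ?_, by linear_combination 8 * hz⟩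
  have := norm_two_mul_lt_one (-2 * z)
  rw [show 2 * (-2 * z) = 1 by linear_combination -h, norm_one] at this
  exact lt_irrefl _ this

theorem exists_sq_eq_neg_five_three_adic : ∃ u : ℤ_[3], u ^ 2 = -5 := by
  obtain ⟨x, hx, -⟩ := hensels_lemma (p := 3) (R := ℤ_[3])
    (F := X ^ 2 + 5) (a := 1) (by
      have h1 : aeval (1 : ℤ_[3]) (X ^ 2 + 5 : ℤ_[3][X]) = ((6 : ℤ) : ℤ_[3]) := by
        simp; norm_num
      have h2 : aeval (1 : ℤ_[3]) (derivative (X ^ 2 + 5 : ℤ_[3][X])) = ((2 : ℤ) : ℤ_[3]) := by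
        simp; norm_num
      have h3 : ‖((2 : ℤ) : ℤ_[3])‖ = 1 := by
        refine le_antisymm (PadicInt.norm_le_one _) (not_lt.1 fun h => ?_)
        rw [PadicInt.norm_int_lt_one_iff_dvd] at h
        norm_num at h
      rw [h1, h2, h3, one_pow, PadicInt.norm_int_lt_one_iff_dvd]
      norm_num)
  refine ⟨x, ?_⟩
  have : x ^ 2 + 5 = 0 := by simpa [map_ofNat] using hx
  linear_combination this

/-- `E` defines a point over `ℚ_[p]` of the Jacobian, and divides no rational Mumford pair. -/
structure IsLocalPoint (p : ℕ) [Fact p.Prime] (E : ℚ[X]) : Prop where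
  monic : E.Monic
  natDegree_pos : 1 ≤ E.natDegree
  natDegree_le : E.natDegree ≤ 2
  irreducible : Irreducible E
  not_dvd {A B : ℚ[X]} (h : IsMumford A B) : ¬ E ∣ A
  exists_dvd : ∃ BE : ℚ_[p][X], E.map (algebraMap ℚ ℚ_[p]) ∣ sextic ℚ_[p] - BE ^ 2

theorem IsObstructed.false {p : ℕ} [Fact p.Prime] {A B E : ℚ[X]} {a b c d : Fin 2} {s : K}
    (h : IsObstructed p E a b c d) (hE : IsLocalPoint p E) (hA : IsMumford A B) (hs0 : s ≠ 0)
    (hs : (twist A : K) * aeval θ A = classRep a b c d * s ^ 2) : False := by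
  obtain ⟨N, g, hN, hg, ha⟩ := h
  obtain ⟨BE, hBE⟩ := hE.exists_dvd
  exact false_of_anisotropicOnHyperplane hA hE.monic hE.natDegree_pos hE.natDegree_le
    hE.irreducible (hE.not_dvd hA) hBE hs0 hs hN hg ha

theorem isLocalPoint_linear {p : ℕ} [Fact p.Prime] (r : ℚ) (hr : ¬ IsSquare (eval r (sextic ℚ)))
    (h : IsSquare (algebraMap ℚ ℚ_[p] (eval r (sextic ℚ)))) : IsLocalPoint p (X - C r) where
  monic := monic_X_sub_C r
  natDegree_pos := (natDegree_X_sub_C r).ge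
  natDegree_le := by rw [natDegree_X_sub_C]; norm_num
  irreducible := irreducible_X_sub_C r
  not_dvd {A B} hA hdvd := by
    have := hdvd.trans hA.dvd
    rw [dvd_iff_isRoot, IsRoot, eval_sub, eval_pow, sub_eq_zero] at this
    exact hr ⟨_, this.trans (sq _)⟩
  exists_dvd := by
    obtain ⟨u, hu⟩ := h
    refine ⟨C u, ?_⟩
    rw [Polynomial.map_sub, map_X, map_C, dvd_iff_isRoot, IsRoot, eval_sub, eval_pow, eval_C, sq,
      ← hu, ← sextic_map (algebraMap ℚ ℚ_[p]), eval_map, eval₂_at_apply, sub_self]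

theorem isLocalPoint_quadratic {p : ℕ} [Fact p.Prime] (a b : ℤ) {r₀ r₁ : ℤ} {Q : ℤ[X]}
    (hQ : sextic ℤ = (X ^ 2 + C a * X + C b) * Q + (C r₀ + C r₁ * X))
    (hirr : ¬ IsSquare (((a ^ 2 - 4 * b : ℤ)) : ℚ))
    (hnorm : ¬ IsSquare (Algebra.norm ℚ (θ ^ 2 + ((a : ℚ) : K) * θ + ((b : ℚ) : K)))) {n κ : ℚ_[p]}
    (hn : n ^ 2 = r₀ ^ 2 - a * r₀ * r₁ + b * r₁ ^ 2) (hκ0 : κ ≠ 0)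
    (hκ : κ ^ 2 = 2 * r₀ - a * r₁ + 2 * n) :
    IsLocalPoint p (X ^ 2 + C (a : ℚ) * X + C (b : ℚ)) := by
  have hdeg : (X ^ 2 + C (a : ℚ) * X + C (b : ℚ)).natDegree = 2 := by compute_degree!
  have hmon : (X ^ 2 + C (a : ℚ) * X + C (b : ℚ)).Monic := by monicity!
  refine ⟨hmon, by omega, by omega, ?_, ?_, ?_⟩
  · rw [hmon.irreducible_iff_roots_eq_zero_of_degree_le_three (by omega) (by omega),
      Multiset.eq_zero_iff_forall_notMem]
    intro x hx
    have h0 : x ^ 2 + a * x + b = 0 := by simpa using (mem_roots'.1 hx).2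
    refine hirr ⟨2 * x + a, ?_⟩
    push_cast
    linear_combination (-4) * h0
  · intro A B hA hdvd
    have hA2 : A.natDegree = 2 := le_antisymm hA.natDegree_le
      (hdeg ▸ natDegree_le_of_dvd hdvd hA.monic.ne_zero)
    have := eq_of_monic_of_dvd_of_natDegree_le hmon hA.monic hdvd (by omega)
    have h2 := isSquare_norm hA
    rw [twist, if_pos hA2, this] at h2
    apply hnorm
    simpa using h2
  · refine ⟨C κ⁻¹ * (C (r₀ + n) + C (r₁ : ℚ_[p]) * X), ?_⟩
    have hQ' := congrArg (Polynomial.map (Int.castRingHom ℚ_[p])) hQ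
    rw [sextic_map] at hQ'
    simp only [Polynomial.map_add, Polynomial.map_mul, Polynomial.map_pow, map_X,
      eq_intCast, Polynomial.map_intCast] at hQ'
    refine ⟨Q.map (Int.castRingHom ℚ_[p]) - C ((r₁ : ℚ_[p]) * κ⁻¹) ^ 2, ?_⟩
    rw [hQ']
    simp only [Polynomial.map_add, Polynomial.map_mul, Polynomial.map_pow, map_X,
      map_intCast, Polynomial.map_intCast]
    have hn' := congrArg (C : ℚ_[p] → ℚ_[p][X]) hn
    have hκ' := congrArg (C : ℚ_[p] → ℚ_[p][X]) hκ
    have hi := congrArg (C : ℚ_[p] → ℚ_[p][X]) (mul_inv_cancel₀ hκ0)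
    simp only [map_mul, map_add, map_sub, map_pow, map_ofNat, map_one, map_intCast] at hn' hκ' hi ⊢
    generalize (C κ⁻¹ : ℚ_[p][X]) = i at *
    generalize (C κ : ℚ_[p][X]) = k at *
    linear_combination (-i ^ 2) * hn' + (i ^ 2 * ((r₀ : ℚ_[p][X]) + r₁ * X)) * hκ' -
      ((r₀ : ℚ_[p][X]) + r₁ * X) * (i * k + 1) * hi

theorem isLocalPoint_sub_seven : IsLocalPoint 2 (X - 7) := by
  have he : eval 7 (sextic ℚ) = 202660 := by simp [sextic]; norm_num
  have := isLocalPoint_linear (p := 2) 7 (by rw [he]; norm_num) (by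
    obtain ⟨u, hu0, hu⟩ := exists_sq_eq_two_adic 6333
    rw [he]
    refine ⟨2 * PadicInt.Coe.ringHom u, ?_⟩
    have := congrArg (PadicInt.Coe.ringHom (p := 2)) hu
    simp only [map_add, map_mul, map_pow, map_ofNat, map_neg, map_one] at this
    simp only [map_ofNat]
    linear_combination (-4) * this)
  simpa [map_ofNat] using this

theorem isLocalPoint_add_four : IsLocalPoint 3 (X + 4) := by
  have he : eval (-4) (sextic ℚ) = -25920 := by simp [sextic]; norm_num
  have := isLocalPoint_linear (p := 3) (-4)
    (by rw [he]; intro h; have := h.nonneg; norm_num at this) (by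
    obtain ⟨u, hu⟩ := exists_sq_eq_neg_five_three_adic
    rw [he]
    refine ⟨72 * PadicInt.Coe.ringHom u, ?_⟩
    have := congrArg (PadicInt.Coe.ringHom (p := 3)) hu
    simp only [map_add, map_mul, map_pow, map_ofNat, map_neg, map_one] at this
    simp only [map_ofNat, map_neg]
    linear_combination (-5184) * this)
  simpa [map_ofNat] using this

theorem isLocalPoint_quadratic_twelve : IsLocalPoint 2 (X ^ 2 + 12 * X + 24) := by
  obtain ⟨x, hx⟩ := exists_root_two_adic 8 80 363
  obtain ⟨u, hu0, hu⟩ := exists_sq_eq_two_adic (-227 - 10 * x ^ 2 - 100 * x)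
  have hx' := congrArg (PadicInt.Coe.ringHom (p := 2)) hx
  have hu' := congrArg (PadicInt.Coe.ringHom (p := 2)) hu
  simp only [map_add, map_sub, map_mul, map_pow, map_ofNat, map_neg, map_one, map_zero] at hx' hu'
  have := isLocalPoint_quadratic (p := 2) 12 24 (r₀ := 131840) (r₁ := 56320)
    (Q := 5 * X ^ 3 - 35 * X ^ 2 + 500 * X - 5560)
    (by simp [sextic]; ring) (by norm_num) (by
      have := norm_quadratic_θ 1 12 24
      norm_num at this ⊢
      rw [this]; norm_num)
    (n := 1280 * (161 + 32 * PadicInt.Coe.ringHom x)) (κ := 128 * PadicInt.Coe.ringHom u)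
    (by push_cast; linear_combination 104857600 * hx')
    (mul_ne_zero (by norm_num) fun h0 => hu0 (Subtype.coe_injective h0))
    (by push_cast; linear_combination 16384 * hu' - 81920 * hx')
  simpa [map_ofNat] using this

theorem isLocalPoint_quadratic_four : IsLocalPoint 2 (X ^ 2 + 4 * X - 4) := by
  obtain ⟨x, hx⟩ := exists_root_two_adic 4 5 (-80)
  obtain ⟨u, hu0, hu⟩ := exists_sq_eq_two_adic (-77 + 5 * x)
  have hx' := congrArg (PadicInt.Coe.ringHom (p := 2)) hx
  have hu' := congrArg (PadicInt.Coe.ringHom (p := 2)) hu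
  simp only [map_add, map_sub, map_mul, map_pow, map_ofNat, map_neg, map_one, map_zero] at hx' hu'
  have := isLocalPoint_quadratic (p := 2) 4 (-4) (r₀ := -6320) (r₁ := 7120)
    (Q := 5 * X ^ 3 + 5 * X ^ 2 + 200 * X - 1180)
    (by simp [sextic]; ring) (by norm_num) (by
      have := norm_quadratic_θ 1 4 (-4)
      norm_num at this ⊢
      rw [this]; norm_num)
    (n := 80 * (11 + 16 * PadicInt.Coe.ringHom x)) (κ := 8 * PadicInt.Coe.ringHom u)
    (by push_cast; linear_combination 204800 * hx')
    (mul_ne_zero (by norm_num) fun h0 => hu0 (Subtype.coe_injective h0))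
    (by push_cast; linear_combination 64 * hu')
  simpa [sub_eq_add_neg, map_ofNat] using this

/-- The descent image of every Mumford pair is trivial. -/
theorem exists_sq_eq_aeval {A B : ℚ[X]} (h : IsMumford A B) :
    ∃ s : K, s ≠ 0 ∧ (twist A : K) * aeval θ A = s ^ 2 := by
  obtain ⟨a, b, c, d, s, hs0, hs⟩ := exists_class h
  have hc := isLocalPoint_sub_seven
  have hh := isLocalPoint_quadratic_twelve
  have hd := isLocalPoint_quadratic_four
  have hb := isLocalPoint_add_four
  fin_cases a <;> fin_cases b <;> fin_cases c <;> fin_cases d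
  · exact ⟨s, hs0, by simpa [classRep] using hs⟩
  · exact (obstructed_sub_seven_0001.false hc h hs0 hs).elim
  · exact (obstructed_sub_seven_0010.false hc h hs0 hs).elim
  · exact (obstructed_sub_seven_0011.false hc h hs0 hs).elim
  · exact (obstructed_sub_seven_0100.false hc h hs0 hs).elim
  · exact (obstructed_quadratic_twelve_0101.false hh h hs0 hs).elim
  · exact (obstructed_quadratic_twelve_0110.false hh h hs0 hs).elim
  · exact (obstructed_quadratic_twelve_0111.false hh h hs0 hs).elim
  · exact (obstructed_quadratic_four_1000.false hd h hs0 hs).elim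
  · exact (obstructed_add_four_1001.false hb h hs0 hs).elim
  · exact (obstructed_sub_seven_1010.false hc h hs0 hs).elim
  · exact (obstructed_quadratic_four_1011.false hd h hs0 hs).elim
  · exact (obstructed_sub_seven_1100.false hc h hs0 hs).elim
  · exact (obstructed_sub_seven_1101.false hc h hs0 hs).elim
  · exact (obstructed_quadratic_twelve_1110.false hh h hs0 hs).elim
  · exact (obstructed_sub_seven_1111.false hc h hs0 hs).elim

section Parity

theorem dvd_iff_toZMod_eq_zero {x : ℤ_[2]} : 2 ∣ x ↔ PadicInt.toZMod x = 0 := by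
  rw [← RingHom.mem_ker, PadicInt.ker_toZMod, PadicInt.maximalIdeal_eq_span_p,
    Ideal.mem_span_singleton]
  norm_num

theorem exists_eq_add_two_mul {x y : ℤ_[2]} (h : PadicInt.toZMod x = PadicInt.toZMod y) :
    ∃ u, x = y + 2 * u := by
  obtain ⟨u, hu⟩ := dvd_iff_toZMod_eq_zero.2 (show PadicInt.toZMod (x - y) = 0 by
    rw [map_sub, h, sub_self])
  exact ⟨u, by linear_combination hu⟩

theorem exists_eq_two_mul {x : ℤ_[2]} (h : PadicInt.toZMod x = 0) : ∃ u, x = 2 * u :=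
  dvd_iff_toZMod_eq_zero.2 h

theorem exists_eq_one_add_two_mul {x : ℤ_[2]} (h : PadicInt.toZMod x = 1) :
    ∃ u, x = 1 + 2 * u :=
  exists_eq_add_two_mul (by rw [h, map_one])

theorem sq_add_sq_ne {x y w : ℤ_[2]} (h : x ^ 2 + y ^ 2 = 3 + 4 * w) : False := by
  have := congrArg (PadicInt.toZModPow (p := 2) 2) h
  simp only [map_add, map_mul, map_pow, map_ofNat] at this
  generalize PadicInt.toZModPow (p := 2) 2 x = x, PadicInt.toZModPow (p := 2) 2 y = y,
    PadicInt.toZModPow (p := 2) 2 w = w at this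
  revert x y w
  decide

theorem toZMod_eq_of_two_mul_eq {x y : ℤ_[2]} (h : 2 * x = 2 * y) :
    PadicInt.toZMod x = PadicInt.toZMod y := by
  rw [mul_left_cancel₀ two_ne_zero h]

theorem toZMod_eq_of_four_mul_eq {x y : ℤ_[2]} (h : 4 * x = 4 * y) :
    PadicInt.toZMod x = PadicInt.toZMod y := by
  rw [mul_left_cancel₀ (by norm_num) h]

end Parity

section Coefficients

variable {R : Type*} [CommRing R]

theorem eq_of_natDegree_le_two {p : R[X]} (h : p.natDegree ≤ 2) :
    p = C (p.coeff 0) + C (p.coeff 1) * X + C (p.coeff 2) * X ^ 2 := by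
  conv_lhs => rw [p.as_sum_range_C_mul_X_pow' (n := 3) (by omega)]
  simp [Finset.sum_range_succ]

theorem eq_of_natDegree_le_three {p : R[X]} (h : p.natDegree ≤ 3) :
    p = C (p.coeff 0) + C (p.coeff 1) * X + C (p.coeff 2) * X ^ 2 + C (p.coeff 3) * X ^ 3 := by
  conv_lhs => rw [p.as_sum_range_C_mul_X_pow' (n := 4) (by omega)]
  simp [Finset.sum_range_succ]

theorem eq_of_natDegree_le_four {p : R[X]} (h : p.natDegree ≤ 4) :
    p = C (p.coeff 0) + C (p.coeff 1) * X + C (p.coeff 2) * X ^ 2 + C (p.coeff 3) * X ^ 3 +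
      C (p.coeff 4) * X ^ 4 := by
  conv_lhs => rw [p.as_sum_range_C_mul_X_pow' (n := 5) (by omega)]
  simp [Finset.sum_range_succ]

theorem coeffs_eq_zero {e₀ e₁ e₂ e₃ e₄ e₅ e₆ : R}
    (h : C e₀ + C e₁ * X + C e₂ * X ^ 2 + C e₃ * X ^ 3 + C e₄ * X ^ 4 + C e₅ * X ^ 5 +
      C e₆ * X ^ 6 = 0) :
    e₀ = 0 ∧ e₁ = 0 ∧ e₂ = 0 ∧ e₃ = 0 ∧ e₄ = 0 ∧ e₅ = 0 ∧ e₆ = 0 := by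
  have (i : ℕ) := congrArg (coeff · i) h
  refine ⟨?_, ?_, ?_, ?_, ?_, ?_, ?_⟩
  · simpa [coeff_X] using this 0
  · simpa [coeff_X] using this 1
  · simpa [coeff_X] using this 2
  · simpa [coeff_X] using this 3
  · simpa [coeff_X] using this 4
  · simpa [coeff_X] using this 5
  · simpa [coeff_X] using this 6

/-- The sextic of the curve in the coordinate in which it is minimal at `2`. -/
noncomputable def evenSextic (R : Type*) [CommRing R] : R[X] :=
  10 * X ^ 5 + 25 * X ^ 4 + 100 * X ^ 3 - 100 * X ^ 2 + 200 * X - 100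

theorem evenSextic_map {S : Type*} [CommRing S] (f : R →+* S) :
    (evenSextic R).map f = evenSextic S := by
  simp [evenSextic]

/-- The coefficients of the relation `c ^ 2 = f + ν a a' ^ 2` between forms. -/
theorem coeffs_of_relation {ν : R} {c a a' : R[X]} (hc : c.natDegree ≤ 3) (ha : a.natDegree ≤ 2)
    (ha' : a'.natDegree ≤ 2) (h : c ^ 2 = evenSextic R + C ν * (a * a' ^ 2)) :
    c.coeff 0 ^ 2 = -100 + ν * (a.coeff 0 * a'.coeff 0 ^ 2) ∧
    2 * c.coeff 1 * c.coeff 0 = 200 + ν * (a.coeff 1 * a'.coeff 0 ^ 2 +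
      2 * a.coeff 0 * a'.coeff 1 * a'.coeff 0) ∧
    2 * c.coeff 2 * c.coeff 0 + c.coeff 1 ^ 2 = -100 + ν * (a.coeff 2 * a'.coeff 0 ^ 2 +
      2 * a.coeff 1 * a'.coeff 1 * a'.coeff 0 +
      a.coeff 0 * (2 * a'.coeff 2 * a'.coeff 0 + a'.coeff 1 ^ 2)) ∧
    2 * c.coeff 3 * c.coeff 0 + 2 * c.coeff 2 * c.coeff 1 = 100 +
      ν * (2 * a.coeff 2 * a'.coeff 1 * a'.coeff 0 +
      a.coeff 1 * (2 * a'.coeff 2 * a'.coeff 0 + a'.coeff 1 ^ 2) +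
      2 * a.coeff 0 * a'.coeff 2 * a'.coeff 1) ∧
    2 * c.coeff 3 * c.coeff 1 + c.coeff 2 ^ 2 = 25 +
      ν * (a.coeff 2 * (2 * a'.coeff 2 * a'.coeff 0 + a'.coeff 1 ^ 2) +
      2 * a.coeff 1 * a'.coeff 2 * a'.coeff 1 + a.coeff 0 * a'.coeff 2 ^ 2) ∧
    2 * c.coeff 3 * c.coeff 2 = 10 + ν * (2 * a.coeff 2 * a'.coeff 2 * a'.coeff 1 +
      a.coeff 1 * a'.coeff 2 ^ 2) ∧
    c.coeff 3 ^ 2 = ν * (a.coeff 2 * a'.coeff 2 ^ 2) := by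
  rw [eq_of_natDegree_le_three hc, eq_of_natDegree_le_two ha, eq_of_natDegree_le_two ha',
    evenSextic] at h
  simp only [← sub_eq_zero (b := -100 + ν * _), ← sub_eq_zero (b := 200 + ν * _),
    ← sub_eq_zero (b := 100 + ν * _), ← sub_eq_zero (b := 25 + ν * _),
    ← sub_eq_zero (b := 10 + ν * _), ← sub_eq_zero (b := ν * _)]
  apply coeffs_eq_zero
  simp only [map_add, map_sub, map_mul, map_pow, map_ofNat, map_neg]
  linear_combination h

end Coefficients

section Relation

variable {c a a' : ℤ_[2][X]}

theorem relation_four_mul_false (hc : c.natDegree ≤ 3) (ha : a.natDegree ≤ 2)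
    (ha' : a'.natDegree ≤ 2) {ν : ℤ_[2]}
    (h : c ^ 2 = evenSextic ℤ_[2] + C (4 * ν) * (a * a' ^ 2)) : False := by
  obtain ⟨-, -, -, -, -, h5, h6⟩ := coeffs_of_relation hc ha ha' h
  generalize a.coeff 0 = a₀, a.coeff 1 = a₁, a.coeff 2 = a₂, a'.coeff 0 = a₀', a'.coeff 1 = a₁',
    a'.coeff 2 = a₂', c.coeff 2 = c₂, c.coeff 3 = c₃ at *
  obtain ⟨u, rfl⟩ : ∃ u, c₃ = 2 * u := exists_eq_two_mul (by
    have := congrArg PadicInt.toZMod h6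
    simp only [map_mul, map_pow, map_ofNat] at this
    revert this
    generalize PadicInt.toZMod c₃ = x
    generalize PadicInt.toZMod ν * _ = y
    rw [show (4 : ZMod 2) = 0 from rfl, zero_mul, zero_mul]
    exact pow_eq_zero_iff two_ne_zero |>.1)
  have := toZMod_eq_of_two_mul_eq (x := 2 * (u * c₂)) (y := 5 + 2 * (ν * (2 * a₂ * a₂' * a₁' + a₁ * a₂' ^ 2)))
    (by linear_combination h5)
  simp only [map_mul, map_add, map_ofNat, show (2 : ZMod 2) = 0 from rfl, zero_mul, add_zero] at this
  revert this
  decide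

theorem relation_two_false (hc : c.natDegree ≤ 3) (ha : a.natDegree ≤ 2)
    (ha' : a'.natDegree ≤ 2)
    (h : c ^ 2 = evenSextic ℤ_[2] + C 2 * (a * a' ^ 2)) : False := by
  obtain ⟨h0, h1, h2, h3, h4, h5, h6⟩ := coeffs_of_relation hc ha ha' h
  generalize a.coeff 0 = a₀, a.coeff 1 = a₁, a.coeff 2 = a₂, a'.coeff 0 = a₀', a'.coeff 1 = a₁',
    a'.coeff 2 = a₂', c.coeff 0 = c₀, c.coeff 1 = c₁, c.coeff 2 = c₂, c.coeff 3 = c₃ at *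
  have sq (x : ZMod 2) : x ^ 2 = x := by revert x; decide
  have n0 : (2 : ZMod 2) = 0 := rfl
  have n1 : (100 : ZMod 2) = 0 := rfl
  have n2 : (25 : ZMod 2) = 1 := rfl
  obtain ⟨u₀, rfl⟩ := exists_eq_two_mul (x := c₀) (by
    simpa [n0, n1, sq, map_ofNat] using congrArg PadicInt.toZMod h0)
  obtain ⟨u₁, rfl⟩ := exists_eq_two_mul (x := c₁) (by
    simpa [n0, n1, sq, map_ofNat] using congrArg PadicInt.toZMod h2)
  obtain ⟨u₂, rfl⟩ := exists_eq_one_add_two_mul (x := c₂) (by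
    simpa [n0, n2, sq, map_ofNat] using congrArg PadicInt.toZMod h4)
  obtain ⟨u₃, rfl⟩ := exists_eq_two_mul (x := c₃) (by
    simpa [n0, n1, sq, map_ofNat] using congrArg PadicInt.toZMod h6)
  have e0 := toZMod_eq_of_two_mul_eq (x := a₀ * a₀' ^ 2) (y := 2 * u₀ ^ 2 + 50)
    (by linear_combination -h0)
  have e1 := toZMod_eq_of_two_mul_eq (x := a₁ * a₀' ^ 2)
    (y := 4 * u₁ * u₀ - 100 - 2 * a₀ * a₁' * a₀') (by linear_combination -h1)
  have e3 := toZMod_eq_of_two_mul_eq (x := a₁ * a₁' ^ 2)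
    (y := 4 * u₃ * u₀ + 2 * (1 + 2 * u₂) * u₁ - 50 - 2 * a₂ * a₁' * a₀' - 2 * a₁ * a₂' * a₀' -
      2 * a₀ * a₂' * a₁') (by linear_combination -h3)
  have e4 := toZMod_eq_of_two_mul_eq (x := a₂ * a₁' ^ 2 + a₀ * a₂' ^ 2)
    (y := 4 * u₃ * u₁ + 2 * u₂ + 2 * u₂ ^ 2 - 12 - 2 * a₂ * a₂' * a₀' - 2 * a₁ * a₂' * a₁')
    (by linear_combination -h4)
  have e5 := toZMod_eq_of_two_mul_eq (x := a₁ * a₂' ^ 2)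
    (y := 2 * u₃ * (1 + 2 * u₂) - 5 - 2 * a₂ * a₂' * a₁') (by linear_combination -h5)
  have e6 := toZMod_eq_of_two_mul_eq (x := a₂ * a₂' ^ 2) (y := 2 * u₃ ^ 2)
    (by linear_combination -h6)
  simp only [map_mul, map_add, map_sub, map_pow, map_ofNat, sq, n0, show (50 : ZMod 2) = 0 from rfl,
    n1, show (4 : ZMod 2) = 0 from rfl, show (12 : ZMod 2) = 0 from rfl,
    show (5 : ZMod 2) = 1 from rfl, zero_mul, add_zero, sub_zero, zero_sub,
    show (-1 : ZMod 2) = 1 from rfl, mul_eq_zero] at e0 e1 e3 e4 e5 e6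
  have mem (x : ZMod 2) : x = 0 ∨ x = 1 := by revert x; decide
  have h1' : PadicInt.toZMod a₁ = 1 ∧ PadicInt.toZMod a₂' = 1 := by
    revert e5
    generalize PadicInt.toZMod a₁ = x, PadicInt.toZMod a₂' = y
    revert x y
    decide
  obtain ⟨p₁, rfl⟩ := exists_eq_one_add_two_mul h1'.1
  obtain ⟨q₂, rfl⟩ := exists_eq_one_add_two_mul h1'.2
  obtain ⟨q₀, rfl⟩ := exists_eq_two_mul (x := a₀') (e1.resolve_left (by rw [h1'.1]; decide))
  obtain ⟨q₁, rfl⟩ := exists_eq_two_mul (x := a₁') (e3.resolve_left (by rw [h1'.1]; decide))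
  obtain ⟨p₂, rfl⟩ := exists_eq_two_mul (x := a₂) (e6.resolve_right (by rw [h1'.2]; decide))
  have f0 := toZMod_eq_of_four_mul_eq (x := u₀ ^ 2) (y := -25 + 2 * a₀ * q₀ ^ 2)
    (by linear_combination h0)
  have f2 := toZMod_eq_of_four_mul_eq (x := (1 + 2 * u₂) * u₀ + u₁ ^ 2)
    (y := -25 + 4 * p₂ * q₀ ^ 2 + 4 * (1 + 2 * p₁) * q₁ * q₀ +
      2 * a₀ * ((1 + 2 * q₂) * q₀ + q₁ ^ 2)) (by linear_combination h2)
  have f3 := toZMod_eq_of_four_mul_eq (x := 2 * u₃ * u₀ + (1 + 2 * u₂) * u₁)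
    (y := 25 + 8 * p₂ * q₁ * q₀ + 2 * (1 + 2 * p₁) * ((1 + 2 * q₂) * q₀ + q₁ ^ 2) +
      2 * a₀ * (1 + 2 * q₂) * q₁) (by linear_combination h3)
  simp only [map_mul, map_add, map_neg, map_one, map_pow, map_ofNat, sq, n0, n2,
    show (8 : ZMod 2) = 0 from rfl, show (4 : ZMod 2) = 0 from rfl, zero_mul, add_zero, zero_add,
    one_mul, show (-1 : ZMod 2) = 1 from rfl] at f0 f2 f3
  rw [f0, f3] at f2
  exact absurd f2 (by decide)

end Relation

section UnitRelation

theorem toZMod_eq_zero_of_mul_eq {n x y : ℤ_[2]} (hn : n ≠ 0) (h : n * x = n * (2 * y)) :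
    PadicInt.toZMod x = 0 :=
  dvd_iff_toZMod_eq_zero.1 ⟨y, mul_left_cancel₀ hn h⟩

variable {c a a' : ℤ_[2][X]}

set_option maxRecDepth 4000 in
set_option synthInstance.maxSize 2000 in
set_option synthInstance.maxHeartbeats 200000 in
theorem unit_relation_mod_two : ∀ a₀ a₂ b₀ b₁ b₂ p₁ s₀ s₂ : ZMod 2, b₀ * s₀ = 0 →
    b₀ * p₁ + a₀ * a₂ * b₀ = 0 → a₀ * b₀ + b₀ * s₂ + b₁ * s₀ = 0 →
    a₀ * b₁ + a₂ * b₀ + b₁ * p₁ + a₀ * a₂ * b₁ = 0 →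
    a₀ * b₂ + a₂ * b₁ + b₁ * s₂ + b₂ * s₀ = 0 → 1 + a₂ * b₂ + b₂ * p₁ + a₀ * a₂ * b₂ = 0 →
    b₂ * s₂ = 0 → b₀ = 0 ∧ b₁ = 0 ∧ b₂ = 1 ∧ s₀ = a₀ := by
  decide

theorem relation_one_false (hc : c.natDegree ≤ 3) (ha : a.natDegree ≤ 2)
    (ha' : a'.natDegree ≤ 2)
    (h : c ^ 2 = evenSextic ℤ_[2] + C 1 * (a * a' ^ 2)) : False := by
  obtain ⟨h0, h1, h2, h3, h4, h5, h6⟩ := coeffs_of_relation hc ha ha' h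
  generalize a.coeff 0 = a₀, a.coeff 1 = a₁, a.coeff 2 = a₂, a'.coeff 0 = b₀, a'.coeff 1 = b₁,
    a'.coeff 2 = b₂, c.coeff 0 = c₀, c.coeff 1 = c₁, c.coeff 2 = c₂, c.coeff 3 = c₃ at *
  have mem (x : ZMod 2) : x = 0 ∨ x = 1 := by revert x; decide
  have sq (x : ZMod 2) : x ^ 2 = x := by revert x; decide
  have sqz (x : ℤ_[2]) : ∃ e, x ^ 2 = x + 2 * e :=
    exists_eq_add_two_mul (by rw [map_pow, sq])
  have n0 : (2 : ZMod 2) = 0 := rfl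
  have nn : (100 : ZMod 2) = 0 ∧ (200 : ZMod 2) = 0 ∧ (10 : ZMod 2) = 0 ∧
    (25 : ZMod 2) = 1 := by decide
  obtain ⟨n2, n3, n4, n5⟩ := nn
  have m0 := congrArg PadicInt.toZMod h0
  have m1 := congrArg PadicInt.toZMod h1
  have m2 := congrArg PadicInt.toZMod h2
  have m3 := congrArg PadicInt.toZMod h3
  have m4 := congrArg PadicInt.toZMod h4
  have m5 := congrArg PadicInt.toZMod h5
  have m6 := congrArg PadicInt.toZMod h6
  simp only [map_mul, map_add, map_neg, map_pow, map_ofNat, sq, n0, n2, n3, n4, n5,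
    zero_mul, zero_add, one_mul, neg_zero] at m0 m1 m2 m3 m4 m5 m6
  obtain ⟨d₀, rfl⟩ := exists_eq_add_two_mul (x := c₀) (y := a₀ * b₀) (by rw [m0, map_mul])
  obtain ⟨d₁, rfl⟩ := exists_eq_add_two_mul (x := c₁) (y := a₂ * b₀ + a₀ * b₁)
    (by simp [m2])
  obtain ⟨d₂, rfl⟩ := exists_eq_add_two_mul (x := c₂) (y := 1 + a₂ * b₁ + a₀ * b₂)
    (by simp [m4, add_assoc])
  obtain ⟨d₃, rfl⟩ := exists_eq_add_two_mul (x := c₃) (y := a₂ * b₂) (by rw [m6, map_mul])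
  have ha₁ : PadicInt.toZMod a₁ = 0 := by
    by_contra h'
    have h' := (mem _).resolve_left h'
    rw [h', one_mul, eq_comm] at m1 m3 m5
    obtain ⟨q₂, rfl⟩ := exists_eq_two_mul m5
    have := toZMod_eq_of_two_mul_eq (x := 2 * (a₂ * q₂ + d₃) * (1 + a₂ * b₁ + a₀ * (2 * q₂) + 2 * d₂))
      (y := 5 + 2 * (a₂ * q₂ * b₁ + a₁ * q₂ ^ 2)) (by linear_combination h5)
    simp only [map_mul, map_add, map_ofNat, n0, zero_mul, add_zero] at this
    exact absurd this (by decide)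
  obtain ⟨p₁, rfl⟩ := exists_eq_two_mul ha₁
  obtain ⟨s₀, hs₀⟩ := sqz a₀
  obtain ⟨s₂, hs₂⟩ := sqz a₂
  have e0 := toZMod_eq_zero_of_mul_eq (n := 2) (by norm_num) (x := b₀ ^ 2 * s₀) (y := -25 - d₀
      ^ 2 - a₀ * b₀ * d₀) (by linear_combination h0 - (b₀ ^ 2) * hs₀)
  have e1 := toZMod_eq_zero_of_mul_eq (n := 2) (by norm_num) (x := b₀ ^ 2 * p₁ + a₀ * a₂ * b₀ ^
      2) (y := 50 - 2 * d₀ * d₁ - a₀ * b₀ * d₁ - a₀ * b₁ * d₀ - a₂ * b₀ * d₀ - b₀ * b₁ * s₀ +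
      b₀ ^ 2 * p₁) (by linear_combination h1 - (2 * b₀ * b₁) * hs₀)
  have e2 := toZMod_eq_zero_of_mul_eq (n := 2) (by norm_num) (x := a₀ * b₀ + b₀ ^ 2 * s₂ + b₁ ^
      2 * s₀) (y := -25 - d₀ - 2 * d₀ * d₂ - d₁ ^ 2 - a₀ * b₀ * d₂ - a₀ * b₁ * d₁ - a₀ * b₂ *
      d₀ - a₂ * b₀ * d₁ - a₂ * b₁ * d₀ + b₀ * b₁ * p₁ - b₀ * b₂ * s₀ - a₀ * a₂ * b₀ * b₁) (by
      linear_combination h2 - (2 * b₀ * b₂ + b₁ ^ 2) * hs₀ - (b₀ ^ 2) * hs₂)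
  have e3 := toZMod_eq_zero_of_mul_eq (n := 2) (by norm_num) (x := a₀ * b₁ + a₂ * b₀ + b₁ ^ 2 *
      p₁ + a₀ * a₂ * b₁ ^ 2) (y := 25 - d₁ - 2 * d₀ * d₃ - 2 * d₁ * d₂ - a₀ * b₀ * d₃ - a₀ * b₁
      * d₂ - a₀ * b₂ * d₁ - a₂ * b₀ * d₂ - a₂ * b₁ * d₁ - a₂ * b₂ * d₀ - b₀ * b₁ * s₂ + b₀ * b₂
      * p₁ - b₁ * b₂ * s₀ + b₁ ^ 2 * p₁ - a₀ * a₂ * b₀ * b₂) (by linear_combination h3 - (2 *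
      b₁ * b₂) * hs₀ - (2 * b₀ * b₁) * hs₂)
  have e4 := toZMod_eq_zero_of_mul_eq (n := 2) (by norm_num) (x := a₀ * b₂ + a₂ * b₁ + b₁ ^ 2 *
      s₂ + b₂ ^ 2 * s₀) (y := 6 - d₂ - 2 * d₁ * d₃ - d₂ ^ 2 - a₀ * b₁ * d₃ - a₀ * b₂ * d₂ - a₂
      * b₀ * d₃ - a₂ * b₁ * d₂ - a₂ * b₂ * d₁ - b₀ * b₂ * s₂ + b₁ * b₂ * p₁ - a₀ * a₂ * b₁ *
      b₂) (by linear_combination h4 - (b₂ ^ 2) * hs₀ - (2 * b₀ * b₂ + b₁ ^ 2) * hs₂)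
  have e5 := toZMod_eq_zero_of_mul_eq (n := 2) (by norm_num) (x := 1 + a₂ * b₂ + b₂ ^ 2 * p₁ +
      a₀ * a₂ * b₂ ^ 2) (y := 3 - d₃ - 2 * d₂ * d₃ - a₀ * b₂ * d₃ - a₂ * b₁ * d₃ - a₂ * b₂ * d₂
      - b₁ * b₂ * s₂ + b₂ ^ 2 * p₁) (by linear_combination h5 - (2 * b₁ * b₂) * hs₂)
  have e6 := toZMod_eq_zero_of_mul_eq (n := 2) (by norm_num) (x := b₂ ^ 2 * s₂) (y := -d₃ ^ 2 -
      a₂ * b₂ * d₃) (by linear_combination h6 - (b₂ ^ 2) * hs₂)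
  simp only [map_mul, map_add, map_one, map_pow, sq] at e0 e1 e2 e3 e4 e5 e6
  obtain ⟨z₀, -, -, z₃⟩ := unit_relation_mod_two _ _ _ _ _ _ _ _ e0 e1 e2 e3 e4 e5 e6
  obtain ⟨q, rfl⟩ := exists_eq_two_mul z₀
  obtain ⟨k, rfl⟩ := exists_eq_add_two_mul z₃
  refine sq_add_sq_ne (x := a₀ * q + d₀) (y := a₀ * q) (w := -7 + (a₀ + k) * q ^ 2)
    (mul_left_cancel₀ (show (4 : ℤ_[2]) ≠ 0 by norm_num) ?_)
  linear_combination h0 + 4 * q ^ 2 * hs₀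

end UnitRelation

section Coefficients

variable {R : Type*} [CommRing R]

theorem eq_of_natDegree_le_one' {p : R[X]} (h : p.natDegree ≤ 1) :
    p = C (p.coeff 0) + C (p.coeff 1) * X := by
  conv_lhs => rw [p.as_sum_range_C_mul_X_pow' (n := 2) (by omega)]
  simp [Finset.sum_range_succ]

theorem coeffs_eq_zero_of_le_four {e₀ e₁ e₂ e₃ e₄ : R}
    (h : C e₀ + C e₁ * X + C e₂ * X ^ 2 + C e₃ * X ^ 3 + C e₄ * X ^ 4 = 0) :
    e₀ = 0 ∧ e₁ = 0 ∧ e₂ = 0 ∧ e₃ = 0 ∧ e₄ = 0 := by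
  obtain ⟨h0, h1, h2, h3, h4, -⟩ := coeffs_eq_zero (e₀ := e₀) (e₁ := e₁) (e₂ := e₂) (e₃ := e₃) (e₄ := e₄)
    (e₅ := (0 : R)) (e₆ := (0 : R)) (by
    rw [map_zero]; linear_combination h)
  exact ⟨h0, h1, h2, h3, h4⟩

theorem coeffs_of_mumford {b a m : R[X]} (hb : b.natDegree ≤ 3) (ha : a.natDegree ≤ 2)
    (hm : m.natDegree ≤ 4) (h : b ^ 2 + a * m = evenSextic R) :
    b.coeff 0 ^ 2 + a.coeff 0 * m.coeff 0 = -100 ∧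
    2 * b.coeff 0 * b.coeff 1 + a.coeff 0 * m.coeff 1 + a.coeff 1 * m.coeff 0 = 200 ∧
    2 * b.coeff 0 * b.coeff 2 + b.coeff 1 ^ 2 + a.coeff 0 * m.coeff 2 + a.coeff 1 * m.coeff 1 +
      a.coeff 2 * m.coeff 0 = -100 ∧
    2 * b.coeff 0 * b.coeff 3 + 2 * b.coeff 1 * b.coeff 2 + a.coeff 0 * m.coeff 3 +
      a.coeff 1 * m.coeff 2 + a.coeff 2 * m.coeff 1 = 100 ∧
    2 * b.coeff 1 * b.coeff 3 + b.coeff 2 ^ 2 + a.coeff 0 * m.coeff 4 + a.coeff 1 * m.coeff 3 +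
      a.coeff 2 * m.coeff 2 = 25 ∧
    2 * b.coeff 2 * b.coeff 3 + a.coeff 1 * m.coeff 4 + a.coeff 2 * m.coeff 3 = 10 ∧
    b.coeff 3 ^ 2 + a.coeff 2 * m.coeff 4 = 0 := by
  rw [eq_of_natDegree_le_three hb, eq_of_natDegree_le_two ha, eq_of_natDegree_le_four hm,
    evenSextic] at h
  simp only [← sub_eq_zero (b := (-100 : R)), ← sub_eq_zero (b := (200 : R)),
    ← sub_eq_zero (b := (100 : R)), ← sub_eq_zero (b := (25 : R)), ← sub_eq_zero (b := (10 : R))]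
  apply coeffs_eq_zero
  simp only [map_add, map_sub, map_mul, map_pow, map_ofNat, map_neg]
  linear_combination h

theorem coeffs_of_halving {μ ν : R} {a' a l b m : R[X]} (ha' : a'.natDegree ≤ 2)
    (ha : a.natDegree ≤ 2) (hl : l.natDegree ≤ 1) (hb : b.natDegree ≤ 3) (hm : m.natDegree ≤ 4)
    (h : a' ^ 2 = a * l ^ 2 + C μ * (b * l) - C ν * m) :
    a'.coeff 0 ^ 2 = a.coeff 0 * l.coeff 0 ^ 2 + μ * (b.coeff 0 * l.coeff 0) - ν * m.coeff 0 ∧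
    2 * a'.coeff 0 * a'.coeff 1 = a.coeff 1 * l.coeff 0 ^ 2 +
      2 * a.coeff 0 * l.coeff 0 * l.coeff 1 +
      μ * (b.coeff 0 * l.coeff 1 + b.coeff 1 * l.coeff 0) - ν * m.coeff 1 ∧
    2 * a'.coeff 0 * a'.coeff 2 + a'.coeff 1 ^ 2 = a.coeff 2 * l.coeff 0 ^ 2 +
      2 * a.coeff 1 * l.coeff 0 * l.coeff 1 + a.coeff 0 * l.coeff 1 ^ 2 +
      μ * (b.coeff 1 * l.coeff 1 + b.coeff 2 * l.coeff 0) - ν * m.coeff 2 ∧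
    2 * a'.coeff 1 * a'.coeff 2 = 2 * a.coeff 2 * l.coeff 0 * l.coeff 1 +
      a.coeff 1 * l.coeff 1 ^ 2 +
      μ * (b.coeff 2 * l.coeff 1 + b.coeff 3 * l.coeff 0) - ν * m.coeff 3 ∧
    a'.coeff 2 ^ 2 = a.coeff 2 * l.coeff 1 ^ 2 + μ * (b.coeff 3 * l.coeff 1) - ν * m.coeff 4 := by
  rw [eq_of_natDegree_le_three hb, eq_of_natDegree_le_two ha, eq_of_natDegree_le_two ha',
    eq_of_natDegree_le_four hm, eq_of_natDegree_le_one' hl] at h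
  rw [← sub_eq_zero, ← sub_eq_zero (a := 2 * a'.coeff 0 * a'.coeff 1),
    ← sub_eq_zero (a := _ + a'.coeff 1 ^ 2),
    ← sub_eq_zero (a := 2 * a'.coeff 1 * a'.coeff 2), ← sub_eq_zero (a := a'.coeff 2 ^ 2)]
  apply coeffs_eq_zero_of_le_four
  simp only [map_add, map_sub, map_mul, map_pow, map_ofNat]
  linear_combination h

end Coefficients

section LevelZero

set_option maxRecDepth 4000 in
set_option synthInstance.maxSize 2000 in
set_option synthInstance.maxHeartbeats 200000 in
theorem level_zero_halving_mod_two : ∀ l₀ l₁ a₀ a₂ p₁ s₀ s₂ : ZMod 2, ¬ (l₀ = 0 ∧ l₁ = 0) →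
    l₀ * s₀ = 0 → l₀ * p₁ + a₀ * a₂ * l₀ = 0 → l₀ * s₂ + l₁ * s₀ = 0 →
    l₁ * p₁ + a₀ * a₂ * l₁ = 0 → l₁ * s₂ = 0 → s₀ = 0 ∧ s₂ = 0 ∧ p₁ = a₀ * a₂ := by
  decide

set_option maxRecDepth 10000 in
set_option synthInstance.maxSize 5000 in
set_option synthInstance.maxHeartbeats 400000 in
theorem level_zero_mod_two : ∀ a₀ a₂ m₀ m₂ m₄ n₁ n₃ : ZMod 2,
    1 + a₂ * m₄ + a₂ * n₃ + a₂ * m₂ * m₄ = 0 → a₀ * n₁ + a₀ * m₀ * m₂ = 0 →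
    a₀ * m₂ + a₀ * n₃ + a₂ * m₀ + a₂ * n₁ + a₀ * m₂ * m₄ + a₂ * m₀ * m₂ = 0 →
    ∀ t₀ t₂ t₄ : ZMod 2, a₀ * m₀ + a₀ * t₀ = 0 →
    a₀ * m₀ + a₀ * m₂ + a₀ * t₂ + a₂ * m₀ + a₂ * t₀ + a₀ * m₀ * m₄ = 0 →
    a₀ * t₄ + a₂ * t₂ + a₂ * m₀ * m₄ = 0 → a₂ * m₄ + a₂ * t₄ = 0 →
    a₀ = 0 ∧ a₂ = 1 ∧ t₀ = m₀ := by
  decide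

variable {a a' b l m : ℤ_[2][X]} {κ : ℤ_[2]}

theorem level_zero_halving (ha' : a'.natDegree ≤ 2)
    (ha : a.natDegree ≤ 2) (hl : l.natDegree ≤ 1) (hb : b.natDegree ≤ 3) (hm : m.natDegree ≤ 4)
    (h : a' ^ 2 = a * l ^ 2 + C (4 * κ) * (b * l) - C (4 * κ ^ 2) * m)
    (hp : a'.map PadicInt.toZMod ≠ 0) :
    (∃ s₀, a.coeff 0 ^ 2 = a.coeff 0 + 4 * s₀) ∧ (∃ s₂, a.coeff 2 ^ 2 = a.coeff 2 + 4 * s₂) ∧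
    ∃ p, a.coeff 1 = 2 * (a.coeff 0 * a.coeff 2 + 2 * p) := by
  obtain ⟨g0, g1, g2, g3, g4⟩ := coeffs_of_halving ha' ha hl hb hm h
  replace hp : ¬ (PadicInt.toZMod (a'.coeff 0) = 0 ∧ PadicInt.toZMod (a'.coeff 1) = 0 ∧
      PadicInt.toZMod (a'.coeff 2) = 0) := by
    rintro ⟨h0, h1, h2⟩
    apply hp
    rw [eq_of_natDegree_le_two ha']
    simp [h0, h1, h2]
  generalize a.coeff 0 = a₀, a.coeff 1 = a₁, a.coeff 2 = a₂, a'.coeff 0 = r₀, a'.coeff 1 = r₁,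
    a'.coeff 2 = r₂, b.coeff 0 = b₀, b.coeff 1 = b₁, b.coeff 2 = b₂, b.coeff 3 = b₃,
    m.coeff 0 = m₀, m.coeff 1 = m₁, m.coeff 2 = m₂, m.coeff 3 = m₃, m.coeff 4 = m₄,
    l.coeff 0 = l₀, l.coeff 1 = l₁ at *
  have sq (x : ZMod 2) : x ^ 2 = x := by revert x; decide
  have sqz (x : ℤ_[2]) : ∃ e, x ^ 2 = x + 2 * e :=
    exists_eq_add_two_mul (by rw [map_pow, sq])
  have z2 : (2 : ZMod 2) = 0 := rfl
  have z4 : (4 : ZMod 2) = 0 := rfl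
  have k0 := congrArg PadicInt.toZMod g0
  have k1 := congrArg PadicInt.toZMod g1
  have k2 := congrArg PadicInt.toZMod g2
  have k3 := congrArg PadicInt.toZMod g3
  have k4 := congrArg PadicInt.toZMod g4
  simp only [map_mul, map_add, map_sub, map_pow, map_ofNat, sq, z2, z4, zero_mul, zero_add,
    add_zero, sub_zero] at k0 k1 k2 k3 k4
  obtain ⟨d₀, rfl⟩ := exists_eq_add_two_mul (x := r₀) (y := a₀ * l₀) (by rw [k0, map_mul])
  obtain ⟨d₁, rfl⟩ := exists_eq_add_two_mul (x := r₁) (y := a₂ * l₀ + a₀ * l₁) (by simp [k2])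
  obtain ⟨d₂, rfl⟩ := exists_eq_add_two_mul (x := r₂) (y := a₂ * l₁) (by rw [k4, map_mul])
  simp only [map_mul, map_add, map_ofNat, z2, zero_mul, add_zero] at hp
  have hl' : ¬ (PadicInt.toZMod l₀ = 0 ∧ PadicInt.toZMod l₁ = 0) := by
    rintro ⟨h0, h1⟩
    simp [h0, h1] at hp
  obtain ⟨p₁, rfl⟩ := exists_eq_two_mul (x := a₁) (by
    by_contra h'
    exact hl' ⟨(mul_eq_zero.1 k1.symm).resolve_left h', (mul_eq_zero.1 k3.symm).resolve_left h'⟩)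
  obtain ⟨s₀, hs₀⟩ := sqz a₀
  obtain ⟨s₂, hs₂⟩ := sqz a₂
  have e0 := toZMod_eq_zero_of_mul_eq (n := 2) (by norm_num) (x := l₀ ^ 2 * s₀) (y := -d₀ ^ 2 -
      a₀ * d₀ * l₀ + b₀ * l₀ * κ - m₀ * κ ^ 2) (by linear_combination g0 - (l₀ ^ 2) * hs₀)
  have e1 := toZMod_eq_zero_of_mul_eq (n := 2) (by norm_num) (x := l₀ ^ 2 * p₁ + a₀ * a₂ * l₀ ^
      2) (y := -2 * d₀ * d₁ - a₀ * d₀ * l₁ - a₀ * d₁ * l₀ - a₂ * d₀ * l₀ + b₀ * l₁ * κ + b₁ *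
      l₀ * κ - l₀ * l₁ * s₀ + l₀ ^ 2 * p₁ - m₁ * κ ^ 2) (by linear_combination g1 - (2 * l₀ *
      l₁) * hs₀)
  have e2 := toZMod_eq_zero_of_mul_eq (n := 2) (by norm_num) (x := l₀ ^ 2 * s₂ + l₁ ^ 2 * s₀)
      (y := -2 * d₀ * d₂ - d₁ ^ 2 - a₀ * d₁ * l₁ - a₀ * d₂ * l₀ - a₂ * d₀ * l₁ - a₂ * d₁ * l₀ +
      b₁ * l₁ * κ + b₂ * l₀ * κ + l₀ * l₁ * p₁ - m₂ * κ ^ 2 - a₀ * a₂ * l₀ * l₁) (by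
      linear_combination g2 - (l₁ ^ 2) * hs₀ - (l₀ ^ 2) * hs₂)
  have e3 := toZMod_eq_zero_of_mul_eq (n := 2) (by norm_num) (x := l₁ ^ 2 * p₁ + a₀ * a₂ * l₁ ^
      2) (y := -2 * d₁ * d₂ - a₀ * d₂ * l₁ - a₂ * d₁ * l₁ - a₂ * d₂ * l₀ + b₂ * l₁ * κ + b₃ *
      l₀ * κ - l₀ * l₁ * s₂ + l₁ ^ 2 * p₁ - m₃ * κ ^ 2) (by linear_combination g3 - (2 * l₀ *
      l₁) * hs₂)
  have e4 := toZMod_eq_zero_of_mul_eq (n := 2) (by norm_num) (x := l₁ ^ 2 * s₂) (y := -d₂ ^ 2 -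
      a₂ * d₂ * l₁ + b₃ * l₁ * κ - m₄ * κ ^ 2) (by linear_combination g4 - (l₁ ^ 2) * hs₂)
  simp only [map_mul, map_add, map_pow, sq] at e0 e1 e2 e3 e4
  obtain ⟨v₀, v₂, v₁⟩ := level_zero_halving_mod_two _ _ _ _ _ _ _ hl' e0 e1 e2 e3 e4
  obtain ⟨s₀, rfl⟩ := exists_eq_two_mul v₀
  obtain ⟨s₂, rfl⟩ := exists_eq_two_mul v₂
  obtain ⟨p, rfl⟩ := exists_eq_add_two_mul (x := p₁) (y := a₀ * a₂) (by rw [v₁, map_mul])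
  exact ⟨⟨s₀, by rw [hs₀]; ring⟩, ⟨s₂, by rw [hs₂]; ring⟩, p, rfl⟩

theorem level_zero (ha' : a'.natDegree ≤ 2)
    (ha : a.natDegree ≤ 2) (hl : l.natDegree ≤ 1) (hb : b.natDegree ≤ 3) (hm : m.natDegree ≤ 4)
    (h : a' ^ 2 = a * l ^ 2 + C (4 * κ) * (b * l) - C (4 * κ ^ 2) * m)
    (hp : a'.map PadicInt.toZMod ≠ 0) (hmum : b ^ 2 + a * m = evenSextic ℤ_[2]) :
    (∃ x, a.coeff 0 = 4 * x) ∧ (∃ x, a.coeff 1 = 4 * x) ∧ (∃ x, a.coeff 2 = 1 + 4 * x) ∧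
    PadicInt.toZMod (m.coeff 0) = 1 := by
  obtain ⟨⟨s₀, hs₀⟩, ⟨s₂, hs₂⟩, p₂, hp₂⟩ := level_zero_halving ha' ha hl hb hm h hp
  have ha0 : a.map PadicInt.toZMod ≠ 0 := by
    intro h0
    have z4 : (4 : (ZMod 2)[X]) = 0 :=
      (map_ofNat C 4).symm.trans (by rw [show (4 : ZMod 2) = 0 from rfl, map_zero])
    have := congrArg (Polynomial.map PadicInt.toZMod) h
    simp only [Polynomial.map_pow, Polynomial.map_sub, Polynomial.map_add, Polynomial.map_mul, h0,
      map_C, map_mul, map_ofNat, Polynomial.map_ofNat, z4, zero_mul, add_zero, sub_zero] at this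
    exact hp (pow_eq_zero_iff two_ne_zero |>.1 this)
  replace ha0 : ¬ (PadicInt.toZMod (a.coeff 0) = 0 ∧ PadicInt.toZMod (a.coeff 2) = 0) := by
    rintro ⟨h0, h2⟩
    apply ha0
    rw [eq_of_natDegree_le_two ha]
    simp [h0, h2, hp₂, map_ofNat]
    exact Or.inl ((map_ofNat C 2).symm.trans (by
      rw [show (2 : ZMod 2) = 0 from rfl, map_zero]))
  clear h hp
  obtain ⟨h0, h1, h2, h3, h4, h5, h6⟩ := coeffs_of_mumford hb ha hm hmum
  clear hmum
  generalize a.coeff 0 = a₀, a.coeff 1 = a₁, a.coeff 2 = a₂, b.coeff 0 = b₀, b.coeff 1 = b₁,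
    b.coeff 2 = b₂, b.coeff 3 = b₃, m.coeff 0 = m₀, m.coeff 1 = m₁, m.coeff 2 = m₂,
    m.coeff 3 = m₃, m.coeff 4 = m₄ at *
  subst hp₂
  have sq (x : ZMod 2) : x ^ 2 = x := by revert x; decide
  have sqz (x : ℤ_[2]) : ∃ e, x ^ 2 = x + 2 * e :=
    exists_eq_add_two_mul (by rw [map_pow, sq])
  have z2 : (2 : ZMod 2) = 0 := rfl
  have z100 : (100 : ZMod 2) = 0 := rfl
  have z200 : (200 : ZMod 2) = 0 := rfl
  have z25 : (25 : ZMod 2) = 1 := rfl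
  have z10 : (10 : ZMod 2) = 0 := rfl
  have eq_add (x y z : ZMod 2) (h : x + y = z) : x = z + y := by revert x y z; decide
  have k0 := congrArg PadicInt.toZMod h0
  have k1 := congrArg PadicInt.toZMod h1
  have k2 := congrArg PadicInt.toZMod h2
  have k3 := congrArg PadicInt.toZMod h3
  have k4 := congrArg PadicInt.toZMod h4
  have k5 := congrArg PadicInt.toZMod h5
  have k6 := congrArg PadicInt.toZMod h6
  simp only [map_mul, map_add, map_neg, map_pow, map_ofNat, sq, z2, z100, z200, z25, z10, zero_mul,
    zero_add, add_zero, neg_zero, map_zero] at k0 k1 k2 k3 k4 k5 k6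
  obtain ⟨j₁, j₃⟩ : PadicInt.toZMod m₁ = 0 ∧ PadicInt.toZMod m₃ = 0 := by
    revert ha0 k1 k3 k5
    generalize PadicInt.toZMod m₁ = x, PadicInt.toZMod m₃ = y, PadicInt.toZMod a₀ = z,
      PadicInt.toZMod a₂ = w
    revert x y z w
    decide
  obtain ⟨n₁, rfl⟩ := exists_eq_two_mul j₁
  obtain ⟨n₃, rfl⟩ := exists_eq_two_mul j₃
  obtain ⟨f₀, rfl⟩ := exists_eq_add_two_mul (x := b₀) (y := a₀ * m₀) (by
    rw [eq_add _ _ _ k0, map_mul, zero_add])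
  obtain ⟨f₁, rfl⟩ := exists_eq_add_two_mul (x := b₁) (y := a₀ * m₂ + a₂ * m₀) (by
    rw [add_assoc] at k2
    rw [eq_add _ _ _ k2, map_add, map_mul, map_mul, zero_add])
  obtain ⟨f₂, rfl⟩ := exists_eq_add_two_mul (x := b₂) (y := 1 + a₀ * m₄ + a₂ * m₂) (by
    rw [add_assoc] at k4
    rw [eq_add _ _ _ k4, map_add, map_add, map_mul, map_mul, map_one, add_assoc])
  obtain ⟨f₃, rfl⟩ := exists_eq_add_two_mul (x := b₃) (y := a₂ * m₄) (by
    rw [eq_add _ _ _ k6, map_mul, zero_add])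
  obtain ⟨t₀, ht₀⟩ := sqz m₀
  obtain ⟨t₂, ht₂⟩ := sqz m₂
  obtain ⟨t₄, ht₄⟩ := sqz m₄
  have e0 := toZMod_eq_zero_of_mul_eq (n := 2) (by norm_num) (x := a₀ * m₀ + a₀ * t₀) (y := -25
      - f₀ ^ 2 - m₀ * s₀ - 2 * s₀ * t₀ - a₀ * f₀ * m₀) (by linear_combination h0 - (m₀ ^ 2) *
      hs₀ - (a₀ + 4 * s₀) * ht₀)
  have e1 := toZMod_eq_zero_of_mul_eq (n := 2) (by norm_num) (x := a₀ * n₁ + a₀ * m₀ * m₂) (y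
      := 50 - 2 * f₀ * f₁ - m₀ * p₂ - a₀ * a₂ * m₀ - a₀ * a₂ * t₀ - a₀ * f₀ * m₂ - a₀ * f₁ * m₀
      - a₂ * f₀ * m₀ - 2 * m₀ * m₂ * s₀) (by linear_combination h1 - (2 * m₀ * m₂) * hs₀ - (2 *
      a₀ * a₂) * ht₀)
  have e2 := toZMod_eq_zero_of_mul_eq (n := 2) (by norm_num) (x := a₀ * m₀ + a₀ * m₂ + a₀ * t₂
      + a₂ * m₀ + a₂ * t₀ + a₀ * m₀ * m₄) (y := -25 - f₀ - 2 * f₀ * f₂ - f₁ ^ 2 - m₀ * s₂ - m₂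
      * s₀ - 2 * n₁ * p₂ - 2 * s₀ * t₂ - 2 * s₂ * t₀ - a₀ * a₂ * n₁ - a₀ * f₀ * m₄ - a₀ * f₁ *
      m₂ - a₀ * f₂ * m₀ - a₂ * f₀ * m₂ - a₂ * f₁ * m₀ - 2 * m₀ * m₄ * s₀ - a₀ * a₂ * m₀ * m₂)
      (by linear_combination h2 - (m₂ + 2 * t₂ + 2 * m₀ * m₄) * hs₀ - (m₀ ^ 2) * hs₂ - (a₂ + 4
      * s₂) * ht₀ - (a₀ ^ 2) * ht₂)
  have e3 := toZMod_eq_zero_of_mul_eq (n := 2) (by norm_num) (x := a₀ * m₂ + a₀ * n₃ + a₂ * m₀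
      + a₂ * n₁ + a₀ * m₂ * m₄ + a₂ * m₀ * m₂) (y := 25 - f₁ - 2 * f₀ * f₃ - 2 * f₁ * f₂ - m₂ *
      p₂ - a₀ * a₂ * m₂ - a₀ * a₂ * t₂ - a₀ * f₁ * m₄ - a₀ * f₂ * m₂ - a₀ * f₃ * m₀ - a₂ * f₀ *
      m₄ - a₂ * f₁ * m₂ - a₂ * f₂ * m₀ - 2 * m₀ * m₂ * s₂ - 2 * m₂ * m₄ * s₀ - a₀ * a₂ * m₀ *
      m₄) (by linear_combination h3 - (2 * m₂ * m₄) * hs₀ - (2 * m₀ * m₂) * hs₂ - (2 * a₀ * a₂)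
      * ht₂)
  have e4 := toZMod_eq_zero_of_mul_eq (n := 2) (by norm_num) (x := a₀ * t₄ + a₂ * t₂ + a₂ * m₀
      * m₄) (y := 6 - f₂ - a₀ * m₄ - a₂ * m₂ - 2 * f₁ * f₃ - f₂ ^ 2 - m₂ * s₂ - m₄ * s₀ - 2 *
      n₃ * p₂ - 2 * s₀ * t₄ - 2 * s₂ * t₂ - a₀ * a₂ * n₃ - a₀ * f₂ * m₄ - a₀ * f₃ * m₂ - a₂ *
      f₁ * m₄ - a₂ * f₂ * m₂ - a₂ * f₃ * m₀ - 2 * m₀ * m₄ * s₂ - a₀ * a₂ * m₂ * m₄) (by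
      linear_combination h4 - (m₄ ^ 2) * hs₀ - (m₂ + 2 * t₂ + 2 * m₀ * m₄) * hs₂ - (a₂ ^ 2) *
      ht₂ - (a₀ + 4 * s₀) * ht₄)
  have e5 := toZMod_eq_zero_of_mul_eq (n := 2) (by norm_num) (x := 1 + a₂ * m₄ + a₂ * n₃ + a₂ *
      m₂ * m₄) (y := 3 - f₃ - 2 * f₂ * f₃ - m₄ * p₂ - a₀ * a₂ * m₄ - a₀ * a₂ * t₄ - a₀ * f₃ *
      m₄ - a₂ * f₂ * m₄ - a₂ * f₃ * m₂ - 2 * m₂ * m₄ * s₂) (by linear_combination h5 - (2 * m₂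
      * m₄) * hs₂ - (2 * a₀ * a₂) * ht₄)
  have e6 := toZMod_eq_zero_of_mul_eq (n := 2) (by norm_num) (x := a₂ * m₄ + a₂ * t₄) (y := -f₃
      ^ 2 - m₄ * s₂ - 2 * s₂ * t₄ - a₂ * f₃ * m₄) (by linear_combination h6 - (m₄ ^ 2) * hs₂ -
      (a₂ + 4 * s₂) * ht₄)
  simp only [map_mul, map_add, map_one] at e0 e1 e2 e3 e4 e5 e6
  obtain ⟨v₀, v₂, w₀⟩ := level_zero_mod_two _ _ _ _ _ _ _ e5 e1 e3 _ _ _ e0 e2 e4 e6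
  obtain ⟨x, rfl⟩ := exists_eq_two_mul v₀
  obtain ⟨y, rfl⟩ := exists_eq_one_add_two_mul v₂
  obtain ⟨u, rfl⟩ := exists_eq_add_two_mul w₀
  have hx : x = 2 * (x ^ 2 - s₀) := mul_left_cancel₀ (two_ne_zero' ℤ_[2]) (by
    linear_combination -hs₀)
  have hy : y = 2 * (s₂ - y ^ 2) := mul_left_cancel₀ (two_ne_zero' ℤ_[2]) (by
    linear_combination hs₂)
  refine ⟨⟨x ^ 2 - s₀, by linear_combination 2 * hx⟩, ⟨x * (1 + 2 * y) + p₂, by ring⟩,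
    ⟨s₂ - y ^ 2, by linear_combination 2 * hy⟩, ?_⟩
  by_contra hm0
  obtain ⟨v, rfl⟩ := exists_eq_two_mul (x := m₀) (by
    revert hm0
    generalize PadicInt.toZMod m₀ = z
    revert z
    decide)
  have hv : v = 2 * (v ^ 2 - u - v) := mul_left_cancel₀ (two_ne_zero' ℤ_[2]) (by
    linear_combination -ht₀)
  refine sq_add_sq_ne (x := x * (2 * v) + f₀) (y := 0)
    (w := -7 - (x ^ 2 - s₀) * (v ^ 2 - u - v))
    (mul_left_cancel₀ (show (4 : ℤ_[2]) ≠ 0 by norm_num) ?_)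
  linear_combination h0 - 4 * v * hx - 8 * (x ^ 2 - s₀) * hv

end LevelZero

section Final

theorem exists_eq_two_mul_of_sq {x w : ℤ_[2]} (h : x ^ 2 = 4 * w) : ∃ y, x = 2 * y ∧ y ^ 2 = w := by
  obtain ⟨y, rfl⟩ := exists_eq_two_mul (x := x) (by
    have := congrArg PadicInt.toZMod h
    rwa [map_pow, map_mul, map_ofNat, show (4 : ZMod 2) = 0 from rfl, zero_mul,
      pow_eq_zero_iff two_ne_zero] at this)
  exact ⟨y, rfl, mul_left_cancel₀ (show (4 : ℤ_[2]) ≠ 0 by norm_num) (by rw [← h]; ring)⟩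

theorem coeffs_of_integral_relation {R : Type*} [CommRing R] {μ : R} {c a a' : R[X]}
    (hc : c.natDegree ≤ 3) (ha : a.natDegree ≤ 2)
    (ha' : a'.natDegree ≤ 2) (h : c ^ 2 = C μ * evenSextic R + a * a' ^ 2) :
    c.coeff 0 ^ 2 = -100 * μ + a.coeff 0 * a'.coeff 0 ^ 2 ∧
    2 * c.coeff 1 * c.coeff 0 = 200 * μ + (a.coeff 1 * a'.coeff 0 ^ 2 +
      2 * a.coeff 0 * a'.coeff 1 * a'.coeff 0) ∧
    2 * c.coeff 2 * c.coeff 0 + c.coeff 1 ^ 2 = -100 * μ + (a.coeff 2 * a'.coeff 0 ^ 2 +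
      2 * a.coeff 1 * a'.coeff 1 * a'.coeff 0 +
      a.coeff 0 * (2 * a'.coeff 2 * a'.coeff 0 + a'.coeff 1 ^ 2)) ∧
    2 * c.coeff 3 * c.coeff 0 + 2 * c.coeff 2 * c.coeff 1 = 100 * μ +
      (2 * a.coeff 2 * a'.coeff 1 * a'.coeff 0 +
      a.coeff 1 * (2 * a'.coeff 2 * a'.coeff 0 + a'.coeff 1 ^ 2) +
      2 * a.coeff 0 * a'.coeff 2 * a'.coeff 1) ∧
    2 * c.coeff 3 * c.coeff 1 + c.coeff 2 ^ 2 = 25 * μ +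
      (a.coeff 2 * (2 * a'.coeff 2 * a'.coeff 0 + a'.coeff 1 ^ 2) +
      2 * a.coeff 1 * a'.coeff 2 * a'.coeff 1 + a.coeff 0 * a'.coeff 2 ^ 2) ∧
    2 * c.coeff 3 * c.coeff 2 = 10 * μ + (2 * a.coeff 2 * a'.coeff 2 * a'.coeff 1 +
      a.coeff 1 * a'.coeff 2 ^ 2) ∧
    c.coeff 3 ^ 2 = a.coeff 2 * a'.coeff 2 ^ 2 := by
  rw [eq_of_natDegree_le_three hc, eq_of_natDegree_le_two ha, eq_of_natDegree_le_two ha',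
    evenSextic] at h
  simp only [← sub_eq_zero (b := -100 * μ + _), ← sub_eq_zero (b := 200 * μ + _),
    ← sub_eq_zero (b := 100 * μ + _), ← sub_eq_zero (b := 25 * μ + _),
    ← sub_eq_zero (b := 10 * μ + _), ← sub_eq_zero (b := a.coeff 2 * a'.coeff 2 ^ 2)]
  apply coeffs_eq_zero
  simp only [map_add, map_sub, map_mul, map_pow, map_ofNat, map_neg]
  linear_combination h

variable {c a a' b l m : ℤ_[2][X]}

theorem final_one (hc : c.natDegree ≤ 3) (ha : a.natDegree ≤ 2)
    (ha' : a'.natDegree ≤ 2) (h : c ^ 2 = C 4 * evenSextic ℤ_[2] + a * a' ^ 2)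
    (h₀ : ∃ x, a.coeff 0 = 4 * x) (h₀' : ∃ x, a'.coeff 0 = 4 * x) : False := by
  obtain ⟨h0, -⟩ := coeffs_of_integral_relation hc ha ha' h
  obtain ⟨x, hx⟩ := h₀
  obtain ⟨y, hy⟩ := h₀'
  rw [hx, hy] at h0
  obtain ⟨u, -, hu⟩ := exists_eq_two_mul_of_sq (x := c.coeff 0) (w := 4 * (-25 + 4 * x * y ^ 2))
    (by rw [h0]; ring)
  obtain ⟨v, -, hv⟩ := exists_eq_two_mul_of_sq hu
  exact sq_add_sq_ne (x := v) (y := 0) (w := -7 + x * y ^ 2) (by rw [hv]; ring)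

set_option synthInstance.maxSize 2000 in
set_option synthInstance.maxHeartbeats 200000 in
theorem final_two (hc : c.natDegree ≤ 3) (ha : a.natDegree ≤ 2)
    (ha' : a'.natDegree ≤ 2) (h : c ^ 2 = C 16 * evenSextic ℤ_[2] + a * a' ^ 2)
    (h₀ : ∃ x, a.coeff 0 = 4 * x) (h₁ : ∃ x, a.coeff 1 = 4 * x) (h₂ : ∃ x, a.coeff 2 = 1 + 4 * x)
    (h₀' : ∃ x, a'.coeff 0 = 4 * x) (h₁' : ∃ x, a'.coeff 1 = 4 * x)
    (h₂' : ∃ x, a'.coeff 2 = 1 + 4 * x) : False := by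
  obtain ⟨h0, h1, h2, h3, h4, h5, h6⟩ := coeffs_of_integral_relation hc ha ha' h
  obtain ⟨u₀, hu₀⟩ := h₀
  obtain ⟨u₁, hu₁⟩ := h₁
  obtain ⟨y, hy⟩ := h₂
  obtain ⟨v₀, hv₀⟩ := h₀'
  obtain ⟨v₁, hv₁⟩ := h₁'
  obtain ⟨z, hz⟩ := h₂'
  simp only [hu₀, hu₁, hy, hv₀, hv₁, hz] at h0 h1 h2 h3 h4 h5 h6
  generalize c.coeff 0 = c₀, c.coeff 1 = c₁, c.coeff 2 = c₂, c.coeff 3 = c₃ at *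
  obtain ⟨x, hx, h0'⟩ := exists_eq_two_mul_of_sq (x := c₀) (w := 4 * (4 * (-25 + u₀ * v₀ ^ 2)))
    (by rw [h0]; ring)
  obtain ⟨x, rfl, hx'⟩ := exists_eq_two_mul_of_sq h0'
  obtain ⟨x, rfl, -⟩ := exists_eq_two_mul_of_sq hx'
  obtain rfl : c₀ = 8 * x := by rw [hx]; ring
  clear hx hx' h0'
  obtain ⟨t, ht, h2'⟩ := exists_eq_two_mul_of_sq (x := c₁)
    (w := 4 * (-100 - c₂ * x + (1 + 4 * y) * v₀ ^ 2
    + 8 * u₁ * v₁ * v₀ + 2 * u₀ * (1 + 4 * z) * v₀ + 4 * u₀ * v₁ ^ 2)) (by linear_combination h2)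
  obtain ⟨t, rfl, -⟩ := exists_eq_two_mul_of_sq h2'
  obtain rfl : c₁ = 4 * t := by rw [ht]; ring
  clear ht h2'
  obtain ⟨c₂, rfl, -⟩ := exists_eq_two_mul_of_sq (x := c₂) (w := 100 - 2 * c₃ * t +
    (1 + 4 * y) * (2 * (1 + 4 * z) * v₀ + 4 * v₁ ^ 2) + 8 * u₁ * (1 + 4 * z) * v₁ +
    u₀ * (1 + 4 * z) ^ 2) (by linear_combination h4)
  have e0 := toZMod_eq_zero_of_mul_eq (n := 64) (by norm_num) (x := 1 + x ^ 2 + u₀ * v₀ ^ 2)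
      (y := -12 + u₀ * v₀ ^ 2) (by linear_combination h0)
  have e2 := toZMod_eq_zero_of_mul_eq (n := 16) (by norm_num) (x := t ^ 2 + v₀ ^ 2) (y := -50
      - x * c₂ + u₀ * v₀ + v₀ ^ 2 + 4 * u₀ * v₀ * z + 2 * u₀ * v₁ ^ 2 + 4 * u₁ * v₀ * v₁ + 2 *
      v₀ ^ 2 * y) (by linear_combination h2)
  have e3 := toZMod_eq_zero_of_mul_eq (n := 16) (by norm_num) (x := x * c₃ + t * c₂) (y := 50
      + u₀ * v₁ + u₁ * v₀ + v₀ * v₁ + 4 * u₀ * v₁ * z + 4 * u₁ * v₀ * z + 2 * u₁ * v₁ ^ 2 + 4 *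
      v₀ * v₁ * y) (by linear_combination h3)
  have e4 := toZMod_eq_zero_of_mul_eq (n := 4) (by norm_num) (x := u₀ + c₂ ^ 2) (y := 50 + u₀ +
      v₀ - t * c₃ + 4 * u₀ * z + 4 * u₁ * v₁ + 4 * v₀ * y + 4 * v₀ * z + 2 * v₁ ^ 2 + 8 * u₀ *
      z ^ 2 + 16 * u₁ * v₁ * z + 16 * v₀ * y * z + 8 * v₁ ^ 2 * y) (by linear_combination h4)
  have e5 := toZMod_eq_zero_of_mul_eq (n := 4) (by norm_num) (x := u₁ + c₂ * c₃) (y := 20 + u₁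
      + v₁ + 4 * u₁ * z + 4 * v₁ * y + 4 * v₁ * z + 8 * u₁ * z ^ 2 + 16 * v₁ * y * z) (by
      linear_combination h5)
  have e6 := toZMod_eq_zero_of_mul_eq (n := 1) (by norm_num) (x := 1 + c₃ ^ 2) (y := 1 + 2 * y
      + 4 * z + 16 * y * z + 8 * z ^ 2 + 32 * y * z ^ 2) (by linear_combination h6)
  have sq (x : ZMod 2) : x ^ 2 = x := by revert x; decide
  simp only [map_mul, map_add, map_one, map_pow, sq] at e0 e2 e3 e4 e5 e6
  revert e0 e2 e3 e4 e5 e6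
  generalize PadicInt.toZMod x = c₀, PadicInt.toZMod t = c₁, PadicInt.toZMod c₂ = c₂,
    PadicInt.toZMod c₃ = c₃, PadicInt.toZMod u₀ = u₀, PadicInt.toZMod u₁ = u₁,
    PadicInt.toZMod v₀ = v₀
  clear * -
  revert c₃ c₂ c₁ c₀ u₀ u₁ v₀
  decide

set_option synthInstance.maxSize 2000 in
set_option synthInstance.maxHeartbeats 200000 in
theorem final_three {κ : ℤ_[2]} (ha' : a'.natDegree ≤ 2)
    (ha : a.natDegree ≤ 2) (hl : l.natDegree ≤ 1) (hb : b.natDegree ≤ 3) (hm : m.natDegree ≤ 4)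
    (h : a' ^ 2 = a * l ^ 2 + C (4 * (4 * κ)) * (b * l) - C (4 * (4 * κ) ^ 2) * m)
    (hmum : b ^ 2 + a * m = evenSextic ℤ_[2]) (hm0 : PadicInt.toZMod (m.coeff 0) = 1)
    (h₀ : ∃ x, a.coeff 0 = 4 * x) (h₁ : ∃ x, a.coeff 1 = 4 * x) (h₂ : ∃ x, a.coeff 2 = 1 + 4 * x)
    (h₀' : ∃ x, a'.coeff 0 = 4 * x) (h₁' : ∃ x, a'.coeff 1 = 4 * x)
    (h₂' : ∃ x, a'.coeff 2 = 1 + 4 * x) : False := by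
  obtain ⟨-, -, g2, g3, g4⟩ := coeffs_of_halving ha' ha hl hb hm h
  obtain ⟨h0, h1, h2, h3, -⟩ := coeffs_of_mumford hb ha hm hmum
  obtain ⟨u₀, hu₀⟩ := h₀
  obtain ⟨u₁, hu₁⟩ := h₁
  obtain ⟨y, hy⟩ := h₂
  obtain ⟨v₀, hv₀⟩ := h₀'
  obtain ⟨v₁, hv₁⟩ := h₁'
  obtain ⟨z, hz⟩ := h₂'
  simp only [hu₀, hu₁, hy] at g2 g3 g4 h0 h1 h2 h3
  rw [hv₀, hv₁, hz] at g2
  rw [hv₁, hz] at g3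
  rw [hz] at g4
  generalize b.coeff 0 = b₀, b.coeff 1 = b₁, b.coeff 2 = b₂, b.coeff 3 = b₃, m.coeff 0 = m₀,
    m.coeff 1 = m₁, m.coeff 2 = m₂, m.coeff 3 = m₃, m.coeff 4 = m₄, l.coeff 0 = l₀,
    l.coeff 1 = l₁ at *
  have sq (x : ZMod 2) : x ^ 2 = x := by revert x; decide
  have hl₁ : PadicInt.toZMod (1 + l₁ ^ 2) = 0 := toZMod_eq_zero_of_mul_eq one_ne_zero
    (y := 2 * y * l₁ ^ 2 + 8 * κ * (b₃ * l₁) - 32 * κ ^ 2 * m₄ - 4 * z - 8 * z ^ 2 + l₁ ^ 2)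
    (by linear_combination g4)
  obtain ⟨l₀, rfl⟩ := exists_eq_two_mul (x := l₀) (by
    rw [← sq (PadicInt.toZMod l₀), ← map_pow]
    exact toZMod_eq_zero_of_mul_eq one_ne_zero
      (y := 4 * v₀ * (1 + 4 * z) + 8 * v₁ ^ 2 - 2 * y * l₀ ^ 2 - 4 * u₁ * l₀ * l₁ - 2 * u₀ * l₁ ^ 2
        - 8 * κ * (b₁ * l₁ + b₂ * l₀) + 32 * κ ^ 2 * m₂) (by linear_combination -g2))
  obtain ⟨β, rfl, -⟩ := exists_eq_two_mul_of_sq (x := b₀) (w := -25 - u₀ * m₀)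
    (by linear_combination h0)
  obtain ⟨w, rfl⟩ := exists_eq_two_mul (x := m₁) (
    toZMod_eq_zero_of_mul_eq one_ne_zero (y := 50 - 2 * β * b₃ - b₁ * b₂ - 2 * u₀ * m₃ -
      2 * u₁ * m₂ - 2 * y * m₁) (by linear_combination h3))
  have e2 := toZMod_eq_zero_of_mul_eq (n := 4) (by norm_num) (x := l₀ ^ 2 + l₁ ^ 2 * u₀) (y :=
      -v₀ + l₀ ^ 2 - 4 * v₀ * z - 2 * v₁ ^ 2 + 2 * b₁ * l₁ * κ + 4 * b₂ * l₀ * κ + 2 * l₀ * l₁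
      * u₁ + 2 * l₀ ^ 2 * y + l₁ ^ 2 * u₀ - 8 * m₂ * κ ^ 2) (by linear_combination g2)
  have e3 := toZMod_eq_zero_of_mul_eq (n := 4) (by norm_num) (x := l₀ * l₁ + l₁ ^ 2 * u₁) (y :=
      -v₁ + l₀ * l₁ - 4 * v₁ * z + 2 * b₂ * l₁ * κ + 4 * b₃ * l₀ * κ + 2 * l₀ * l₁ * y + l₁ ^ 2
      * u₁ - 8 * m₃ * κ ^ 2) (by linear_combination g3)
  have q0 := toZMod_eq_zero_of_mul_eq (n := 4) (by norm_num) (x := 1 + m₀ * u₀ + β ^ 2) (y :=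
      -12) (by linear_combination h0)
  have q2 := toZMod_eq_zero_of_mul_eq (n := 1) (by norm_num) (x := m₀ + b₁ ^ 2) (y := -50 - 2 *
      b₂ * β - 2 * m₀ * y - 2 * (2 * w) * u₁ - 2 * m₂ * u₀) (by linear_combination h2)
  have q1 := toZMod_eq_zero_of_mul_eq (n := 4) (by norm_num) (x := b₁ * β + m₀ * u₁) (y := 25 -
      u₀ * w) (by linear_combination h1)
  simp only [map_mul, map_add, map_one, map_pow, sq, hm0] at e2 e3 q0 q2 q1 hl₁
  revert e2 e3 q0 q2 q1 hl₁
  generalize PadicInt.toZMod l₀ = l₀, PadicInt.toZMod l₁ = l₁, PadicInt.toZMod u₀ = u₀,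
    PadicInt.toZMod u₁ = u₁, PadicInt.toZMod β = β, PadicInt.toZMod b₁ = b₁
  clear * -
  revert l₀ l₁ u₀ u₁ β b₁
  decide

end Final

section Reduction

theorem map_toZMod_eq_zero {p : ℤ_[2][X]} (h : p.map PadicInt.toZMod = 0) : ∃ q, p = 2 * q := by
  have : C 2 ∣ p := (C_dvd_iff_dvd_coeff _ _).2 fun i ↦ dvd_iff_toZMod_eq_zero.2 (by
    rw [← coeff_map, h, coeff_zero])
  rwa [map_ofNat] at this

theorem map_two_mul (p : ℤ_[2][X]) : (2 * p).map PadicInt.toZMod = 0 := by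
  have : (2 : (ZMod 2)[X]) = 0 := CharTwo.two_eq_zero
  rw [Polynomial.map_mul, Polynomial.map_ofNat, this, zero_mul]

theorem four_ne_zero_polynomial : (4 : ℤ_[2][X]) ≠ 0 := by
  rw [show (4 : ℤ_[2][X]) = 2 * 2 by norm_num]
  exact mul_ne_zero two_ne_zero two_ne_zero

theorem map_two_pow_succ_mul (k : ℕ) (p : ℤ_[2][X]) :
    (2 ^ (k + 1) * p).map PadicInt.toZMod = 0 := by
  rw [pow_succ', mul_assoc, map_two_mul]

theorem exists_eq_two_pow_mul {a w Z : ℤ_[2][X]} (ha : a.map PadicInt.toZMod ≠ 0) {j : ℕ}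
    (h : a * Z = 2 ^ j * w) : ∃ M, Z = 2 ^ j * M := by
  induction j generalizing Z with
  | zero => exact ⟨Z, by ring⟩
  | succ j ih =>
    have h₁ := congrArg (Polynomial.map PadicInt.toZMod) h
    rw [map_two_pow_succ_mul, Polynomial.map_mul, mul_eq_zero, or_iff_right ha] at h₁
    obtain ⟨Y, rfl⟩ := map_toZMod_eq_zero h₁
    obtain ⟨M, rfl⟩ := ih (Z := Y) (mul_left_cancel₀ two_ne_zero (by linear_combination h))
    exact ⟨M, by ring⟩

theorem exists_eq_two_pow_mul_of_quadratic {a b w Z : ℤ_[2][X]} (ha : a.map PadicInt.toZMod ≠ 0)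
    {j : ℕ} (h : a * Z ^ 2 = 2 ^ (j + 1) * (b * Z) + 4 ^ j * w) : ∃ Y, Z = 2 ^ j * Y := by
  induction j generalizing Z with
  | zero => exact ⟨Z, by ring⟩
  | succ j ih =>
    have h₁ : a * Z ^ 2 = 2 * (2 ^ (j + 1) * (b * Z) + 2 * 4 ^ j * w) := by
      linear_combination h
    replace h₁ := congrArg (Polynomial.map PadicInt.toZMod) h₁
    rw [map_two_mul, Polynomial.map_mul, mul_eq_zero, or_iff_right ha, Polynomial.map_pow,
      sq_eq_zero_iff] at h₁
    obtain ⟨Y, rfl⟩ := map_toZMod_eq_zero h₁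
    obtain ⟨M, rfl⟩ := ih (Z := Y) (mul_left_cancel₀ four_ne_zero_polynomial
      (by linear_combination h))
    exact ⟨M, by ring⟩

theorem eq_sq_of_not_dvd {a b m : (ZMod 2)[X]} (ha : a.natDegree = 2) (h : b ^ 2 = a * m)
    (hb : ¬ a ∣ b) : ∃ l q, Prime l ∧ a = l ^ 2 ∧ b = l * q ∧ m = q ^ 2 ∧ ¬ l ∣ q := by
  have ha₀ : a ≠ 0 := by rintro rfl; simp at ha
  have : ¬ Squarefree a := fun hs ↦ hb (hs.isRadical 2 b ⟨m, h⟩)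
  simp only [Squarefree, not_forall] at this
  obtain ⟨l, ⟨r, hr⟩, hl⟩ := this
  have hl₀ : l ≠ 0 := by rintro rfl; simp at hr; exact ha₀ hr
  have hr₀ : r ≠ 0 := by rintro rfl; simp at hr; exact ha₀ hr
  have hdeg := congrArg natDegree hr
  rw [natDegree_mul (mul_ne_zero hl₀ hl₀) hr₀, natDegree_mul hl₀ hl₀, ha] at hdeg
  have hl₁ : l.natDegree ≠ 0 := fun h0 ↦ hl (isUnit_iff_degree_eq_zero.2 (by
    rw [degree_eq_natDegree hl₀, h0]; rfl))
  have hr₁ : r = 1 := by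
    rw [eq_C_of_natDegree_eq_zero (p := r) (by omega)] at hr₀ ⊢
    generalize r.coeff 0 = c at *
    have : ∀ c : ZMod 2, c ≠ 0 → c = 1 := by decide
    rw [this c (by rintro rfl; simp at hr₀), map_one]
  subst hr₁
  have hp : Prime l := (irreducible_of_degree_eq_one (by
    rw [degree_eq_natDegree hl₀, show l.natDegree = 1 by omega]; rfl)).prime
  rw [mul_one, ← sq] at hr
  subst hr
  obtain ⟨q, rfl⟩ : l ∣ b := hp.dvd_of_dvd_pow ⟨l * m, by rw [h]; ring⟩
  refine ⟨l, q, hp, rfl, rfl, mul_left_cancel₀ (pow_ne_zero 2 hl₀) (by rw [← h]; ring), ?_⟩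
  rintro ⟨s, rfl⟩
  exact hb ⟨s, by ring⟩

theorem eq_of_sq_eq_sq {a b : (ZMod 2)[X]} (h : a ^ 2 = b ^ 2) : a = b :=
  CharTwo.sq_injective h

end Reduction

section Descent

local notation "φ" => Polynomial.map (PadicInt.toZMod (p := 2))

theorem exists_mumford_cofactor {k : ℕ} {C F a a' b x : ℤ_[2][X]} (ha : φ a ≠ 0)
    (hC : C ^ 2 = 4 ^ k * F + a * a' ^ 2) (hb : 2 ^ k * b = C + a * x) :
    ∃ M, b ^ 2 = F + a * M ∧ a' ^ 2 = 4 ^ k * M - 2 ^ (k + 1) * (b * x) + a * x ^ 2 := by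
  have h4 : (2 : ℤ_[2][X]) ^ (2 * k) = 4 ^ k := by rw [pow_mul]; norm_num
  have h4' : ((2 : ℤ_[2][X]) ^ k) ^ 2 = 4 ^ k := by rw [← h4]; ring
  have h0 : (4 : ℤ_[2][X]) ^ k ≠ 0 := pow_ne_zero _ four_ne_zero_polynomial
  obtain ⟨M, hM⟩ := exists_eq_two_pow_mul (Z := a' ^ 2 + 2 * C * x + a * x ^ 2)
    (w := b ^ 2 - F) (j := 2 * k) ha (by
      rw [h4]
      linear_combination -hC - (2 ^ k * b + C + a * x) * hb + b ^ 2 * h4')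
  rw [h4] at hM
  refine ⟨M, mul_left_cancel₀ h0 ?_, ?_⟩
  · linear_combination a * hM + hC + (2 ^ k * b + C + a * x) * hb - b ^ 2 * h4'
  · linear_combination hM + 2 * x * hb

theorem exists_mumford_cofactor_right {k : ℕ} {C F a a' b' x' : ℤ_[2][X]} (ha' : φ a' ≠ 0)
    (hC : C ^ 2 = 4 ^ k * F + a * a' ^ 2) (hb' : 2 ^ k * b' = C + a' * x') :
    ∃ M', b' ^ 2 = F + a' * M' ∧
      a * a' = 4 ^ k * M' - 2 ^ (k + 1) * (b' * x') + a' * x' ^ 2 := by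
  have h4 : (2 : ℤ_[2][X]) ^ (2 * k) = 4 ^ k := by rw [pow_mul]; norm_num
  have h4' : ((2 : ℤ_[2][X]) ^ k) ^ 2 = 4 ^ k := by rw [← h4]; ring
  obtain ⟨M', hM'⟩ := exists_eq_two_pow_mul (Z := a * a' + 2 * C * x' + a' * x' ^ 2)
    (w := b' ^ 2 - F) (j := 2 * k) ha' (by
      rw [h4]
      linear_combination -hC - (2 ^ k * b' + C + a' * x') * hb' + b' ^ 2 * h4')
  rw [h4] at hM'
  refine ⟨M', mul_left_cancel₀ (pow_ne_zero k four_ne_zero_polynomial) ?_, ?_⟩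
  · linear_combination a' * hM' + hC + (2 ^ k * b' + C + a' * x') * hb' - b' ^ 2 * h4'
  · linear_combination hM' + 2 * x' * hb'

theorem eq_of_mul_eq_sq {l x y : (ZMod 2)[X]} (hl : Prime l) (hl₁ : l.natDegree = 1)
    (hx : x.natDegree ≤ 1) (hy : y.natDegree ≤ 1) (h : x * y = l ^ 2) : x = l ∧ y = l := by
  have key : ∀ {x y : (ZMod 2)[X]}, x.natDegree ≤ 1 → x * y = l ^ 2 → l ∣ x → x = l ∧ y = l := by
    rintro x y hx h ⟨u, rfl⟩
    have hu : u * y = l := mul_left_cancel₀ hl.ne_zero (by linear_combination h)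
    have hu₀ : u ≠ 0 := by rintro rfl; exact hl.ne_zero (by rw [← hu, zero_mul])
    rw [natDegree_mul hl.ne_zero hu₀] at hx
    have hu₁ : u = 1 := by
      rw [eq_C_of_natDegree_eq_zero (p := u) (by omega)] at hu₀ ⊢
      generalize u.coeff 0 = c at *
      have : ∀ c : ZMod 2, c ≠ 0 → c = 1 := by decide
      rw [this c (by rintro rfl; simp at hu₀), map_one]
    subst hu₁
    exact ⟨mul_one l, by rw [← hu, one_mul]⟩
  rcases hl.dvd_or_dvd (h ▸ dvd_pow_self l two_ne_zero) with hd | hd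
  · exact key hx h hd
  · exact (key hy (by rw [mul_comm, h]) hd).symm

theorem descent_of_natDegree_two {k : ℕ} {C F a a' b b' x x' : ℤ_[2][X]} (hF : φ F = 0)
    (hC : C ^ 2 = 4 ^ k * F + a * a' ^ 2) (ha : φ a ≠ 0)
    (hb : 2 ^ k * b = C + a * x) (hb' : 2 ^ k * b' = C + a' * x')
    (hx : x.natDegree ≤ 1) (hx' : x'.natDegree ≤ 1)
    (h2 : (φ a').natDegree = 2) (hmin : ¬ φ a' ∣ φ b') : False := by
  have h4' : ((2 : ℤ_[2][X]) ^ k) ^ 2 = 4 ^ k := by rw [← pow_mul, mul_comm, pow_mul]; norm_num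
  have ha' : φ a' ≠ 0 := by intro h; rw [h] at h2; simp at h2
  obtain ⟨M, hM, hE⟩ := exists_mumford_cofactor ha hC hb
  obtain ⟨M', hM', hE'⟩ := exists_mumford_cofactor_right ha' hC hb'
  have hM'₂ := congrArg φ hM'
  have hM₂ := congrArg φ hM
  simp only [Polynomial.map_add, Polynomial.map_mul, Polynomial.map_pow, hF, zero_add] at hM'₂ hM₂
  obtain ⟨l, q, hl, hal, hbl, hml, hlq⟩ := eq_sq_of_not_dvd h2 hM'₂ hmin
  have hl₁ : l.natDegree = 1 := by
    rw [hal, natDegree_pow] at h2; omega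
  rcases k with _ | j
  · have h₁ := congrArg φ hC
    have h₂ := congrArg φ hb'
    simp only [Polynomial.map_add, Polynomial.map_mul, Polynomial.map_pow, hF, pow_zero, one_mul,
      zero_add] at h₁ h₂
    refine hmin (h₂ ▸ dvd_add ?_ (dvd_mul_right _ _))
    exact (IsIntegrallyClosed.pow_dvd_pow_iff two_ne_zero).1 (h₁ ▸ dvd_mul_left _ _)
  have hx'a : φ a = φ x' ^ 2 := by
    have h₁ := congrArg φ (show a * a' =
      2 * (2 * (4 ^ j * M') - 2 ^ (j + 1) * (b' * x')) + a' * x' ^ 2 by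
        linear_combination hE')
    rw [Polynomial.map_add, map_two_mul, zero_add, Polynomial.map_mul, Polynomial.map_mul,
      Polynomial.map_pow, mul_comm] at h₁
    exact mul_left_cancel₀ ha' h₁
  have hxx : φ x * φ x' = l ^ 2 := by
    have h₁ := congrArg φ (show a' ^ 2 =
      2 * (2 * (4 ^ j * M) - 2 ^ (j + 1) * (b * x)) + a * x ^ 2 by
        linear_combination hE)
    rw [Polynomial.map_add, map_two_mul, zero_add, Polynomial.map_mul, Polynomial.map_pow,
      Polynomial.map_pow, hx'a, hal, ← mul_pow] at h₁
    rw [eq_of_sq_eq_sq h₁, mul_comm]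
  obtain ⟨hxl, hx'l⟩ := eq_of_mul_eq_sq hl hl₁ (natDegree_map_le.trans hx)
    (natDegree_map_le.trans hx') hxx
  obtain ⟨N, hN⟩ := exists_eq_two_pow_mul (Z := a - x' ^ 2) (w := 2 ^ j * M' - b' * x')
    (j := j + 2) ha' (by
      linear_combination hE' + M' * (by rw [← h4']; ring : (4 : ℤ_[2][X]) ^ (j + 1) = 2 ^ (j + 2) * 2 ^ j))
  have hN' : a' * N = 2 ^ j * M' - b' * x' :=
    mul_left_cancel₀ (pow_ne_zero (j + 2) (two_ne_zero (α := ℤ_[2][X]))) (by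
      linear_combination -a' * hN + hE' + M' * (by rw [← h4']; ring : (4 : ℤ_[2][X]) ^ (j + 1) = 2 ^ (j + 2) * 2 ^ j))
  rcases j with _ | i
  · have h₁ := congrArg φ (show M' = a' * N + b' * x' by linear_combination -hN')
    rw [Polynomial.map_add, Polynomial.map_mul, Polynomial.map_mul, hml, hal, hbl, hx'l] at h₁
    exact hlq (hl.dvd_of_dvd_pow ⟨l * φ N + q * l, by rw [h₁]; ring⟩)
  have hNq : φ N = q := by
    have h₁ := congrArg φ (show a' * N + b' * x' = 2 * (2 ^ i * M') by linear_combination hN')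
    rw [map_two_mul, Polynomial.map_add, Polynomial.map_mul, Polynomial.map_mul, hal, hbl,
      hx'l] at h₁
    exact mul_left_cancel₀ (pow_ne_zero 2 hl.ne_zero) (by
      linear_combination h₁ - l ^ 2 * q * (CharTwo.two_eq_zero : (2 : (ZMod 2)[X]) = 0))
  have hx'₀ : φ x' ≠ 0 := hx'l ▸ hl.ne_zero
  have hx₀ : φ x ≠ 0 := hxl ▸ hl.ne_zero
  obtain ⟨E, hEx⟩ := exists_eq_two_pow_mul (Z := x' * x - a') (w := b - b' - 2 * N * x)
    (j := i + 2) hx'₀ (by linear_combination -x * hN - hb + hb')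
  have hE₁ : x' * E = b - b' - 2 * N * x :=
    mul_left_cancel₀ (pow_ne_zero (i + 2) (two_ne_zero (α := ℤ_[2][X]))) (by
      linear_combination -x' * hEx - x * hN - hb + hb')
  have hY₀ : x * (b' + N * x) = 2 ^ (i + 1) * (M - E ^ 2) :=
    mul_left_cancel₀ (pow_ne_zero (i + 3) (two_ne_zero (α := ℤ_[2][X]))) (by
      linear_combination hE + (a' + x' * x - 2 ^ (i + 2) * E) * hEx + x ^ 2 * hN +
        2 ^ (i + 3) * x * hE₁ - M * h4')
  obtain ⟨Y, hY⟩ := exists_eq_two_pow_mul hx₀ hY₀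
  have hY' : x * Y = M - E ^ 2 :=
    mul_left_cancel₀ (pow_ne_zero (i + 1) (two_ne_zero (α := ℤ_[2][X]))) (by
      linear_combination -x * hY + hY₀)
  have h₁ := congrArg φ (show M = x * Y + E ^ 2 by linear_combination -hY')
  have h₂ := congrArg φ (show b = x' * E + b' + 2 * (N * x) by linear_combination -hE₁)
  rw [Polynomial.map_add, Polynomial.map_mul, hxl, Polynomial.map_pow] at h₁
  rw [Polynomial.map_add, map_two_mul, Polynomial.map_add, Polynomial.map_mul, hx'l, hbl] at h₂
  rw [h₁, h₂, hx'a, hx'l] at hM₂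
  have h₃ : q ^ 2 = l * φ Y := mul_left_cancel₀ (pow_ne_zero 2 hl.ne_zero) (by
    linear_combination hM₂ - l ^ 2 * φ E * q * (CharTwo.two_eq_zero : (2 : (ZMod 2)[X]) = 0))
  exact hlq (hl.dvd_of_dvd_pow ⟨_, h₃⟩)

end Descent

section Descent

local notation "φ" => Polynomial.map (PadicInt.toZMod (p := 2))

theorem natDegree_two_pow_mul (k : ℕ) (p : ℤ_[2][X]) : (2 ^ k * p).natDegree = p.natDegree := by
  rw [show (2 : ℤ_[2][X]) ^ k = C (2 ^ k) by rw [map_pow, map_ofNat],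
    natDegree_C_mul (pow_ne_zero _ two_ne_zero)]

theorem natDegree_four_pow_mul (k : ℕ) (p : ℤ_[2][X]) : (4 ^ k * p).natDegree = p.natDegree := by
  rw [show (4 : ℤ_[2][X]) ^ k = 2 ^ (2 * k) by rw [pow_mul]; norm_num, natDegree_two_pow_mul]

theorem reflect_sq {R : Type*} [CommRing R] {n : ℕ} {p : R[X]} (h : p.natDegree ≤ n) :
    reflect (n + n) (p ^ 2) = reflect n p ^ 2 := by
  rw [sq, sq, reflect_mul _ _ h h]

theorem reflect_two_pow_mul (n k : ℕ) (p : ℤ_[2][X]) :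
    reflect n (2 ^ k * p) = 2 ^ k * reflect n p := by
  rw [show (2 : ℤ_[2][X]) ^ k = C (2 ^ k) by rw [map_pow, map_ofNat], reflect_C_mul]

theorem reflect_four_pow_mul (n k : ℕ) (p : ℤ_[2][X]) :
    reflect n (4 ^ k * p) = 4 ^ k * reflect n p := by
  rw [show (4 : ℤ_[2][X]) ^ k = 2 ^ (2 * k) by rw [pow_mul]; norm_num, reflect_two_pow_mul]

theorem natDegree_le_one_of_X_sq_dvd_reflect {p : (ZMod 2)[X]} (hp : p.natDegree ≤ 3)
    (h : X ^ 2 ∣ reflect 3 p) : p.natDegree ≤ 1 := by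
  have h₀ := X_pow_dvd_iff.1 h 0 (by norm_num)
  have h₁ := X_pow_dvd_iff.1 h 1 (by norm_num)
  rw [coeff_reflect, revAt_le (by norm_num)] at h₀ h₁
  refine natDegree_le_iff_coeff_eq_zero.2 fun N hN ↦ ?_
  rcases lt_or_ge 3 N with h3 | h3
  · exact coeff_eq_zero_of_natDegree_lt (hp.trans_lt h3)
  · interval_cases N
    · exact h₁
    · exact h₀

theorem descent {k : ℕ} {C F a a' b b' x x' : ℤ_[2][X]} (hF : φ F = 0)
    (hC : C ^ 2 = 4 ^ k * F + a * a' ^ 2) (ha : φ a ≠ 0) (ha' : φ a' ≠ 0)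
    (hb : 2 ^ k * b = C + a * x) (hb' : 2 ^ k * b' = C + a' * x')
    (hCd : C.natDegree ≤ 3) (had : a.natDegree ≤ 2) (ha'd : a'.natDegree ≤ 2)
    (hb'd : b'.natDegree ≤ 3) (hx : x.natDegree ≤ 1) (hx' : x'.natDegree ≤ 1)
    (hmin : ∀ h, h.natDegree ≤ 1 → φ b' ≠ φ a' * h) : False := by
  obtain ⟨M', hM', hE'⟩ := exists_mumford_cofactor_right ha' hC hb'
  have hb'd₂ : (φ b').natDegree ≤ 3 := natDegree_map_le.trans hb'd
  have : (φ a').natDegree ≤ 2 := natDegree_map_le.trans ha'd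
  obtain h0 | h1 | h2 : (φ a').natDegree = 0 ∨ (φ a').natDegree = 1 ∨ (φ a').natDegree = 2 := by
    omega
  · have h1 : φ a' = 1 := by
      rw [eq_C_of_natDegree_eq_zero h0] at ha' ⊢
      generalize (φ a').coeff 0 = c at *
      have : ∀ c : ZMod 2, c ≠ 0 → c = 1 := by decide
      rw [this c (by rintro rfl; simp at ha'), map_one]
    have hR : φ (reflect 2 a') = X ^ 2 := by rw [← reflect_map, h1, reflect_one]
    refine descent_of_natDegree_two (F := reflect 6 F) (C := reflect 3 C) (k := k)
      (a := reflect 2 a) (a' := reflect 2 a') (b := reflect 3 b) (b' := reflect 3 b')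
      (x := reflect 1 x) (x' := reflect 1 x') ?_ ?_ ?_ ?_ ?_
      (natDegree_reflect_le.trans (by omega)) (natDegree_reflect_le.trans (by omega)) ?_ ?_
    · rw [← reflect_map, hF, reflect_zero]
    · rw [← reflect_sq hCd, ← reflect_sq ha'd, hC, reflect_add, reflect_four_pow_mul,
        ← reflect_mul _ _ had (natDegree_pow_le_of_le 2 ha'd)]
    · rw [← reflect_map, Ne, reflect_eq_zero_iff]
      exact ha
    · rw [← reflect_two_pow_mul, hb, reflect_add, ← reflect_mul _ _ had hx]
    · rw [← reflect_two_pow_mul, hb', reflect_add, ← reflect_mul _ _ ha'd hx']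
    · rw [hR, natDegree_X_pow]
    · rw [hR, ← reflect_map]
      intro hd
      exact hmin _ (natDegree_le_one_of_X_sq_dvd_reflect hb'd₂ hd) (by rw [h1, one_mul])
  · have hp : Prime (φ a') := (irreducible_of_degree_eq_one (by
      rw [degree_eq_natDegree ha', h1]; rfl)).prime
    have hM₂ := congrArg φ hM'
    simp only [Polynomial.map_add, Polynomial.map_mul, Polynomial.map_pow, hF, zero_add] at hM₂
    obtain ⟨h, hh⟩ : φ a' ∣ φ b' := hp.dvd_of_dvd_pow ⟨_, hM₂⟩
    refine hmin h ?_ hh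
    have hM'd : M'.natDegree ≤ 4 := by
      rw [← natDegree_four_pow_mul k, show 4 ^ k * M' =
        a * a' + 2 ^ (k + 1) * (b' * x') - a' * x' ^ 2 by linear_combination -hE']
      refine natDegree_sub_le_of_le (natDegree_add_le_of_degree_le
        (natDegree_mul_le_of_le had ha'd) ?_)
        (natDegree_mul_le_of_le ha'd (natDegree_pow_le_of_le 2 hx'))
      rw [natDegree_two_pow_mul]
      exact natDegree_mul_le_of_le (m := 3) (n := 1) hb'd hx'
    by_cases hz : h = 0
    · rw [hz, natDegree_zero]; omega
    have : φ M' = φ a' * h ^ 2 := mul_left_cancel₀ ha' (by rw [← hM₂, hh]; ring)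
    have hd : (φ M').natDegree ≤ 4 := natDegree_map_le.trans hM'd
    rw [this, natDegree_mul ha' (pow_ne_zero 2 hz), natDegree_pow] at hd
    omega
  · refine descent_of_natDegree_two hF hC ha hb hb' hx hx' h2 ?_
    rintro ⟨h, hh⟩
    refine hmin h ?_ hh
    by_cases hz : h = 0
    · rw [hz, natDegree_zero]; omega
    rw [hh, natDegree_mul ha' hz] at hb'd₂
    omega

end Descent

section Halving

theorem natDegree_sextic : (sextic ℚ).natDegree = 5 := by
  rw [show sextic ℚ = C 5 * monicQuintic ℚ from rfl, natDegree_C_mul (by norm_num),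
    natDegree_monicQuintic]

theorem isCoprime_sextic {A : ℚ[X]} (hA : A ≠ 0) (h : A.natDegree < 5) :
    IsCoprime A (sextic ℚ) := by
  rw [show sextic ℚ = C 5 * monicQuintic ℚ from rfl]
  exact (isCoprime_mul_unit_left_right (isUnit_C.2 (by norm_num)) _ _).2
    (isCoprime_monicQuintic_iff.2 (aeval_θ_ne_zero hA h))

theorem exists_relation_aeval (A B : ℚ[X]) (s : K) (hs : s ≠ 0) :
    ∃ (l A' : ℚ[X]) (μ : ℚ), l.natDegree ≤ 1 ∧ A'.natDegree ≤ 2 ∧ ¬ (l = 0 ∧ μ = 0) ∧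
      aeval θ (A * l + C μ * B) = s * aeval θ A' := by
  let v : Fin 6 → K := ![aeval θ A, aeval θ A * θ, aeval θ B, -s, -s * θ, -s * θ ^ 2]
  have hv : ¬ LinearIndependent ℚ v := fun h ↦ by
    have := h.fintype_card_le_finrank
    rw [finrank_K, Fintype.card_fin] at this
    omega
  obtain ⟨g, hg, i, hi⟩ := Fintype.not_linearIndependent_iff.1 hv
  simp only [Fin.sum_univ_six, v, Matrix.cons_val] at hg
  refine ⟨C (g 0) + C (g 1) * X, C (g 3) + C (g 4) * X + C (g 5) * X ^ 2, g 2, by compute_degree,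
    by compute_degree, ?_, ?_⟩
  · rintro ⟨h₁, h₂⟩
    have h0 : g 0 = 0 := by simpa using congrArg (coeff · 0) h₁
    have h1 : g 1 = 0 := by simpa using congrArg (coeff · 1) h₁
    have h3 : C (g 3) + C (g 4) * X + C (g 5) * X ^ 2 = 0 := by
      by_contra hne
      refine mul_ne_zero hs (aeval_θ_ne_zero hne (lt_of_le_of_lt (b := 2) (by compute_degree) (by norm_num))) ?_
      simp only [map_add, map_mul, map_pow, aeval_X, aeval_C, ← Algebra.smul_def]
      simp only [h0, h1, h₂, zero_smul, zero_add] at hg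
      simp only [Algebra.smul_def] at hg ⊢
      linear_combination -hg
    have h3' : g 3 = 0 := by simpa [coeff_X] using congrArg (coeff · 0) h3
    have h4 : g 4 = 0 := by simpa [coeff_C] using congrArg (coeff · 1) h3
    have h5 : g 5 = 0 := by simpa [coeff_C, coeff_X] using congrArg (coeff · 2) h3
    fin_cases i <;> exact hi (by assumption)
  · simp only [map_add, map_mul, map_pow, aeval_X, aeval_C]
    simp only [Algebra.smul_def] at hg
    linear_combination hg

theorem exists_halving_relation {A B : ℚ[X]} (h : IsMumford A B)
    (hB : B.natDegree < A.natDegree) :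
    ∃ (l A' : ℚ[X]) (μ : ℚ), l.natDegree ≤ 1 ∧ A'.natDegree ≤ 2 ∧ ¬ (l = 0 ∧ μ = 0) ∧
      (A * l + C μ * B) ^ 2 = C (μ ^ 2) * sextic ℚ + C (twist A) * (A * A' ^ 2) := by
  obtain ⟨s, hs, hsq⟩ := exists_sq_eq_aeval h
  have hAd := h.natDegree_le
  have hApos := h.natDegree_pos
  obtain ⟨l, A', μ, hl, hA', hne, heq⟩ := exists_relation_aeval A B s hs
  refine ⟨l, A', μ, hl, hA', hne, ?_⟩
  have hdvd : monicQuintic ℚ ∣ (A * l + C μ * B) ^ 2 - C (twist A) * (A * A' ^ 2) := by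
    rw [← minpoly_θ]
    refine minpoly.dvd _ _ ?_
    rw [map_sub, map_pow, heq, map_mul, map_mul, map_pow, aeval_C, eq_ratCast]
    linear_combination -aeval θ A' ^ 2 * hsq
  obtain ⟨w, hw⟩ := hdvd
  have hcd : (A * l + C μ * B).natDegree ≤ A.natDegree + 1 := natDegree_add_le_of_degree_le
    (natDegree_mul_le_of_le le_rfl hl) ((natDegree_C_mul_le _ _).trans (by omega))
  have hHd : ((A * l + C μ * B) ^ 2 - C (twist A) * (A * A' ^ 2)).natDegree ≤ A.natDegree + 4 := by
    have h₁ := natDegree_pow_le_of_le 2 hcd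
    have h₂ := (natDegree_C_mul_le (twist A) _).trans
      (natDegree_mul_le_of_le (le_refl A.natDegree) (natDegree_pow_le_of_le 2 hA'))
    exact (natDegree_sub_le_of_le h₁ h₂).trans (by omega)
  have hwd : w = 0 ∨ w.natDegree < A.natDegree := by
    by_cases hw0 : w = 0
    · exact .inl hw0
    · rw [hw, natDegree_mul (monicQuintic_monic ℚ).ne_zero hw0, natDegree_monicQuintic] at hHd
      right; omega
  obtain ⟨m, hm⟩ := h.dvd
  have h5 : sextic ℚ = 5 * monicQuintic ℚ := rfl
  have hAw : A ∣ sextic ℚ * (C (μ ^ 2) - C (1 / 5) * w) := by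
    refine ⟨C μ ^ 2 * m - (A * l ^ 2 + 2 * C μ * B * l - C (twist A) * A' ^ 2), ?_⟩
    have h15 : (C (1 / 5 : ℚ)) * 5 = 1 := by
      rw [← map_ofNat C 5, ← C_mul]; norm_num
    rw [map_pow]
    linear_combination C μ ^ 2 * hm + hw - h15 * monicQuintic ℚ * w - C (1 / 5) * w * h5
  have hz := (isCoprime_sextic h.monic.ne_zero (by omega)).dvd_of_dvd_mul_left hAw
  have hz0 : C (μ ^ 2) - C (1 / 5) * w = 0 := by
    by_contra hne
    have := natDegree_le_of_dvd hz hne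
    have h2 : (C (μ ^ 2) - C (1 / 5) * w).natDegree ≤ w.natDegree :=
      (natDegree_sub_le _ _).trans (max_le (by rw [natDegree_C]; omega) (natDegree_C_mul_le _ _))
    rcases hwd with rfl | hwd
    · rw [mul_zero, sub_zero, natDegree_C] at this
      omega
    · omega
  have h15 : (C (1 / 5 : ℚ)) * 5 = 1 := by
    rw [← map_ofNat C 5, ← C_mul]; norm_num
  linear_combination hw - 5 * monicQuintic ℚ * hz0 - h15 * monicQuintic ℚ * w - C (μ ^ 2) * h5

theorem exists_halving {A B : ℚ[X]} (h : IsMumford A B) (hB : B.natDegree < A.natDegree) :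
    (∃ r, A = (X - C r) ^ 2) ∨ ∃ (A' B' c l l' : ℚ[X]) (ν : ℚ), IsMumford A' B' ∧
      B'.natDegree < A'.natDegree ∧ c.natDegree ≤ 3 ∧ c = B + A * l ∧ l.natDegree ≤ 1 ∧
      c = B' + A' * l' ∧ l'.natDegree ≤ 1 ∧ ν ≠ 0 ∧ c ^ 2 = sextic ℚ + C ν * (A * A' ^ 2) := by
  obtain ⟨l, A', μ, hl, hA', hne, heq⟩ := exists_halving_relation h hB
  have hA0 := h.monic.ne_zero
  have hAd := h.natDegree_le
  have hApos := h.natDegree_pos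
  by_cases hμ : μ = 0
  · subst hμ
    have hl0 : l ≠ 0 := fun h ↦ hne ⟨h, rfl⟩
    have heq : A * l ^ 2 = C (twist A) * A' ^ 2 := mul_left_cancel₀ hA0 (by
      simp only [map_zero, zero_mul, add_zero, zero_pow two_ne_zero, zero_add] at heq
      linear_combination heq)
    have hA'0 : A' ≠ 0 := by
      rintro rfl
      simp [hA0, hl0] at heq
    have hdeg := congrArg natDegree heq
    rw [natDegree_C_mul (twist_ne_zero A), natDegree_mul hA0 (pow_ne_zero 2 hl0), natDegree_pow,
      natDegree_pow] at hdeg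
    have hA2 : A.natDegree = 2 := by omega
    rw [twist, if_pos hA2, map_one, one_mul] at heq
    obtain ⟨e, rfl⟩ : l ∣ A' := (IsIntegrallyClosed.pow_dvd_pow_iff two_ne_zero).1
      (heq ▸ dvd_mul_left _ _)
    have hAe : A = e ^ 2 := mul_right_cancel₀ (pow_ne_zero 2 hl0) (by rw [heq]; ring)
    have he1 : e.natDegree = 1 := by rw [hAe, natDegree_pow] at hA2; omega
    have hlc : e.coeff 1 ^ 2 = 1 := by
      have := h.monic
      rw [Monic, hAe, leadingCoeff_pow, leadingCoeff, he1] at this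
      exact this
    refine .inl ⟨-(e.coeff 0 * e.coeff 1), ?_⟩
    rw [hAe, eq_of_natDegree_le_one' he1.le]
    have hlc' := congrArg C hlc
    simp only [map_pow, map_one, map_neg, map_mul, coeff_add, coeff_C_zero, coeff_C_mul, coeff_X_zero, coeff_X_one, coeff_C_succ, mul_zero, add_zero, mul_one, zero_add] at hlc' ⊢
    linear_combination (X ^ 2 - C (e.coeff 0) ^ 2) * hlc'
  · right
    have hμC : C μ⁻¹ * C μ = 1 := by rw [← C_mul, inv_mul_cancel₀ hμ, map_one]
    have hcd : (B + A * (C μ⁻¹ * l)).natDegree ≤ A.natDegree + 1 :=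
      natDegree_add_le_of_degree_le (by omega)
        (natDegree_mul_le_of_le le_rfl ((natDegree_C_mul_le _ _).trans hl))
    have hrel : (B + A * (C μ⁻¹ * l)) ^ 2 =
        sextic ℚ + C (twist A * μ⁻¹ ^ 2) * (A * A' ^ 2) := by
      simp only [map_mul, map_pow] at heq ⊢
      linear_combination C μ⁻¹ ^ 2 * heq + (sextic ℚ * (C μ⁻¹ * C μ + 1) - B ^ 2 * (C μ⁻¹ * C μ + 1) - 2 * A * B * l * C μ⁻¹) * hμC
    have hA'2 : A'.natDegree = 2 := by
      by_contra hA'1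
      have h₁ : (C (twist A * μ⁻¹ ^ 2) * (A * A' ^ 2)).natDegree < (sextic ℚ).natDegree := by
        have h₂ := (natDegree_C_mul_le (twist A * μ⁻¹ ^ 2) _).trans
          (natDegree_mul_le_of_le (le_refl A.natDegree)
            (natDegree_pow_le_of_le 2 (show A'.natDegree ≤ 1 by omega)))
        rw [natDegree_sextic]
        omega
      have h₂ := congrArg natDegree hrel
      rw [natDegree_add_eq_left_of_natDegree_lt h₁, natDegree_sextic, natDegree_pow] at h₂
      omega
    have hA'0 : A' ≠ 0 := by rintro rfl; simp at hA'2
    have hlc : A'.leadingCoeff ≠ 0 := leadingCoeff_ne_zero.2 hA'0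
    have hlcC : C A'.leadingCoeff * C A'.leadingCoeff⁻¹ = 1 := by
      rw [← C_mul, mul_inv_cancel₀ hlc, map_one]
    have hmon : (A' * C A'.leadingCoeff⁻¹).Monic := monic_mul_leadingCoeff_inv hA'0
    have hdeg : (A' * C A'.leadingCoeff⁻¹).natDegree = 2 := by
      rw [natDegree_mul_C (inv_ne_zero hlc), hA'2]
    set A'' := A' * C A'.leadingCoeff⁻¹ with hA''
    set c := B + A * (C μ⁻¹ * l) with hc
    have hA'A : A' = A'' * C A'.leadingCoeff := by
      rw [hA'']; linear_combination -A' * hlcC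
    have hmod := modByMonic_add_div c A''
    refine ⟨A'', c %ₘ A'', c, C μ⁻¹ * l, c /ₘ A'', twist A * μ⁻¹ ^ 2 * A'.leadingCoeff ^ 2,
      ⟨hmon, by omega, by omega, ?_⟩, natDegree_modByMonic_lt _ hmon (by rintro h1; rw [h1] at hdeg; simp at hdeg), by omega,
      rfl, (natDegree_C_mul_le _ _).trans hl, hmod.symm, ?_,
      mul_ne_zero (mul_ne_zero (twist_ne_zero A) (pow_ne_zero 2 (inv_ne_zero hμ)))
        (pow_ne_zero 2 hlc), ?_⟩
    · refine ⟨(c /ₘ A'') * (c + c %ₘ A'') - C (twist A * μ⁻¹ ^ 2) * (A * (C A'.leadingCoeff * A')), ?_⟩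
      linear_combination hrel * (-1) + (c + c %ₘ A'') * (-hmod) + C (twist A * μ⁻¹ ^ 2) * A * A' * (-hA'A)
    · rw [natDegree_divByMonic _ hmon]; omega
    · rw [map_mul C (twist A * μ⁻¹ ^ 2), map_pow]
      linear_combination hrel + C (twist A * μ⁻¹ ^ 2) * A * (A' + A'' * C A'.leadingCoeff) * hA'A

end Halving

section Integrality

local notation "φ" => Polynomial.map (PadicInt.toZMod (p := 2))
local notation "ι" => Polynomial.map (algebraMap ℤ_[2] ℚ_[2])

theorem map_algebraMap_injective : Function.Injective ι :=
  map_injective _ (IsFractionRing.injective ℤ_[2] ℚ_[2])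

theorem natDegree_map_algebraMap (p : ℤ_[2][X]) : (ι p).natDegree = p.natDegree :=
  natDegree_map_eq_of_injective (IsFractionRing.injective ℤ_[2] ℚ_[2]) p

theorem exists_map_eq_two_pow_mul (p : ℚ_[2][X]) : ∃ (j : ℕ) (P : ℤ_[2][X]), ι P = 2 ^ j * p := by
  obtain ⟨b, hb, h⟩ := IsLocalization.integerNormalization_spec (nonZeroDivisors ℤ_[2]) p
  have hb0 := nonZeroDivisors.ne_zero hb
  refine ⟨b.valuation, C ((PadicInt.unitCoeff hb0)⁻¹ : ℤ_[2]ˣ).val *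
    IsLocalization.integerNormalization (nonZeroDivisors ℤ_[2]) p, ?_⟩
  rw [Polynomial.map_mul, h, map_C, Algebra.smul_def, ← mul_assoc]
  congr 1
  have : b • (1 : ℚ_[2][X]) = C (algebraMap ℤ_[2] ℚ_[2] b) := by
    rw [Algebra.smul_def, mul_one]; rfl
  rw [← mul_one (algebraMap ℤ_[2] ℚ_[2][X] b), ← Algebra.smul_def, this, ← C_mul, ← map_mul]
  have h1 : ((PadicInt.unitCoeff hb0)⁻¹ : ℤ_[2]ˣ).val * b = 2 ^ b.valuation :=
    (Units.inv_mul_eq_iff_eq_mul _).2 (PadicInt.unitCoeff_spec hb0)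
  rw [h1, map_pow, map_ofNat, map_pow, map_ofNat]

theorem exists_map_eq_of_sq {p : ℚ_[2][X]} {w : ℤ_[2][X]} (h : p ^ 2 = ι w) : ∃ P, ι P = p := by
  obtain ⟨j, Q, hQ⟩ := exists_map_eq_two_pow_mul p
  obtain ⟨P, rfl⟩ := exists_eq_two_pow_mul_of_quadratic (a := 1) (b := 0) (w := w) (Z := Q) (j := j)
    (by simp) (map_algebraMap_injective (by
      have h4 : ((2 : ℚ_[2][X]) ^ j) ^ 2 = 4 ^ j := by rw [← pow_mul, mul_comm, pow_mul]; norm_num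
      simp only [one_mul, zero_mul, mul_zero, zero_add, Polynomial.map_pow, Polynomial.map_mul,
        Polynomial.map_ofNat, hQ]
      linear_combination p ^ 2 * h4 + 4 ^ j * h))
  refine ⟨P, mul_left_cancel₀ (pow_ne_zero j (two_ne_zero (α := ℚ_[2][X]))) ?_⟩
  rw [← hQ, Polynomial.map_mul, Polynomial.map_pow, Polynomial.map_ofNat]

theorem exists_map_eq_of_mul {a q : ℤ_[2][X]} (ha : φ a ≠ 0) {x : ℚ_[2][X]}
    (h : ι q = ι a * x) : ∃ Y, ι Y = x ∧ q = a * Y := by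
  obtain ⟨j, Q, hQ⟩ := exists_map_eq_two_pow_mul x
  obtain ⟨Y, rfl⟩ := exists_eq_two_pow_mul (a := a) (w := q) (Z := Q) (j := j) ha
    (map_algebraMap_injective (by
      simp only [Polynomial.map_pow, Polynomial.map_mul, Polynomial.map_ofNat, hQ, h]
      ring))
  have hY : ι Y = x := mul_left_cancel₀ (pow_ne_zero j (two_ne_zero (α := ℚ_[2][X]))) (by
    rw [← hQ, Polynomial.map_mul, Polynomial.map_pow, Polynomial.map_ofNat])
  exact ⟨Y, hY, map_algebraMap_injective (by rw [h, Polynomial.map_mul, hY])⟩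

theorem not_isUnit_two : ¬ IsUnit (2 : ℤ_[2][X]) := fun h ↦ by
  have := h.map (mapRingHom (PadicInt.toZMod (p := 2)))
  have h2 : (2 : (ZMod 2)[X]) = 0 := CharTwo.two_eq_zero
  rw [map_ofNat, h2] at this
  exact not_isUnit_zero this

theorem exists_primitive {p : ℚ_[2][X]} (hp : p ≠ 0) :
    ∃ (a : ℤ_[2][X]) (u : ℚ_[2]), φ a ≠ 0 ∧ u ≠ 0 ∧ ι a = C u * p := by
  obtain ⟨j, P, hP⟩ := exists_map_eq_two_pow_mul p
  have hP0 : P ≠ 0 := by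
    rintro rfl
    rw [Polynomial.map_zero] at hP
    exact mul_ne_zero (pow_ne_zero j two_ne_zero) hp hP.symm
  obtain ⟨n, a, ha, rfl⟩ := WfDvdMonoid.max_power_factor' hP0 not_isUnit_two
  refine ⟨a, 2 ^ j / 2 ^ n, fun h ↦ ha ?_,
    div_ne_zero (pow_ne_zero j two_ne_zero) (pow_ne_zero n two_ne_zero), ?_⟩
  · obtain ⟨q, rfl⟩ := map_toZMod_eq_zero h
    exact dvd_mul_right _ _
  · refine mul_left_cancel₀ (pow_ne_zero n (two_ne_zero (α := ℚ_[2][X]))) ?_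
    rw [Polynomial.map_mul, Polynomial.map_pow, Polynomial.map_ofNat] at hP
    rw [hP, ← mul_assoc]
    congr 1
    rw [show (2 : ℚ_[2][X]) = C 2 from (map_ofNat C 2).symm, ← C_pow, ← C_pow, ← C_mul,
      mul_div_cancel₀ _ (pow_ne_zero n two_ne_zero)]

theorem exists_unit_mul_two_pow {ν : ℚ_[2]} (hν : ν ≠ 0) : ∃ (η : ℤ_[2]ˣ) (j : ℕ),
    ν = 2 ^ j * (η : ℤ_[2]) ∨ 2 ^ j * ν = (η : ℤ_[2]) := by
  have key : ∀ {ν : ℚ_[2]}, ν ≠ 0 → ‖ν‖ ≤ 1 → ∃ (η : ℤ_[2]ˣ) (j : ℕ), ν = 2 ^ j * (η : ℤ_[2]) := by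
    intro ν hν h
    obtain ⟨x, rfl⟩ : ∃ x : ℤ_[2], (x : ℚ_[2]) = ν := ⟨⟨ν, h⟩, rfl⟩
    have h0 : x ≠ 0 := PadicInt.coe_ne_zero.1 hν
    refine ⟨PadicInt.unitCoeff h0, x.valuation,
      (congrArg (algebraMap ℤ_[2] ℚ_[2]) (PadicInt.unitCoeff_spec h0)).trans ?_⟩
    rw [map_mul, map_pow, map_natCast, mul_comm, Nat.cast_ofNat]
    rfl
  rcases le_total ‖ν‖ 1 with h | h
  · obtain ⟨η, j, h⟩ := key hν h
    exact ⟨η, j, .inl h⟩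
  · obtain ⟨η, j, h⟩ := key (inv_ne_zero hν) (by rw [norm_inv]; exact inv_le_one_of_one_le₀ h)
    refine ⟨η⁻¹, j, .inr ?_⟩
    have h1 : ((η : ℤ_[2]) : ℚ_[2]) * ((η⁻¹ : ℤ_[2]ˣ) : ℤ_[2]) = 1 := by
      rw [← PadicInt.coe_mul, η.mul_inv, PadicInt.coe_one]
    rw [inv_eq_iff_eq_inv] at h
    have h2 : ((η : ℤ_[2]) : ℚ_[2]) ≠ 0 := left_ne_zero_of_mul_eq_one h1
    rw [h]
    field_simp
    linear_combination -h1

end Integrality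

section Relation

local notation "φ" => Polynomial.map (PadicInt.toZMod (p := 2))
local notation "ι" => Polynomial.map (algebraMap ℤ_[2] ℚ_[2])

theorem exists_integral_relation_of_primitive {a a' : ℤ_[2][X]} {c : ℚ_[2][X]} {ν : ℚ_[2]}
    (ha : φ a ≠ 0) (ha' : φ a' ≠ 0) (had : a.natDegree ≤ 2) (ha'd : a'.natDegree ≤ 2)
    (hc : c.natDegree ≤ 3) (hν : ν ≠ 0)
    (h : c ^ 2 = evenSextic ℚ_[2] + C ν * ι (a * a' ^ 2)) :
    ∃ (k : ℕ) (P : ℤ_[2][X]) (η : ℤ_[2]ˣ), 0 < k ∧ ι P = 2 ^ k * c ∧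
      P ^ 2 = 4 ^ k * evenSextic ℤ_[2] + C (η : ℤ_[2]) * a * a' ^ 2 := by
  have hf : evenSextic ℚ_[2] = ι (evenSextic ℤ_[2]) := (evenSextic_map _).symm
  have had' (η : ℤ_[2]ˣ) : (C (η : ℤ_[2]) * a).natDegree ≤ 2 := (natDegree_C_mul_le _ _).trans had
  have hηa (η : ℤ_[2]ˣ) : φ (C (η : ℤ_[2]) * a) ≠ 0 := by
    rw [Polynomial.map_mul, map_C]
    exact mul_ne_zero (C_ne_zero.2 (η.isUnit.map _).ne_zero) ha
  have hC2 : (C 2 : ℚ_[2][X]) = 2 := map_ofNat C 2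
  have h4 (k : ℕ) : ((2 : ℚ_[2][X]) ^ k) ^ 2 = 4 ^ k := by
    rw [← pow_mul, mul_comm, pow_mul]; norm_num
  obtain ⟨η, j, hj | hj⟩ := exists_unit_mul_two_pow hν
  · exfalso
    have hj' : C ν = 2 ^ j * C (algebraMap ℤ_[2] ℚ_[2] η) := by
      rw [hj, C_mul, C_pow, hC2]; rfl
    have hw : c ^ 2 = ι (evenSextic ℤ_[2] + 2 ^ j * (C (η : ℤ_[2]) * a * a' ^ 2)) := by
      simp only [Polynomial.map_add, Polynomial.map_mul, Polynomial.map_pow, Polynomial.map_ofNat,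
        map_C] at h ⊢
      rw [h, hf, hj']
      ring
    obtain ⟨P, rfl⟩ := exists_map_eq_of_sq hw
    rw [natDegree_map_algebraMap] at hc
    rw [← Polynomial.map_pow] at hw
    replace hw := map_algebraMap_injective hw
    rcases j with _ | _ | j
    · refine relation_one_false hc (had' η) ha'd (hw.trans ?_)
      rw [C_1]; ring
    · refine relation_two_false hc (had' η) ha'd (hw.trans ?_)
      rw [map_ofNat]; ring
    · refine relation_four_mul_false hc (had' η) ha'd (ν := 2 ^ j) (hw.trans ?_)
      rw [C_mul, C_pow, map_ofNat, map_ofNat]; ring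
  · have hj' : 2 ^ j * C ν = C (algebraMap ℤ_[2] ℚ_[2] η) := by
      rw [← hC2, ← C_pow, ← C_mul, hj]; rfl
    obtain ⟨k, rfl | rfl⟩ := Nat.even_or_odd' j
    · have hw : (2 ^ k * c) ^ 2 =
          ι (4 ^ k * evenSextic ℤ_[2] + C (η : ℤ_[2]) * a * a' ^ 2) := by
        simp only [Polynomial.map_add, Polynomial.map_mul, Polynomial.map_pow,
          Polynomial.map_ofNat, map_C] at h ⊢
        rw [← hj', ← hf, mul_pow, h, h4, pow_mul]
        norm_num
        ring
      obtain ⟨P, hP⟩ := exists_map_eq_of_sq hw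
      rw [← hP, ← Polynomial.map_pow] at hw
      replace hw := map_algebraMap_injective hw
      rcases Nat.eq_zero_or_pos k with rfl | hk
      · exfalso
        rw [pow_zero, one_mul] at hP
        rw [← hP, natDegree_map_algebraMap] at hc
        refine relation_one_false hc (had' η) ha'd (hw.trans ?_)
        rw [C_1]; ring
      · exact ⟨k, P, η, hk, hP, hw⟩
    · exfalso
      have hw : (2 ^ (k + 1) * c) ^ 2 =
          ι (4 ^ (k + 1) * evenSextic ℤ_[2] + 2 * (C (η : ℤ_[2]) * a * a' ^ 2)) := by
        simp only [Polynomial.map_add, Polynomial.map_mul, Polynomial.map_pow,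
          Polynomial.map_ofNat, map_C] at h ⊢
        rw [← hj', ← hf, mul_pow, h, h4, pow_succ 2 (2 * k), pow_mul, show (2 : ℚ_[2][X]) ^ 2 = 4 by norm_num]
        ring
      obtain ⟨P, hP⟩ := exists_map_eq_of_sq hw
      rw [← hP, ← Polynomial.map_pow] at hw
      replace hw := map_algebraMap_injective hw
      have h₁ : φ (P ^ 2) = 0 := by
        rw [hw, show 4 ^ (k + 1) * evenSextic ℤ_[2] + 2 * (C (η : ℤ_[2]) * a * a' ^ 2) =
          2 * (2 * 4 ^ k * evenSextic ℤ_[2] + C (η : ℤ_[2]) * a * a' ^ 2) by ring, map_two_mul]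
      rw [Polynomial.map_pow, sq_eq_zero_iff] at h₁
      obtain ⟨Q, rfl⟩ := map_toZMod_eq_zero h₁
      have h₂ : C (η : ℤ_[2]) * a * a' ^ 2 = 2 * (Q ^ 2 - 4 ^ k * evenSextic ℤ_[2]) :=
        mul_left_cancel₀ (two_ne_zero (α := ℤ_[2][X])) (by linear_combination -hw)
      have h₃ := congrArg φ h₂
      rw [map_two_mul, Polynomial.map_mul, Polynomial.map_pow] at h₃
      exact mul_ne_zero (hηa η) (pow_ne_zero 2 ha') h₃

theorem exists_integral_relation {A A' c : ℚ_[2][X]} {ν : ℚ_[2]} (hA : A ≠ 0) (hA' : A' ≠ 0)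
    (hAd : A.natDegree ≤ 2) (hA'd : A'.natDegree ≤ 2) (hc : c.natDegree ≤ 3) (hν : ν ≠ 0)
    (h : c ^ 2 = 16 * evenSextic ℚ_[2] + C ν * (A * A' ^ 2)) :
    ∃ (k : ℕ) (P a a' : ℤ_[2][X]) (u u' : ℚ_[2]), 0 < k ∧ 4 * ι P = 2 ^ k * c ∧ u ≠ 0 ∧ u' ≠ 0 ∧
      ι a = C u * A ∧ ι a' = C u' * A' ∧ φ a ≠ 0 ∧ φ a' ≠ 0 ∧ a.natDegree = A.natDegree ∧
      a'.natDegree = A'.natDegree ∧ P.natDegree ≤ 3 ∧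
      P ^ 2 = 4 ^ k * evenSextic ℤ_[2] + a * a' ^ 2 := by
  obtain ⟨a, u, ha, hu, haA⟩ := exists_primitive hA
  obtain ⟨a', u', ha', hu', haA'⟩ := exists_primitive hA'
  have had : a.natDegree = A.natDegree := by
    rw [← natDegree_map_algebraMap, haA, natDegree_C_mul hu]
  have ha'd : a'.natDegree = A'.natDegree := by
    rw [← natDegree_map_algebraMap, haA', natDegree_C_mul hu']
  have h16 : C (1 / 4 : ℚ_[2]) ^ 2 * 16 = 1 := by
    rw [← map_ofNat C 16, ← C_pow, ← C_mul]; norm_num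
  have huu : C (u * u' ^ 2)⁻¹ * C (u * u' ^ 2) = 1 := by
    rw [← C_mul, inv_mul_cancel₀ (mul_ne_zero hu (pow_ne_zero 2 hu')), C_1]
  obtain ⟨k, P, η, hk, hP, hrel⟩ := exists_integral_relation_of_primitive (c := C (1 / 4) * c)
    (ν := (1 / 4) ^ 2 * ν * (u * u' ^ 2)⁻¹) ha ha' (had ▸ hAd) (ha'd ▸ hA'd)
    ((natDegree_C_mul_le _ _).trans hc)
    (mul_ne_zero (mul_ne_zero (by norm_num) hν)
      (inv_ne_zero (mul_ne_zero hu (pow_ne_zero 2 hu')))) (by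
      rw [Polynomial.map_mul, Polynomial.map_pow, haA, haA']
      have h₀ : C ((1 / 4) ^ 2 * ν * (u * u' ^ 2)⁻¹) =
          C (1 / 4) ^ 2 * C ν * C (u * u' ^ 2)⁻¹ := by simp only [C_mul, C_pow]
      rw [h₀]
      have : C (u * u' ^ 2) = C u * C u' ^ 2 := by rw [C_mul, C_pow]
      linear_combination C (1 / 4) ^ 2 * h + evenSextic ℚ_[2] * h16 -
        C (1 / 4) ^ 2 * C ν * A * A' ^ 2 * huu +
        C (1 / 4) ^ 2 * C ν * A * A' ^ 2 * C (u * u' ^ 2)⁻¹ * this)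
  have h14 : 4 * C (1 / 4 : ℚ_[2]) = 1 := by
    rw [← map_ofNat C 4, ← C_mul]; norm_num
  have hηu : φ (C (η : ℤ_[2])) ≠ 0 := by
    rw [map_C]; exact C_ne_zero.2 (η.isUnit.map _).ne_zero
  refine ⟨k, P, C (η : ℤ_[2]) * a, a', algebraMap ℤ_[2] ℚ_[2] η * u, u', hk, ?_,
    mul_ne_zero (η.isUnit.map _).ne_zero hu, hu', ?_, haA', ?_, ha', ?_, ha'd, ?_, hrel⟩
  · rw [hP]
    linear_combination 2 ^ k * c * h14
  · rw [Polynomial.map_mul, haA, map_C, C_mul, mul_assoc]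
  · rw [Polynomial.map_mul]; exact mul_ne_zero hηu ha
  · rw [natDegree_C_mul η.ne_zero, had]
  · rw [← natDegree_map_algebraMap, hP, ← map_ofNat C 2, ← C_pow]
    exact (natDegree_C_mul_le _ _).trans ((natDegree_C_mul_le _ _).trans hc)

end Relation

section Levels

local notation "φ" => Polynomial.map (PadicInt.toZMod (p := 2))
local notation "ι" => Polynomial.map (algebraMap ℤ_[2] ℚ_[2])

/-- The substitution `X ↦ 2X` followed by the inclusion of `ℚ` in `ℚ_[2]`. -/
noncomputable def rescale : ℚ[X] →+* ℚ_[2][X] :=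
  (mapRingHom (algebraMap ℚ ℚ_[2])).comp (compRingHom (2 * X))

theorem rescale_apply (p : ℚ[X]) : rescale p = (p.comp (2 * X)).map (algebraMap ℚ ℚ_[2]) := rfl

theorem rescale_C (r : ℚ) : rescale (C r) = C (algebraMap ℚ ℚ_[2] r) := by
  rw [rescale_apply, C_comp, map_C]

theorem rescale_X : rescale X = 2 * X := by
  rw [rescale_apply, X_comp, Polynomial.map_mul, map_X, Polynomial.map_ofNat]

theorem natDegree_rescale (p : ℚ[X]) : (rescale p).natDegree = p.natDegree := by
  rw [rescale_apply, natDegree_map, natDegree_comp, ← map_ofNat C 2, natDegree_C_mul_X _ two_ne_zero,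
    mul_one]

theorem rescale_ne_zero {p : ℚ[X]} (hp : 0 < p.natDegree) : rescale p ≠ 0 := fun h ↦ by
  rw [← natDegree_rescale, h, natDegree_zero] at hp
  exact hp.false

theorem rescale_sextic : rescale (sextic ℚ) = 16 * evenSextic ℚ_[2] := by
  simp only [sextic, evenSextic, map_add, map_sub, map_mul, map_pow, map_ofNat, rescale_X]
  ring

/-- The divisor class `(A, B)` has a representative which is integral after multiplication by
`2 ^ n / 4`. -/
def HasLevel (A B : ℚ_[2][X]) (n : ℕ) : Prop :=
  ∃ (b : ℤ_[2][X]) (l : ℚ_[2][X]), b.natDegree ≤ 3 ∧ l.natDegree ≤ 1 ∧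
    4 * ι b = 2 ^ n * B + A * l

theorem natDegree_ofNat_pow_mul (k : ℕ) (p : ℚ_[2][X]) : (2 ^ k * p).natDegree = p.natDegree := by
  rw [show (2 : ℚ_[2][X]) ^ k = C (2 ^ k) by rw [C_pow, map_ofNat],
    natDegree_C_mul (pow_ne_zero k two_ne_zero)]

theorem HasLevel.mono {A B : ℚ_[2][X]} {m n : ℕ} (h : HasLevel A B m) (hmn : m ≤ n) :
    HasLevel A B n := by
  obtain ⟨b, l, hb, hl, h⟩ := h
  obtain ⟨k, rfl⟩ := Nat.exists_eq_add_of_le hmn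
  refine ⟨2 ^ k * b, 2 ^ k * l, ?_, ?_, ?_⟩
  · rwa [natDegree_two_pow_mul]
  · rwa [natDegree_ofNat_pow_mul]
  · rw [Polynomial.map_mul, Polynomial.map_pow, Polynomial.map_ofNat, pow_add]
    linear_combination 2 ^ k * h

theorem HasLevel.exists_eq_add_mul {A B L : ℚ_[2][X]} {k n : ℕ} {a P : ℤ_[2][X]} {u : ℚ_[2]}
    (h : HasLevel A B n) (hnk : n ≤ k) (hu : u ≠ 0) (haA : ι a = C u * A) (ha : φ a ≠ 0)
    (hL : L.natDegree ≤ 1) (hP : 4 * ι P = 2 ^ k * B + A * L) :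
    ∃ (b x : ℤ_[2][X]) (l : ℚ_[2][X]), b.natDegree ≤ 3 ∧ x.natDegree ≤ 1 ∧ l.natDegree ≤ 1 ∧
      4 * ι b = 2 ^ n * B + A * l ∧ 2 ^ (k - n) * b = P + a * x := by
  obtain ⟨b, l, hb, hl, h⟩ := h
  obtain ⟨j, rfl⟩ := Nat.exists_eq_add_of_le hnk
  rw [Nat.add_sub_cancel_left]
  have hCu : C u * C u⁻¹ = 1 := by rw [← C_mul, mul_inv_cancel₀ hu, C_1]
  have h14 : 4 * C (1 / 4 : ℚ_[2]) = 1 := by rw [← map_ofNat C 4, ← C_mul]; norm_num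
  obtain ⟨x, hx, hbx⟩ := exists_map_eq_of_mul (q := 2 ^ j * b - P) ha
    (x := C (1 / 4 : ℚ_[2]) * (C u⁻¹ * (2 ^ j * l - L))) (by
      refine mul_left_cancel₀ (show (4 : ℚ_[2][X]) ≠ 0 by
        rw [← map_ofNat C 4]; exact C_ne_zero.2 (by norm_num)) ?_
      rw [Polynomial.map_sub, Polynomial.map_mul, Polynomial.map_pow, Polynomial.map_ofNat, haA]
      rw [pow_add] at hP
      linear_combination 2 ^ j * h - hP - C u * A * (C u⁻¹ * (2 ^ j * l - L)) * h14 -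
        A * (2 ^ j * l - L) * hCu)
  refine ⟨b, x, l, hb, ?_, hl, h, by linear_combination hbx⟩
  rw [← natDegree_map_algebraMap, hx]
  refine (natDegree_C_mul_le _ _).trans ((natDegree_C_mul_le _ _).trans
    ((natDegree_sub_le_of_le (m := 1) (n := 1) ?_ hL).trans (by omega)))
  rwa [natDegree_ofNat_pow_mul]

theorem HasLevel.of_succ {A B l : ℚ_[2][X]} {n : ℕ} {a b : ℤ_[2][X]} {u : ℚ_[2]}
    (haA : ι a = C u * A) (had : a.natDegree ≤ 2) (hb : b.natDegree ≤ 3) (hl : l.natDegree ≤ 1)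
    (h : 4 * ι b = 2 ^ (n + 1) * B + A * l) {q : (ZMod 2)[X]} (hq : q.natDegree ≤ 1)
    (hbq : φ b = φ a * q) : HasLevel A B n := by
  obtain ⟨y, hy⟩ := ZMod.ringHom_surjective (PadicInt.toZMod (p := 2)) (q.coeff 1)
  obtain ⟨z, hz⟩ := ZMod.ringHom_surjective (PadicInt.toZMod (p := 2)) (q.coeff 0)
  have hH : φ (C y * X + C z) = q := by
    rw [Polynomial.map_add, Polynomial.map_mul, map_C, map_C, map_X, hy, hz]
    exact (eq_X_add_C_of_natDegree_le_one hq).symm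
  have hHd : (C y * X + C z).natDegree ≤ 1 := natDegree_linear_le
  generalize C y * X + C z = H at hH hHd
  obtain ⟨b', hb'⟩ := map_toZMod_eq_zero (p := b - a * H) (by
    rw [Polynomial.map_sub, Polynomial.map_mul, hH, hbq, sub_self])
  have h12 : 2 * C (1 / 2 : ℚ_[2]) = 1 := by rw [← map_ofNat C 2, ← C_mul]; norm_num
  refine ⟨b', C (1 / 2) * l + C (-2 * u) * ι H, ?_, ?_, ?_⟩
  · have : (2 ^ 1 * b').natDegree ≤ 3 := by
      rw [pow_one, ← hb']
      exact (natDegree_sub_le_of_le hb (natDegree_mul_le_of_le had hHd)).trans (by omega)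
    rwa [natDegree_two_pow_mul] at this
  · refine (natDegree_add_le_of_le (m := 1) (n := 1) ((natDegree_C_mul_le _ _).trans hl)
      ((natDegree_C_mul_le _ _).trans ?_)).trans (by omega)
    rwa [natDegree_map_algebraMap]
  · have hb'' := congrArg ι hb'
    simp only [Polynomial.map_sub, Polynomial.map_mul, Polynomial.map_ofNat, haA] at hb''
    refine mul_left_cancel₀ (two_ne_zero (α := ℚ_[2][X])) ?_
    rw [C_mul, C_neg, map_ofNat C 2]
    rw [pow_succ] at h
    linear_combination h - 4 * hb'' - A * l * h12

end Levels

section LevelZero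

local notation "φ" => Polynomial.map (PadicInt.toZMod (p := 2))
local notation "ι" => Polynomial.map (algebraMap ℤ_[2] ℚ_[2])

/-- A Mumford representation whose second component is reduced. -/
def IsReducedMumford (A B : ℚ[X]) : Prop := IsMumford A B ∧ B.natDegree < A.natDegree

/-- An integral `2`-adic form of the relation between a divisor class and one of its halves. -/
structure IntegralRelation (A B A' B' : ℚ[X]) (k : ℕ) (P a a' : ℤ_[2][X]) : Prop where
  pos : 0 < k
  exists_smul : ∃ u : ℚ_[2], u ≠ 0 ∧ ι a = C u * rescale A
  exists_smul' : ∃ u : ℚ_[2], u ≠ 0 ∧ ι a' = C u * rescale A'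
  ne_zero : φ a ≠ 0
  ne_zero' : φ a' ≠ 0
  natDegree_left : a.natDegree = A.natDegree
  natDegree_le : a.natDegree ≤ 2
  natDegree_le' : a'.natDegree ≤ 2
  natDegree_le_three : P.natDegree ≤ 3
  eq : P ^ 2 = 4 ^ k * evenSextic ℤ_[2] + a * a' ^ 2
  exists_lift : ∃ L, L.natDegree ≤ 1 ∧ 4 * ι P = 2 ^ k * rescale B + rescale A * L
  exists_lift' : ∃ L, L.natDegree ≤ 1 ∧ 4 * ι P = 2 ^ k * rescale B' + rescale A' * L

theorem IsReducedMumford.exists_integralRelation {A B : ℚ[X]} (h : IsReducedMumford A B)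
    (hA : ∀ r, A ≠ (X - C r) ^ 2) :
    ∃ (A' B' : ℚ[X]) (k : ℕ) (P a a' : ℤ_[2][X]), IsReducedMumford A' B' ∧
      IntegralRelation A B A' B' k P a a' := by
  obtain ⟨r, hr⟩ | ⟨A', B', c, l, l', ν, hM, hB', hc, hcl, hl, hcl', hl', hν, hrel⟩ :=
    exists_halving h.1 h.2
  · exact absurd hr (hA r)
  have hrel' := congrArg rescale hrel
  rw [map_add, map_mul, map_mul, map_pow, map_pow, rescale_sextic, rescale_C] at hrel'
  obtain ⟨k, P, a, a', u, u', hk, hP, hu, hu', haA, haA', ha, ha', had, ha'd, hPd, heq⟩ :=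
    exists_integral_relation (rescale_ne_zero h.1.natDegree_pos)
      (rescale_ne_zero hM.natDegree_pos) ((natDegree_rescale A).trans_le h.1.natDegree_le)
      ((natDegree_rescale A').trans_le hM.natDegree_le) ((natDegree_rescale c).trans_le hc)
      ((_root_.map_ne_zero _).2 hν) hrel'
  rw [natDegree_rescale] at had ha'd
  refine ⟨A', B', k, P, a, a', ⟨hM, hB'⟩, hk, ⟨u, hu, haA⟩, ⟨u', hu', haA'⟩, ha, ha', had,
    had.trans_le h.1.natDegree_le, ha'd.trans_le hM.natDegree_le, hPd, heq,
    ⟨2 ^ k * rescale l, ?_, ?_⟩, ⟨2 ^ k * rescale l', ?_, ?_⟩⟩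
  · rwa [natDegree_ofNat_pow_mul, natDegree_rescale]
  · rw [hP, hcl, map_add, map_mul]; ring
  · rwa [natDegree_ofNat_pow_mul, natDegree_rescale]
  · rw [hP, hcl', map_add, map_mul]; ring

namespace IntegralRelation

variable {A B A' B' : ℚ[X]} {k n : ℕ} {P a a' : ℤ_[2][X]}

theorem hasLevel (h : IntegralRelation A B A' B' k P a a') :
    HasLevel (rescale A) (rescale B) k :=
  let ⟨L, hL, hP⟩ := h.exists_lift
  ⟨P, L, h.natDegree_le_three, hL, hP⟩

theorem hasLevel' (h : IntegralRelation A B A' B' k P a a') :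
    HasLevel (rescale A') (rescale B') k :=
  let ⟨L, hL, hP⟩ := h.exists_lift'
  ⟨P, L, h.natDegree_le_three, hL, hP⟩

theorem hasLevel_zero (h : IntegralRelation A B A' B' k P a a')
    (hn : HasLevel (rescale A) (rescale B) n)
    (hmin : ∀ m, HasLevel (rescale A') (rescale B') m → n ≤ m) :
    HasLevel (rescale A') (rescale B') 0 := by
  classical
  have hex : ∃ m, HasLevel (rescale A') (rescale B') m := ⟨k, h.hasLevel'⟩
  have hspec := Nat.find_spec hex
  have hle := Nat.find_min' hex h.hasLevel'
  rcases hm : Nat.find hex with _ | m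
  · rwa [hm] at hspec
  exfalso
  have hlt : ¬ HasLevel (rescale A') (rescale B') m := Nat.find_min hex (by omega)
  rw [hm] at hspec hle
  obtain ⟨u, hu, haA⟩ := h.exists_smul
  obtain ⟨u', hu', haA'⟩ := h.exists_smul'
  obtain ⟨L, hL, hP⟩ := h.exists_lift
  obtain ⟨L', hL', hP'⟩ := h.exists_lift'
  obtain ⟨b, x, -, -, hx, -, -, hbx⟩ :=
    (hn.mono (hmin _ hspec)).exists_eq_add_mul hle hu haA h.ne_zero hL hP
  obtain ⟨b', x', l', hb', hx', hl', hbl', hbx'⟩ :=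
    hspec.exists_eq_add_mul hle hu' haA' h.ne_zero' hL' hP'
  refine descent (F := 4 ^ (m + 1) * evenSextic ℤ_[2]) ?_ ?_ h.ne_zero h.ne_zero' hbx hbx'
    h.natDegree_le_three h.natDegree_le h.natDegree_le' hb' hx hx' fun q hq hbq ↦
    hlt (HasLevel.of_succ haA' h.natDegree_le' hb' hl' hbl' hq hbq)
  · rw [show (4 : ℤ_[2][X]) ^ (m + 1) * evenSextic ℤ_[2] =
      2 * (2 * 4 ^ m * evenSextic ℤ_[2]) by ring, map_two_mul]
  · rw [← mul_assoc, ← pow_add, Nat.sub_add_cancel hle]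
    exact h.eq

theorem exists_cofactor (h : IntegralRelation A B A' B' k P a a')
    (h0 : HasLevel (rescale A) (rescale B) 0) :
    ∃ b l m : ℤ_[2][X], b.natDegree ≤ 3 ∧ l.natDegree ≤ 1 ∧ m.natDegree ≤ 4 ∧
      b ^ 2 + a * m = evenSextic ℤ_[2] ∧
      a' ^ 2 = a * l ^ 2 + 2 ^ (k + 1) * (b * l) - 4 ^ k * m := by
  obtain ⟨u, hu, haA⟩ := h.exists_smul
  obtain ⟨L, hL, hP⟩ := h.exists_lift
  obtain ⟨b, x, -, hb, hx, -, -, hbx⟩ :=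
    h0.exists_eq_add_mul (Nat.zero_le k) hu haA h.ne_zero hL hP
  rw [Nat.sub_zero] at hbx
  obtain ⟨M, hM, hM'⟩ := exists_mumford_cofactor h.ne_zero h.eq hbx
  refine ⟨b, -x, -M, hb, (natDegree_neg x).trans_le hx, ?_, by linear_combination hM,
    by linear_combination hM'⟩
  rw [natDegree_neg, ← natDegree_four_pow_mul k,
    show 4 ^ k * M = a' ^ 2 + 2 ^ (k + 1) * (b * x) - a * x ^ 2 by linear_combination -hM']
  refine (natDegree_sub_le_of_le (m := 4) (n := 4) ((natDegree_add_le_of_le (m := 4) (n := 4)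
    (natDegree_pow_le_of_le 2 h.natDegree_le') ?_).trans (by omega))
    (natDegree_mul_le_of_le h.natDegree_le (natDegree_pow_le_of_le 2 hx))).trans (by omega)
  rw [natDegree_two_pow_mul]
  exact natDegree_mul_le_of_le hb hx

theorem coeff_of_hasLevel_zero (h : IntegralRelation A B A' B' k P a a')
    (h0 : HasLevel (rescale A) (rescale B) 0) :
    (∃ x, a.coeff 0 = 4 * x) ∧ (∃ x, a.coeff 1 = 4 * x) ∧ (∃ x, a.coeff 2 = 1 + 4 * x) := by
  obtain ⟨b, l, m, hb, hl, hm, hbm, hrel⟩ := h.exists_cofactor h0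
  obtain ⟨j, rfl⟩ := Nat.exists_eq_add_of_lt h.pos
  rw [zero_add] at hrel
  obtain ⟨e₀, e₁, e₂, -⟩ := level_zero (κ := 2 ^ j) h.natDegree_le' h.natDegree_le hl hb hm
    (by
      simp only [C_mul, C_pow, map_ofNat]
      have : ((2 : ℤ_[2][X]) ^ j) ^ 2 = 4 ^ j := by rw [← pow_mul, mul_comm, pow_mul]; norm_num
      linear_combination hrel + 4 * m * this)
    h.ne_zero' hbm
  exact ⟨e₀, e₁, e₂⟩

theorem natDegree_eq_two_of_hasLevel_zero (h : IntegralRelation A B A' B' k P a a')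
    (h0 : HasLevel (rescale A) (rescale B) 0) : A.natDegree = 2 := by
  obtain ⟨-, -, x, hx⟩ := h.coeff_of_hasLevel_zero h0
  rw [← h.natDegree_left]
  refine le_antisymm h.natDegree_le (le_natDegree_of_ne_zero fun h ↦ ?_)
  rw [hx] at h
  have := congrArg PadicInt.toZMod h
  rw [map_add, map_mul, map_ofNat, show (4 : ZMod 2) = 0 from rfl, zero_mul, add_zero, map_one,
    map_zero] at this
  exact one_ne_zero this

theorem exists_sq_eq {A'' B'' : ℚ[X]} {k' : ℕ} {P' a₂ a₂' : ℤ_[2][X]}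
    (h : IntegralRelation A B A' B' k P a a')
    (h' : IntegralRelation A' B' A'' B'' k' P' a₂ a₂')
    (h0 : HasLevel (rescale A') (rescale B') 0) :
    ∃ s : ℤ_[2][X], s ^ 2 = a' ^ 2 ∧ s.natDegree ≤ 2 ∧
      (∃ x, s.coeff 0 = 4 * x) ∧ (∃ x, s.coeff 1 = 4 * x) ∧ (∃ x, s.coeff 2 = 1 + 4 * x) := by
  obtain ⟨⟨x₀, e₀⟩, ⟨x₁, e₁⟩, x₂, e₂⟩ := h'.coeff_of_hasLevel_zero h0
  obtain ⟨u, hu, hA⟩ := h.exists_smul'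
  obtain ⟨v, hv, hA'⟩ := h'.exists_smul
  have hvv : C v⁻¹ * C v = 1 := by rw [← C_mul, inv_mul_cancel₀ hv, C_1]
  obtain ⟨Y, hY, hYa⟩ := exists_map_eq_of_mul (q := a') (x := C u * C v⁻¹) h'.ne_zero (by
    rw [hA, hA']; linear_combination -C u * rescale A' * hvv)
  obtain ⟨y, rfl⟩ : ∃ y, C y = Y := natDegree_eq_zero.1 (by
    rw [← natDegree_map_algebraMap, hY, ← C_mul, natDegree_C])
  have hy : PadicInt.toZMod y = 1 := by
    have : PadicInt.toZMod y ≠ 0 := fun h0 ↦ h.ne_zero' (by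
      rw [hYa, Polynomial.map_mul, map_C, h0, C_0, mul_zero])
    revert this
    generalize PadicInt.toZMod y = y
    revert y
    decide
  obtain ⟨z, rfl⟩ := exists_eq_one_add_two_mul hy
  have hz : PadicInt.toZMod z = 0 ∨ PadicInt.toZMod z = 1 := by
    generalize PadicInt.toZMod z = z
    revert z
    decide
  rcases hz with hz | hz
  · obtain ⟨w, rfl⟩ := exists_eq_two_mul hz
    refine ⟨a', rfl, h.natDegree_le', ?_⟩
    simp only [hYa, coeff_mul_C, e₀, e₁, e₂]
    exact ⟨⟨x₀ * (1 + 2 * (2 * w)), by ring⟩, ⟨x₁ * (1 + 2 * (2 * w)), by ring⟩,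
      ⟨x₂ + w + 4 * x₂ * w, by ring⟩⟩
  · obtain ⟨w, rfl⟩ := exists_eq_one_add_two_mul hz
    refine ⟨-a', neg_sq _, (natDegree_neg a').trans_le h.natDegree_le', ?_⟩
    simp only [hYa, coeff_neg, coeff_mul_C, e₀, e₁, e₂]
    exact ⟨⟨-x₀ * (1 + 2 * (1 + 2 * w)), by ring⟩, ⟨-x₁ * (1 + 2 * (1 + 2 * w)), by ring⟩,
      ⟨-1 - w - 3 * x₂ - 4 * x₂ * w, by ring⟩⟩

theorem false_of_hasLevel_zero {A'' B'' : ℚ[X]} {k' : ℕ} {P' a₂ a₂' : ℤ_[2][X]}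
    (h : IntegralRelation A B A' B' k P a a')
    (h' : IntegralRelation A' B' A'' B'' k' P' a₂ a₂')
    (h0 : HasLevel (rescale A) (rescale B) 0)
    (h0' : HasLevel (rescale A') (rescale B') 0) : False := by
  obtain ⟨s, hs, hsd, s₀, s₁, s₂⟩ := h.exists_sq_eq h' h0'
  obtain ⟨b, l, m, hb, hl, hm, hbm, hrel⟩ := h.exists_cofactor h0
  have heq := h.eq
  have hpos := h.pos
  have had := h.natDegree_le
  have hPd := h.natDegree_le_three
  have h4 (j : ℕ) : ((2 : ℤ_[2][X]) ^ j) ^ 2 = 4 ^ j := by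
    rw [← pow_mul, mul_comm, pow_mul]; norm_num
  obtain ⟨j, rfl⟩ := Nat.exists_eq_add_of_lt h.pos
  rw [zero_add] at hrel heq
  obtain ⟨a₀, a₁, a₂, m₀⟩ := level_zero (κ := 2 ^ j) h.natDegree_le' h.natDegree_le hl hb hm
    (by
      simp only [C_mul, C_pow, map_ofNat]
      linear_combination hrel + 4 * m * h4 j)
    h.ne_zero' hbm
  rw [← hs] at heq hrel
  rcases j with _ | _ | j
  · exact final_one hPd had hsd (heq.trans (by rw [map_ofNat]; ring)) a₀ s₀
  · exact final_two hPd had hsd (heq.trans (by rw [map_ofNat]; ring)) a₀ a₁ a₂ s₀ s₁ s₂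
  · refine final_three (κ := 2 ^ j) hsd had hl hb hm ?_ hbm m₀ a₀ a₁ a₂ s₀ s₁ s₂
    simp only [C_mul, C_pow, map_ofNat]
    linear_combination hrel + 64 * m * h4 j

end IntegralRelation

end LevelZero

section Degenerate

local notation "φ" => Polynomial.map (PadicInt.toZMod (p := 2))
local notation "ι" => Polynomial.map (algebraMap ℤ_[2] ℚ_[2])

theorem IsMumford.isReducedMumford_X_sub_C {B : ℚ[X]} {r : ℚ} (h : IsMumford ((X - C r) ^ 2) B) :
    IsReducedMumford (X - C r) (C (B.eval r)) := by
  refine ⟨⟨monic_X_sub_C r, ?_, ?_, ?_⟩, ?_⟩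
  · rw [natDegree_X_sub_C]; exact one_pos
  · rw [natDegree_X_sub_C]; exact one_le_two
  · obtain ⟨S, hS⟩ := (dvd_pow_self _ two_ne_zero).trans h.dvd
    obtain ⟨T, hT⟩ := X_sub_C_dvd_sub_C_eval (a := r) (p := B)
    exact ⟨S + T * (B + C (B.eval r)), by linear_combination hS + (B + C (B.eval r)) * hT⟩
  · rw [natDegree_C, natDegree_X_sub_C]; exact one_pos

theorem exists_eq_mul_of_degenerate {q : ℤ_[2]} (hq : q ≠ 0) {b Y : ℤ_[2][X]} {n : ℕ}
    (hb : b.natDegree ≤ 3)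
    (h : b ^ 2 = 4 ^ n * evenSextic ℤ_[2] + (C q * X - 1) ^ 2 * Y) : ∃ e, b.coeff 3 = q * e := by
  have hf : (evenSextic ℤ_[2]).natDegree ≤ 5 := by
    unfold evenSextic; compute_degree
  have hd : (C q * X - 1 : ℤ_[2][X]).natDegree = 1 := by
    rw [← C_1, natDegree_sub_C, natDegree_C_mul_X _ hq]
  have hd0 : (C q * X - 1 : ℤ_[2][X]) ^ 2 ≠ 0 :=
    pow_ne_zero 2 fun h0 ↦ by rw [h0, natDegree_zero] at hd; exact zero_ne_one hd
  have hY : Y.natDegree ≤ 4 := by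
    rcases eq_or_ne Y 0 with rfl | hY0
    · simp
    have := natDegree_mul hd0 hY0
    rw [natDegree_pow, hd, show (C q * X - 1) ^ 2 * Y = b ^ 2 - 4 ^ n * evenSextic ℤ_[2] by
      linear_combination -h] at this
    have hle : (b ^ 2 - 4 ^ n * evenSextic ℤ_[2]).natDegree ≤ max (2 * 3) 5 :=
      natDegree_sub_le_of_le (natDegree_pow_le_of_le 2 hb)
        ((natDegree_four_pow_mul n _).trans_le hf)
    omega
  have h6 := congrArg (coeff · 6) h
  have h1 : (b ^ 2).coeff (2 * 3) = b.coeff 3 ^ 2 := coeff_pow_of_natDegree_le hb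
  have h2 : ((C q * X - 1) ^ 2 * Y).coeff (2 + 4) = q ^ 2 * Y.coeff 4 := by
    rw [coeff_mul_add_eq_of_natDegree_le (natDegree_pow_le_of_le 2 hd.le) hY]
    congr 1
    have := coeff_pow_of_natDegree_le (m := 2) hd.le
    rw [mul_one] at this
    rw [this]
    simp [coeff_one]
  have h3 : (4 ^ n * evenSextic ℤ_[2]).coeff 6 = 0 :=
    coeff_eq_zero_of_natDegree_lt (by rw [natDegree_four_pow_mul]; omega)
  simp only [coeff_add, h3] at h6
  have h7 : b.coeff 3 ^ 2 = q ^ 2 * Y.coeff 4 := by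
    rw [← h1, ← h2, h6, zero_add]
  exact (IsIntegrallyClosed.pow_dvd_pow_iff two_ne_zero).1 ⟨_, h7⟩

theorem hasLevel_of_degenerate {B : ℚ[X]} {r : ℚ} {n : ℕ} (h : IsMumford ((X - C r) ^ 2) B)
    (hn : HasLevel (rescale ((X - C r) ^ 2)) (rescale B) n) :
    HasLevel (rescale (X - C r)) (rescale (C (B.eval r))) n := by
  obtain ⟨b, L, hb, hL, hbL⟩ := hn
  obtain ⟨S, hS⟩ := X_sub_C_dvd_sub_C_eval (a := r) (p := B)
  obtain ⟨W, hW⟩ := h.dvd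
  replace hS := congrArg rescale hS
  replace hW := congrArg rescale hW
  simp only [map_sub, map_mul, map_pow, rescale_sextic, rescale_X, rescale_C] at hbL hS hW ⊢
  have h2 : (2 : ℚ_[2][X]) = C 2 := (map_ofNat C 2).symm
  obtain ⟨ρ, hρ⟩ : ∃ ρ : ℚ_[2], algebraMap ℚ ℚ_[2] r = 2 * ρ :=
    ⟨algebraMap ℚ ℚ_[2] r / 2, (mul_div_cancel₀ _ two_ne_zero).symm⟩
  have hN : 2 * X - C (algebraMap ℚ ℚ_[2] r) = 2 * (X - C ρ) := by
    rw [hρ, C_mul, ← h2]; ring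
  rw [hN] at hbL hS hW ⊢
  generalize hβ : algebraMap ℚ ℚ_[2] (B.eval r) = β at hS ⊢
  rcases le_or_gt ‖ρ‖ 1 with h1 | h1
  · have hev := congrArg (eval ρ) hbL
    have hSev := congrArg (eval ρ) hS
    simp only [eval_add, eval_sub, eval_mul, eval_pow, eval_C, eval_X, sub_self, mul_zero, zero_mul,
      ne_eq, OfNat.ofNat_ne_zero, not_false_eq_true, zero_pow, add_zero, eval_ofNat] at hev hSev
    refine ⟨C (b.eval ⟨ρ, h1⟩), 0, by simp, by simp, ?_⟩
    rw [mul_zero, add_zero, map_C, show (4 : ℚ_[2][X]) = C 4 from (map_ofNat C 4).symm, h2,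
      ← C_pow, ← C_mul, ← C_mul, ← sub_eq_zero.1 hSev, ← hev]
    congr 2
    exact (eval_map_apply (algebraMap ℤ_[2] ℚ_[2]) ⟨ρ, h1⟩).symm
  · have hρ0 : ρ ≠ 0 := by
      rintro rfl
      rw [norm_zero] at h1
      exact h1.not_ge zero_le_one
    obtain ⟨q, hq⟩ : ∃ q : ℤ_[2], algebraMap ℤ_[2] ℚ_[2] q = ρ⁻¹ :=
      ⟨⟨ρ⁻¹, by rw [norm_inv]; exact inv_le_one_of_one_le₀ h1.le⟩, rfl⟩
    have hq0 : q ≠ 0 := by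
      rintro rfl
      rw [map_zero] at hq
      exact inv_ne_zero hρ0 hq.symm
    have hQ : C ρ⁻¹ * C ρ = 1 := by rw [← C_mul, inv_mul_cancel₀ hρ0, C_1]
    have h14 : 4 * C (1 / 4 : ℚ_[2]) = 1 := by rw [← map_ofNat C 4, ← C_mul]; norm_num
    have h4 : ((2 : ℚ_[2][X]) ^ n) ^ 2 = 4 ^ n := by rw [← pow_mul, mul_comm, pow_mul]; norm_num
    have h16 : (16 : ℚ_[2][X]) ≠ 0 := by rw [← map_ofNat C 16]; exact C_ne_zero.2 (by norm_num)
    have haρ : (C ρ⁻¹ * X - 1) ^ 2 * C ρ ^ 2 = (X - C ρ) ^ 2 := by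
      linear_combination X * (X * (C ρ⁻¹ * C ρ + 1) - 2 * C ρ) * hQ
    have ha : φ ((C q * X - 1) ^ 2) ≠ 0 := by
      rw [Polynomial.map_pow]
      refine pow_ne_zero 2 fun h ↦ ?_
      have := congrArg (coeff · 0) h
      simp at this
    obtain ⟨Y, -, hY⟩ := exists_map_eq_of_mul (q := b ^ 2 - 4 ^ n * evenSextic ℤ_[2]) ha
      (x := C (1 / 4) * C ρ ^ 2 * (-4 ^ n * rescale W + 2 * 2 ^ n * rescale B * L +
        4 * (X - C ρ) ^ 2 * L ^ 2)) (by
        refine mul_left_cancel₀ h16 ?_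
        simp only [Polynomial.map_sub, Polynomial.map_mul, Polynomial.map_pow, Polynomial.map_ofNat,
          Polynomial.map_one, map_C, map_X, evenSextic_map, hq]
        linear_combination (4 * ι b + 2 ^ n * rescale B + (2 * (X - C ρ)) ^ 2 * L) * hbL -
          4 ^ n * hW + rescale B ^ 2 * h4 -
          (16 * C (1 / 4) * haρ + 4 * (X - C ρ) ^ 2 * h14) * (-4 ^ n * rescale W +
            2 * 2 ^ n * rescale B * L + 4 * (X - C ρ) ^ 2 * L ^ 2))
    obtain ⟨e, he⟩ := exists_eq_mul_of_degenerate hq0 (Y := Y) (n := n) hb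
      (by linear_combination hY)
    have hd : (C q * X - 1 : ℤ_[2][X]).natDegree ≤ 1 := by
      rw [← C_1]; exact natDegree_sub_C.trans_le ((natDegree_C_mul_le _ _).trans natDegree_X_le)
    have hd3 : (C e * X ^ 2 * (C q * X - 1)).natDegree ≤ 2 + 1 :=
      natDegree_mul_le_of_le (natDegree_C_mul_X_pow_le e 2) hd
    have hb₁ : (b - C e * X ^ 2 * (C q * X - 1)).natDegree ≤ 2 := by
      refine natDegree_le_pred (n := 3) ((natDegree_sub_le_of_le hb hd3).trans (by omega)) ?_
      rw [coeff_sub, he, coeff_mul_add_eq_of_natDegree_le (natDegree_C_mul_X_pow_le e 2) hd]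
      simp [coeff_one]
      ring
    have heq : 4 * ι (b - C e * X ^ 2 * (C q * X - 1)) = 2 ^ n * C β + 2 * (X - C ρ) *
        (2 ^ n * rescale S + 2 * (X - C ρ) * L - 2 * C (algebraMap ℤ_[2] ℚ_[2] e) * C ρ⁻¹ * X ^ 2) := by
      simp only [Polynomial.map_sub, Polynomial.map_mul, Polynomial.map_pow, Polynomial.map_one,
        map_C, map_X, hq]
      linear_combination hbL + 2 ^ n * hS - 4 * C (algebraMap ℤ_[2] ℚ_[2] e) * X ^ 2 * hQ
    refine ⟨_, _, hb₁.trans (by omega), ?_, heq⟩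
    generalize 2 ^ n * rescale S + 2 * (X - C ρ) * L -
      2 * C (algebraMap ℤ_[2] ℚ_[2] e) * C ρ⁻¹ * X ^ 2 = l at heq ⊢
    rcases eq_or_ne l 0 with rfl | hl
    · simp
    have hle : (2 ^ 1 * ((X - C ρ) * l)).natDegree ≤ 2 := by
      rw [show 2 ^ 1 * ((X - C ρ) * l) = 2 ^ 2 * ι (b - C e * X ^ 2 * (C q * X - 1)) -
        2 ^ n * C β by linear_combination -heq]
      refine (natDegree_sub_le_of_le (m := 2) (n := 2) ?_ ?_).trans (by omega)
      · rwa [natDegree_ofNat_pow_mul, natDegree_map_algebraMap]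
      · rw [natDegree_ofNat_pow_mul, natDegree_C]; omega
    rw [natDegree_ofNat_pow_mul, natDegree_mul (X_sub_C_ne_zero ρ) hl, natDegree_X_sub_C] at hle
    omega

end Degenerate

theorem IsReducedMumford.exists_nondegenerate {A B : ℚ[X]} {n : ℕ} (h : IsReducedMumford A B)
    (hn : HasLevel (rescale A) (rescale B) n) :
    ∃ A' B', IsReducedMumford A' B' ∧ HasLevel (rescale A') (rescale B') n ∧
      (∀ r, A' ≠ (X - C r) ^ 2) ∧ (A'.natDegree = 1 ∨ A' = A) := by
  by_cases hA : ∃ r, A = (X - C r) ^ 2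
  · obtain ⟨r, rfl⟩ := hA
    refine ⟨_, _, h.1.isReducedMumford_X_sub_C, hasLevel_of_degenerate h.1 hn, fun s hs ↦ ?_,
      .inl (natDegree_X_sub_C r)⟩
    have := congrArg natDegree hs
    rw [natDegree_X_sub_C, natDegree_pow, natDegree_X_sub_C] at this
    omega
  · exact ⟨A, B, h, hn, fun r hr ↦ hA ⟨r, hr⟩, .inr rfl⟩

theorem IsReducedMumford.ne_sq_of_hasLevel_zero {A B : ℚ[X]} (h : IsReducedMumford A B)
    (h0 : HasLevel (rescale A) (rescale B) 0) (r : ℚ) : A ≠ (X - C r) ^ 2 := by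
  obtain ⟨A', B', h', h0', hA', hd | rfl⟩ := h.exists_nondegenerate h0
  · obtain ⟨A₂, B₂, k, P, a, a', -, hrel⟩ := h'.exists_integralRelation hA'
    have := hrel.natDegree_eq_two_of_hasLevel_zero h0'
    omega
  · exact hA' r

theorem IsReducedMumford.not_hasLevel_zero {A B : ℚ[X]} (h : IsReducedMumford A B) :
    ¬ HasLevel (rescale A) (rescale B) 0 := fun h0 ↦ by
  obtain ⟨A₁, B₁, k, P, a, a', h₁, hrel⟩ :=
    h.exists_integralRelation (h.ne_sq_of_hasLevel_zero h0)
  have h0₁ := hrel.hasLevel_zero h0 fun _ _ ↦ Nat.zero_le _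
  obtain ⟨A₂, B₂, k', P', a₂, a₂', -, hrel'⟩ :=
    h₁.exists_integralRelation (h₁.ne_sq_of_hasLevel_zero h0₁)
  exact hrel.false_of_hasLevel_zero hrel' h0 h0₁

theorem IsReducedMumford.not_hasLevel {A B : ℚ[X]} (h : IsReducedMumford A B) (n : ℕ) :
    ¬ HasLevel (rescale A) (rescale B) n := by
  induction n using Nat.strong_induction_on generalizing A B with
  | _ n ih =>
    intro hn
    obtain ⟨A', B', h', hn', hA', -⟩ := h.exists_nondegenerate hn
    obtain ⟨A₁, B₁, k, P, a, a', h₁, hrel⟩ := h'.exists_integralRelation hA'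
    exact h₁.not_hasLevel_zero
      (hrel.hasLevel_zero hn' fun m hm ↦ le_of_not_gt fun hlt ↦ ih m hlt h₁ hm)

theorem not_isReducedMumford {A B : ℚ[X]} (hA : ∀ r, A ≠ (X - C r) ^ 2) :
    ¬ IsReducedMumford A B := fun h ↦ by
  obtain ⟨A₁, B₁, k, P, a, a', -, hrel⟩ := h.exists_integralRelation hA
  exact h.not_hasLevel k hrel.hasLevel

theorem no_rational_points_case6_j0 :
    ¬ ∃ x y : ℚ, y ^ 2 = 10 * x ^ 5 + 75 * x ^ 4 + 300 * x ^ 3 + 450 * x ^ 2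
      + 450 * x + 135 := by
  rintro ⟨x, y, h⟩
  refine not_isReducedMumford (A := X - C (2 * (x + 1))) (B := C (4 * y)) (fun r hr ↦ ?_)
    ⟨⟨monic_X_sub_C _, ?_, ?_, ?_⟩, ?_⟩
  · have := congrArg natDegree hr
    rw [natDegree_X_sub_C, natDegree_pow, natDegree_X_sub_C] at this
    omega
  · rw [natDegree_X_sub_C]; exact one_pos
  · rw [natDegree_X_sub_C]; exact one_le_two
  · rw [dvd_iff_isRoot, IsRoot.def]
    simp only [sextic, eval_sub, eval_add, eval_mul, eval_pow, eval_X, eval_C, eval_ofNat]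
    linear_combination -16 * h
  · rw [natDegree_C, natDegree_X_sub_C]; exact one_pos
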